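/- The family of symmetric products of closed orientable surfaces is LS-logarithmic: for every integer k ≥ 1 and all pairs of integers (n_1,g_1),…,(n_k,g_k) with n_j ≥ 1 and g_j ≥ 0, one has cat(SP^{n_1}(M_{g_1}) × ⋯ × SP^{n_k}(M_{g_k})) = Σ_{j=1}^k cat(SP^{n_j}(M_{g_j})). In particular, cat((SP^n(M_g))^m) = m·cat(SP^n(M_g)) for all m, n ≥ 1 and g ≥ 0. -/

import Mathlib

open scoped unitInterval Topology
open MeasureTheory
noncomputable section

/-- The `n`-th symmetric product relation on `X^n`: two tuples are related iff they
differ by a permutation of coordinates. -/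
def spRel (n : ℕ) (X : Type*) (s t : Fin n → X) : Prop :=
  ∃ e : Equiv.Perm (Fin n), s ∘ e = t

/-- The `n`-th symmetric product of a topological space `X`: the quotient of the
product space `X^n` by the permutation action of the symmetric group `S_n`,
equipped with the quotient topology. -/
def SP (n : ℕ) (X : Type*) [TopologicalSpace X] : Type _ :=
  Quot (spRel n X)

instance (n : ℕ) (X : Type*) [TopologicalSpace X] : TopologicalSpace (SP n X) :=
  inferInstanceAs (TopologicalSpace (Quot (spRel n X)))

/-- The inclusion of a subset, as a continuous map. -/
def inclMap {X : Type*} [TopologicalSpace X] (U : Set X) : C(U, X) :=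
  ⟨Subtype.val, continuous_subtype_val⟩

/-- `catLE X r` : `X` is covered by `r+1` open sets, each of whose inclusion maps
into `X` is null-homotopic. -/
def catLE (X : Type*) [TopologicalSpace X] (r : ℕ) : Prop :=
  ∃ U : Fin (r + 1) → Set X, (∀ i, IsOpen (U i)) ∧ (⋃ i, U i) = Set.univ ∧
    ∀ i, (inclMap (U i)).Nullhomotopic

/-- The Lusternik–Schnirelmann category of `X`, valued in `ℕ∞`. -/
def LScat (X : Type*) [TopologicalSpace X] : ℕ∞ :=
  sInf {c : ℕ∞ | ∃ r : ℕ, catLE X r ∧ c = r}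

/-- The closed unit disc (a topological model for a polygon). -/
abbrev Disc : Type := {z : ℂ // ‖z‖ ≤ 1}

/-- The point at parameter `t ∈ [0,1]` on the `k`-th of the `N` boundary edges of an
`N`-gon, realized as the closed unit disc whose boundary circle is divided into `N` arcs. -/
def polyBP (N k : ℕ) (t : ℝ) : ℂ :=
  Complex.exp (2 * Real.pi * Complex.I * (((k : ℝ) + t) / (N : ℝ)))

/-- Boundary identifications of the `4g`-gon for the edge word
`[a₁,b₁]⋯[a_g,b_g] = a₁b₁a₁⁻¹b₁⁻¹⋯a_gb_ga_g⁻¹b_g⁻¹` : the point at parameter `t`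
on edge `4j+r` (`r = 0,1`) is glued to the point at parameter `1-t` on edge `4j+r+2`. -/
def orientRel (g : ℕ) (z w : Disc) : Prop :=
  ∃ j : Fin g, ∃ r : Fin 2, ∃ t : ℝ, 0 ≤ t ∧ t ≤ 1 ∧
    (z : ℂ) = polyBP (4 * g) (4 * (j : ℕ) + (r : ℕ)) t ∧
    (w : ℂ) = polyBP (4 * g) (4 * (j : ℕ) + (r : ℕ) + 2) (1 - t)

/-- The closed orientable surface of genus `g` : the `2`-sphere for `g = 0`, and for
`g ≥ 1` the quotient of the `4g`-gon by the boundary edge word `[a₁,b₁]⋯[a_g,b_g]`. -/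
def Mg : ℕ → Type
  | 0 => Metric.sphere (0 : EuclideanSpace ℝ (Fin 3)) 1
  | (g + 1) => Quot (orientRel (g + 1))

instance (g : ℕ) : TopologicalSpace (Mg g) := by
  cases g with
  | zero =>
      exact inferInstanceAs (TopologicalSpace (Metric.sphere (0 : EuclideanSpace ℝ (Fin 3)) 1))
  | succ g => exact inferInstanceAs (TopologicalSpace (Quot (orientRel (g + 1))))

namespace LSP
set_option linter.all false
set_option autoImplicit false
open Topology

/-! ### Symmetric products -/

section SPbasics
variable {X Y : Type*} [TopologicalSpace X] [TopologicalSpace Y] {n : ℕ}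

def spMk (s : Fin n → X) : SP n X := Quot.mk _ s

lemma spRel_equiv : Equivalence (spRel n X) where
  refl s := ⟨1, rfl⟩
  symm := by
    rintro s t ⟨e, rfl⟩
    exact ⟨e.symm, by funext i; simp⟩
  trans := by
    rintro s t u ⟨e, rfl⟩ ⟨f, rfl⟩
    exact ⟨f.trans e, by funext i; simp⟩

lemma spMk_eq {s t : Fin n → X} : (spMk s : SP n X) = spMk t ↔ ∃ e : Equiv.Perm (Fin n), s ∘ e = t :=
  ⟨fun h => (spRel_equiv (n := n) (X := X)).eqvGen_iff.1 (Quot.eqvGen_exact h),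
    fun h => Quot.sound h⟩

lemma spMk_surj : Function.Surjective (spMk : (Fin n → X) → SP n X) := Quot.exists_rep

lemma spMk_isQuotientMap : IsQuotientMap (spMk : (Fin n → X) → SP n X) :=
  isQuotientMap_quot_mk

lemma spMk_cont : Continuous (spMk : (Fin n → X) → SP n X) := continuous_quot_mk

lemma permComp_cont (e : Equiv.Perm (Fin n)) : Continuous (fun s : Fin n → X => s ∘ e) :=
  continuous_pi fun i => continuous_apply (e i)

lemma spMk_preimage_image (S : Set (Fin n → X)) :
    spMk ⁻¹' (spMk '' S : Set (SP n X)) = ⋃ e : Equiv.Perm (Fin n), (fun s : Fin n → X => s ∘ e) ⁻¹' S := by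
  ext s
  simp only [Set.mem_preimage, Set.mem_image, Set.mem_iUnion]
  constructor
  · rintro ⟨t, ht, h⟩
    obtain ⟨e, he⟩ := spMk_eq.1 h.symm
    exact ⟨e, by rwa [he]⟩
  · rintro ⟨e, he⟩
    exact ⟨_, he, (spMk_eq.2 ⟨e, rfl⟩).symm⟩

lemma spMk_open : IsOpenMap (spMk : (Fin n → X) → SP n X) := by
  intro S hS
  rw [← spMk_isQuotientMap.isOpen_preimage, spMk_preimage_image]
  exact isOpen_iUnion fun e => hS.preimage (permComp_cont e)

lemma spMk_oq : IsOpenQuotientMap (spMk : (Fin n → X) → SP n X) :=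
  ⟨spMk_surj, spMk_cont, spMk_open⟩

/-- functoriality -/
def spMap (f : X → Y) : SP n X → SP n Y :=
  Quot.lift (fun s => spMk (f ∘ s)) (by
    rintro s t ⟨e, rfl⟩
    exact spMk_eq.2 ⟨e, rfl⟩)

@[simp] lemma spMap_mk (f : X → Y) (s : Fin n → X) : spMap f (spMk s) = spMk (f ∘ s) := rfl

/-- tuples all of whose entries are in `S` -/
def spSet (n : ℕ) (S : Set X) : Set (SP n X) :=
  {D | Quot.lift (fun s : Fin n → X => ∀ l, s l ∈ S) (by
    rintro s t ⟨e, rfl⟩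
    exact propext ⟨fun h l => h _, fun h l => by simpa using h (e.symm l)⟩) D}

@[simp] lemma mem_spSet (S : Set X) (s : Fin n → X) : spMk s ∈ spSet n S ↔ ∀ l, s l ∈ S := Iff.rfl

lemma isOpen_spSet {S : Set X} (hS : IsOpen S) : IsOpen (spSet n S) := by
  rw [← spMk_isQuotientMap.isOpen_preimage]
  have : spMk ⁻¹' (spSet n S) = ⋂ l : Fin n, (fun s : Fin n → X => s l) ⁻¹' S := by
    ext s; simp
  rw [this]
  exact isOpen_iInter_of_finite fun l => hS.preimage (continuous_apply l)

/-- symmetric sum -/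
def spSum {A : Type*} [AddCommMonoid A] (f : X → A) : SP n X → A :=
  Quot.lift (fun s => ∑ l, f (s l)) (by
    rintro s t ⟨e, rfl⟩
    exact (Equiv.sum_comp e (fun l => f (s l))).symm)

@[simp] lemma spSum_mk {A : Type*} [AddCommMonoid A] (f : X → A) (s : Fin n → X) :
    spSum f (spMk s : SP n X) = ∑ l, f (s l) := rfl

lemma spSum_cont {A : Type*} [AddCommMonoid A] [TopologicalSpace A] [ContinuousAdd A] {f : X → A}
    (hf : Continuous f) : Continuous (spSum f : SP n X → A) := by
  refine continuous_quot_lift _ ?_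
  exact continuous_finsetSum _ fun l _ => hf.comp (continuous_apply l)

end SPbasics

/-! ### Homotopies on subsets -/

section Hom
variable {X Y Z W : Type*} [TopologicalSpace X] [TopologicalSpace Y] [TopologicalSpace Z]
  [TopologicalSpace W]

def HomOn (S : Set X) (f g : X → Z) : Prop :=
  ∃ H : I × X → Z, ContinuousOn H (Set.univ ×ˢ S) ∧ ∀ x ∈ S, H (0, x) = f x ∧ H (1, x) = g x

def NullOn (S : Set X) : Prop := ∃ y : X, HomOn S id (fun _ => y)

lemma HomOn.mono {S T : Set X} {f g : X → Z} (h : HomOn S f g) (hT : T ⊆ S) : HomOn T f g := by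
  obtain ⟨H, hH, h1⟩ := h
  exact ⟨H, hH.mono (Set.prod_mono le_rfl hT), fun x hx => h1 x (hT hx)⟩

lemma HomOn.congr {S : Set X} {f g f' g' : X → Z} (h : HomOn S f g) (hf : ∀ x ∈ S, f x = f' x)
    (hg : ∀ x ∈ S, g x = g' x) : HomOn S f' g' := by
  obtain ⟨H, hH, h1⟩ := h
  exact ⟨H, hH, fun x hx => ⟨(h1 x hx).1.trans (hf x hx), (h1 x hx).2.trans (hg x hx)⟩⟩

lemma HomOn.refl {S : Set X} {f : X → Z} (hf : ContinuousOn f S) : HomOn S f f :=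
  ⟨fun p => f p.2, hf.comp continuous_snd.continuousOn (fun p hp => hp.2), fun _ _ => ⟨rfl, rfl⟩⟩

lemma HomOn.symm {S : Set X} {f g : X → Z} (h : HomOn S f g) : HomOn S g f := by
  obtain ⟨H, hH, h1⟩ := h
  refine ⟨fun p => H (unitInterval.symm p.1, p.2), hH.comp (by fun_prop) ?_, fun x hx => ?_⟩
  · rintro ⟨t, x⟩ ⟨_, hx⟩; exact ⟨trivial, hx⟩
  · simpa using (h1 x hx).symm

lemma HomOn.postcomp {S : Set X} {f g : X → Z} (h : HomOn S f g) {k : Z → W} 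
    (hk : Continuous k) : HomOn S (k ∘ f) (k ∘ g) := by
  obtain ⟨H, hH, h1⟩ := h
  refine ⟨fun p => k (H p), hk.comp_continuousOn hH, fun x hx => ?_⟩
  simp [h1 x hx]

lemma HomOn.precomp {S : Set X} {f g : X → Z} (h : HomOn S f g) {T : Set Y} {k : Y → X} 
    (hk : ContinuousOn k T) (hT : Set.MapsTo k T S) : HomOn T (f ∘ k) (g ∘ k) := by
  obtain ⟨H, hH, h1⟩ := h
  refine ⟨fun p => H (p.1, k p.2), hH.comp ?_ ?_, fun x hx => ?_⟩
  · exact continuous_fst.continuousOn.prodMk (hk.comp continuous_snd.continuousOn (fun p hp => hp.2))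
  · rintro ⟨t, x⟩ ⟨_, hx⟩; exact ⟨trivial, hT hx⟩
  · simp [h1 _ (hT hx)]

lemma homOn_iff {S : Set X} {f g : X → Z} : HomOn S f g ↔
    ∃ F G : C(S, Z), F.Homotopic G ∧ (∀ x, F x = f x) ∧ (∀ x, G x = g x) := by
  constructor
  · rintro ⟨H, hH, h1⟩
    have hc : Continuous (fun p : I × S => H (p.1, p.2)) := by
      refine hH.comp_continuous (by fun_prop) ?_
      rintro ⟨t, x⟩; exact ⟨trivial, x.2⟩
    refine ⟨⟨fun x => H (0, x), hc.comp (by fun_prop : Continuous fun x : S => ((0 : I), x))⟩, ⟨fun x => H (1, x), hc.comp (by fun_prop : Continuous fun x : S => ((1 : I), x))⟩, ⟨⟨⟨fun p => H (p.1, p.2), hc⟩,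
      fun x => rfl, fun x => rfl⟩⟩, fun x => (h1 x x.2).1, fun x => (h1 x x.2).2⟩
  · rintro ⟨F, G, ⟨H⟩, hF, hG⟩
    classical
    by_cases hne : Nonempty X
    · obtain ⟨x0⟩ := hne
      refine ⟨fun p => if hp : p.2 ∈ S then H (p.1, ⟨p.2, hp⟩) else f p.2, ?_, fun x hx => ?_⟩
      · rw [continuousOn_iff_continuous_domRestrict]
        have : Continuous (fun q : (Set.univ ×ˢ S : Set (I × X)) => H (q.1.1, ⟨q.1.2, q.2.2⟩)) := by
          fun_prop
        refine this.congr ?_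
        rintro ⟨⟨t, x⟩, ht, hx⟩
        simp only at hx
        simp [hx]
      · simp [hx, hF, hG]
    · refine ⟨fun p => f p.2, ?_, fun x hx => (hne ⟨x⟩).elim⟩
      have : IsEmpty X := not_nonempty_iff.1 hne
      intro p; exact isEmptyElim p.2

lemma HomOn.trans {S : Set X} {f g k : X → Z} (h : HomOn S f g) (h' : HomOn S g k) : HomOn S f k := by
  rw [homOn_iff] at *
  obtain ⟨F, G, h1, hF, hG⟩ := h
  obtain ⟨F', G', h1', hF', hG'⟩ := h'
  have : G = F' := by ext x; rw [hG, hF']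
  subst this
  exact ⟨F, G', h1.trans h1', hF, hG'⟩

lemma nullOn_iff {S : Set X} : NullOn S ↔ (inclMap S).Nullhomotopic := by
  constructor
  · rintro ⟨y, h⟩
    rw [homOn_iff] at h
    obtain ⟨F, G, h1, hF, hG⟩ := h
    refine ⟨y, ?_⟩
    convert h1
    · ext x; exact (hF x).symm
    · ext x; exact (hG x).symm
  · rintro ⟨y, h⟩
    exact ⟨y, homOn_iff.2 ⟨_, _, h, fun x => rfl, fun x => rfl⟩⟩

lemma HomOn.pi {ι : Type*} {X Z : ι → Type*} [∀ j, TopologicalSpace (X j)] [∀ j, TopologicalSpace (Z j)]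
    {S : ∀ j, Set (X j)}
    {f g : ∀ j, X j → Z j} (h : ∀ j, HomOn (S j) (f j) (g j)) :
    HomOn (Set.univ.pi S) (fun x j => f j (x j)) (fun x j => g j (x j)) := by
  choose H hH h1 using h
  refine ⟨fun p j => H j (p.1, p.2 j), ?_, fun x hx => ⟨?_, ?_⟩⟩
  · refine continuousOn_pi.2 fun j => ?_
    refine (hH j).comp (by fun_prop) ?_
    rintro ⟨t, x⟩ ⟨_, hx⟩; exact ⟨trivial, hx j trivial⟩
  · funext j; exact (h1 j _ (hx j trivial)).1
  · funext j; exact (h1 j _ (hx j trivial)).2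

/-- homotopies through symmetric products -/
lemma HomOn.sp {n : ℕ} {S : Set X} (hS : IsOpen S) {f g : X → Z} (h : HomOn S f g) :
    HomOn (spSet n S) (spMap f) (spMap g) := by
  obtain ⟨H, hH, h1⟩ := h
  refine ⟨fun p => spMap (fun x => H (p.1, x)) p.2, ?_, ?_⟩
  · rintro ⟨t, D⟩ ⟨_, hD⟩
    apply ContinuousAt.continuousWithinAt
    obtain ⟨s, rfl⟩ := spMk_surj D
    have hq : IsOpenQuotientMap (Prod.map id spMk : I × (Fin n → X) → I × SP n X) :=
      IsOpenQuotientMap.id.prodMap spMk_oq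
    refine (hq.continuousAt_comp_iff (x := (t, s)) (g := fun p : I × SP n X => spMap (fun x => H (p.1, x)) p.2)).1 ?_
    refine ContinuousAt.comp (g := spMk) spMk_cont.continuousAt 
      (f := fun p : I × (Fin n → X) => fun l => H (p.1, p.2 l)) ?_
    refine continuousAt_pi.2 fun l => ?_
    refine ContinuousAt.comp (g := H) (f := fun p : I × (Fin n → X) => (p.1, p.2 l)) ?_ (by fun_prop)
    exact hH.continuousAt ((isOpen_univ.prod hS).mem_nhds ⟨trivial, hD l⟩)
  · intro D hD
    obtain ⟨s, rfl⟩ := spMk_surj D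
    constructor
    · simp only [spMap_mk]; congr 1; funext l; exact (h1 _ (hD l)).1
    · simp only [spMap_mk]; congr 1; funext l; exact (h1 _ (hD l)).2

end Hom

/-! ### Features -/

def HasFeat (X : Type*) [TopologicalSpace X] (c : ℕ) : Prop :=
  ∃ N : ℝ → ℝ → Set X, (∀ a b, 0 < a → a < b → b < 1/4 → IsOpen (N a b) ∧ NullOn (N a b)) ∧
    ∀ x, ∃ S : Finset ℝ, S.card ≤ c ∧
      ∀ a b, 0 < a → a < b → b < 1/4 → (∀ s ∈ S, s ∉ Set.Icc a b) → x ∈ N a b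

lemma HasFeat.catLE {X : Type*} [TopologicalSpace X] {c : ℕ} (h : HasFeat X c) : catLE X c := by
  obtain ⟨N, hN, hS⟩ := h
  set a : Fin (c+1) → ℝ := fun i => (2 * (i:ℝ) + 1) / (8 * (c + 2)) with ha
  set b : Fin (c+1) → ℝ := fun i => (2 * (i:ℝ) + 2) / (8 * (c + 2)) with hb
  have hc : (0:ℝ) < 8 * (c + 2) := by positivity
  have ha0 : ∀ i, 0 < a i := fun i => by simp only [ha]; positivity
  have hab : ∀ i, a i < b i := fun i => by
    simp only [ha, hb]; gcongr; norm_num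
  have hb1 : ∀ i, b i < 1/4 := fun i => by
    simp only [hb]
    rw [div_lt_iff₀ hc]
    have : (i:ℝ) ≤ c := by exact_mod_cast Nat.lt_succ_iff.1 i.2
    linarith
  have hba : ∀ i j : Fin (c+1), i < j → b i < a j := fun i j hij => by
    simp only [ha, hb]
    have : ((i:ℕ):ℝ) + 1 ≤ (j:ℕ) := by exact_mod_cast hij
    rw [div_lt_div_iff_of_pos_right hc]
    linarith
  refine ⟨fun i => N (a i) (b i), fun i => (hN _ _ (ha0 i) (hab i) (hb1 i)).1, ?_,
    fun i => nullOn_iff.1 (hN _ _ (ha0 i) (hab i) (hb1 i)).2⟩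
  rw [Set.eq_univ_iff_forall]
  intro x
  obtain ⟨S, hc1, hx⟩ := hS x
  by_contra hcon
  have : ∀ i, ∃ s ∈ S, s ∈ Set.Icc (a i) (b i) := by
    intro i
    by_contra! h
    exact hcon (Set.mem_iUnion.2 ⟨i, hx _ _ (ha0 i) (hab i) (hb1 i) h⟩)
  choose f hf hf' using this
  have hinj : Function.Injective f := by
    intro i j hij
    by_contra hne
    rcases lt_or_gt_of_ne hne with h | h
    · have := hba _ _ h
      have h1 := (hf' i).2; have h2 := (hf' j).1; rw [hij] at h1; linarith
    · have := hba _ _ h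
      have h1 := (hf' j).2; have h2 := (hf' i).1; rw [hij] at h2; linarith
  have := Finset.card_le_card_of_injOn (s := Finset.univ) (t := S) f (fun i _ => hf i) hinj.injOn
  simp at this
  omega

lemma HasFeat.pi {k : ℕ} {X : Fin k → Type*} [∀ j, TopologicalSpace (X j)] {c : Fin k → ℕ}
    (h : ∀ j, HasFeat (X j) (c j)) : HasFeat (∀ j, X j) (∑ j, c j) := by
  classical
  choose N hN hS using h
  refine ⟨fun a b => Set.univ.pi fun j => N j a b, fun a b h1 h2 h3 => ⟨?_, ?_⟩, fun x => ?_⟩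
  · exact isOpen_set_pi Set.finite_univ fun j _ => (hN j a b h1 h2 h3).1
  · choose y hy using fun j => (hN j a b h1 h2 h3).2
    exact ⟨y, HomOn.pi hy⟩
  · choose S hc hx using fun j => hS j (x j)
    refine ⟨Finset.univ.biUnion S, Finset.card_biUnion_le.trans (Finset.sum_le_sum fun j _ => hc j), ?_⟩
    intro a b h1 h2 h3 h j _
    exact hx j a b h1 h2 h3 fun s hs => h s (Finset.mem_biUnion.2 ⟨j, Finset.mem_univ _, hs⟩)

lemma catLE_mono {X : Type*} [TopologicalSpace X] {r s : ℕ} (h : catLE X r) (hrs : r ≤ s) : catLE X s := by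
  obtain ⟨U, h1, h2, h3⟩ := h
  have hlt : ∀ i : Fin (s+1), min (i:ℕ) r < r + 1 := fun i => by omega
  refine ⟨fun i => U ⟨min (i:ℕ) r, hlt i⟩, fun i => h1 _, ?_, fun i => h3 _⟩
  rw [Set.eq_univ_iff_forall] at *
  intro x
  obtain ⟨i, hi⟩ := Set.mem_iUnion.1 (h2 x)
  refine Set.mem_iUnion.2 ⟨⟨i, by omega⟩, ?_⟩
  convert hi
  simp; omega

lemma LScat_eq {X : Type*} [TopologicalSpace X] {c : ℕ} (h : catLE X c) (h' : ∀ r, catLE X r → c ≤ r) :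
    LScat X = c := by
  refine le_antisymm (sInf_le ⟨c, h, rfl⟩) (le_sInf ?_)
  rintro _ ⟨r, hr, rfl⟩
  exact_mod_cast h' r hr

lemma catLE_homeo {X Y : Type*} [TopologicalSpace X] [TopologicalSpace Y] (e : X ≃ₜ Y) {r : ℕ}
    (h : catLE X r) : catLE Y r := by
  obtain ⟨U, h1, h2, h3⟩ := h
  refine ⟨fun i => e.symm ⁻¹' U i, fun i => (h1 i).preimage e.symm.continuous, ?_, fun i => ?_⟩
  · rw [← Set.preimage_iUnion, h2, Set.preimage_univ]
  · rw [← nullOn_iff]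
    obtain ⟨y, hy⟩ := nullOn_iff.2 (h3 i)
    refine ⟨e y, ?_⟩
    have := (hy.precomp (k := e.symm) (T := e.symm ⁻¹' U i) e.symm.continuous.continuousOn
      (fun x hx => hx)).postcomp e.continuous
    exact this.congr (fun x _ => by simp) (fun x _ => by simp)

lemma LScat_homeo {X Y : Type*} [TopologicalSpace X] [TopologicalSpace Y] (e : X ≃ₜ Y) :
    LScat X = LScat Y := by
  unfold LScat
  congr 1
  ext c
  exact ⟨fun ⟨r, h, hc⟩ => ⟨r, catLE_homeo e h, hc⟩, fun ⟨r, h, hc⟩ => ⟨r, catLE_homeo e.symm h, hc⟩⟩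

end LSP

namespace LSP
set_option linter.all false
set_option autoImplicit false
open Topology

/-! ### Parametrisation of the surfaces -/

/-- clamp to `[0,1]` -/
def cl (x : ℝ) : ℝ := max 0 (min 1 x)

@[fun_prop] lemma cl_cont : Continuous cl := by unfold cl; fun_prop
lemma cl_nonneg (x : ℝ) : 0 ≤ cl x := le_max_left _ _
lemma cl_le_one (x : ℝ) : cl x ≤ 1 := by unfold cl; simp
lemma cl_mem (x : ℝ) : cl x ∈ Set.Icc (0:ℝ) 1 := ⟨cl_nonneg x, cl_le_one x⟩
lemma cl_of_mem {x : ℝ} (h : x ∈ Set.Icc (0:ℝ) 1) : cl x = x := by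
  unfold cl; rw [min_eq_right h.2, max_eq_right h.1]
lemma cl_of_nonpos {x : ℝ} (h : x ≤ 0) : cl x = 0 := by
  unfold cl; rw [max_eq_left]; exact (min_le_right _ _).trans h
lemma cl_of_one_le {x : ℝ} (h : 1 ≤ x) : cl x = 1 := by
  unfold cl; rw [min_eq_left h]; simp
@[simp] lemma cl_zero : cl 0 = 0 := cl_of_nonpos le_rfl
@[simp] lemma cl_one : cl 1 = 1 := cl_of_one_le le_rfl

/-- boundary point at angle `θ` (measured in edges of the `4G`-gon) -/
def EE (G : ℕ) (θ : ℝ) : ℂ := Complex.exp ((2 * Real.pi * (θ / (4 * G)) : ℝ) * Complex.I)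

@[fun_prop] lemma EE_cont (G : ℕ) : Continuous (EE G) := by unfold EE; fun_prop

@[simp] lemma EE_norm (G : ℕ) (θ : ℝ) : ‖EE G θ‖ = 1 := Complex.norm_exp_ofReal_mul_I _

lemma EE_ne_zero (G : ℕ) (θ : ℝ) : EE G θ ≠ 0 := Complex.exp_ne_zero _

lemma polyBP_eq (G k : ℕ) (t : ℝ) : polyBP (4 * G) k t = EE G (k + t) := by
  unfold polyBP EE
  congr 1
  push_cast
  ring

lemma EE_period {G : ℕ} (hG : 0 < G) (θ : ℝ) : EE G (θ + 4 * G) = EE G θ := by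
  unfold EE
  have : (0:ℝ) < G := by exact_mod_cast hG
  rw [Complex.exp_eq_exp_iff_exists_int]
  refine ⟨1, ?_⟩
  have h : ((θ + 4 * G) / (4 * G) : ℝ) = θ / (4 * G) + 1 := by field_simp
  rw [h]
  push_cast
  ring

lemma EE_eq {G : ℕ} (hG : 0 < G) {θ θ' : ℝ} (h : EE G θ = EE G θ') : ∃ n : ℤ, θ = θ' + n * (4 * G) := by
  unfold EE at h
  have h0 : (0:ℝ) < G := by exact_mod_cast hG
  rw [Complex.exp_eq_exp_iff_exists_int] at h
  obtain ⟨n, hn⟩ := h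
  refine ⟨n, ?_⟩
  have h1 : (((2 * Real.pi * (θ / (4 * G)) : ℝ) : ℂ)) = ((2 * Real.pi * (θ' / (4 * G)) + n * (2 * Real.pi) : ℝ) : ℂ) := by
    apply mul_right_cancel₀ Complex.I_ne_zero
    rw [hn]; push_cast; ring
  have h2 := Complex.ofReal_injective h1
  have hp := Real.pi_pos
  have h3 : 2 * Real.pi * (θ / (4*G) - θ'/(4*G) - n) = 0 := by linarith
  have h4 : θ / (4*G) - θ'/(4*G) - n = 0 := by
    rcases mul_eq_zero.1 h3 with h | h
    · linarith
    · exact h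
  field_simp at h4
  linarith

/-- disc point in polar coordinates -/
def dpt (G : ℕ) (s θ : ℝ) : Disc := ⟨(cl s : ℂ) * EE G θ, by
  rw [norm_mul, EE_norm, mul_one, Complex.norm_real, Real.norm_of_nonneg (cl_nonneg s)]; exact cl_le_one s⟩

lemma dpt_val (G : ℕ) (s θ : ℝ) : (dpt G s θ : ℂ) = (cl s : ℂ) * EE G θ := rfl

lemma dpt_cont (G : ℕ) : Continuous (fun p : ℝ × ℝ => dpt G p.1 p.2) := by
  refine Continuous.subtype_mk ?_ _
  fun_prop

lemma dpt_norm (G : ℕ) (s θ : ℝ) : ‖(dpt G s θ : ℂ)‖ = cl s := by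
  rw [dpt_val, norm_mul, EE_norm, mul_one, Complex.norm_real, Real.norm_of_nonneg (cl_nonneg s)]

lemma dpt_surj {G : ℕ} (hG : 0 < G) (z : Disc) :
    ∃ (j : Fin G) (s θ : ℝ), s ∈ Set.Icc (0:ℝ) 1 ∧ θ ∈ Set.Icc (0:ℝ) 4 ∧ z = dpt G s (4 * j + θ) := by
  have h0 : (0:ℝ) < G := by exact_mod_cast hG
  have hp := Real.pi_pos
  obtain ⟨z, hz⟩ := z
  -- angle in [0, 4G)
  obtain ⟨φ, hφ0, hφ1, hφ⟩ : ∃ φ : ℝ, 0 ≤ φ ∧ φ < 4 * G ∧ z = (‖z‖ : ℂ) * EE G φ := by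
    have h1 : z = (‖z‖ : ℂ) * EE G (z.arg / (2 * Real.pi) * (4 * G)) := by
      conv_lhs => rw [← Complex.norm_mul_exp_arg_mul_I z]
      unfold EE
      congr 3
      congr 1
      field_simp
    have harg := Complex.arg_le_pi z
    have harg' := Complex.neg_pi_lt_arg z
    by_cases hn : 0 ≤ z.arg
    · refine ⟨_, by positivity, ?_, h1⟩
      have : z.arg / (2 * Real.pi) < 1 := by rw [div_lt_one (by positivity)]; linarith
      nlinarith
    · refine ⟨z.arg / (2 * Real.pi) * (4 * G) + 4 * G, ?_, ?_, ?_⟩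
      · have : -1 ≤ z.arg / (2 * Real.pi) := by rw [le_div_iff₀ (by positivity)]; linarith
        nlinarith
      · have : z.arg / (2 * Real.pi) < 0 := div_neg_of_neg_of_pos (by linarith) (by positivity)
        nlinarith
      · rw [EE_period hG]; exact h1
  have hj : ⌊φ/4⌋₊ < G := by
    rw [Nat.floor_lt (by positivity)]; linarith
  refine ⟨⟨⌊φ/4⌋₊, hj⟩, ‖z‖, φ - 4 * ⌊φ/4⌋₊, ⟨norm_nonneg _, hz⟩, ⟨?_, ?_⟩, ?_⟩
  · have := Nat.floor_le (show 0 ≤ φ/4 by positivity); linarith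
  · have := Nat.lt_floor_add_one (φ/4); linarith
  · apply Subtype.ext
    rw [dpt_val, cl_of_mem ⟨norm_nonneg _, hz⟩]
    conv_lhs => simp only []; rw [hφ]
    congr 2
    simp

lemma dpt_inj {G : ℕ} (hG : 0 < G) {s s' φ φ' : ℝ} (hs : s ∈ Set.Icc (0:ℝ) 1) (hs' : s' ∈ Set.Icc (0:ℝ) 1)
    (hφ : φ ∈ Set.Icc (0:ℝ) (4*G)) (hφ' : φ' ∈ Set.Icc (0:ℝ) (4*G)) (h : dpt G s φ = dpt G s' φ') :
    s = s' ∧ (s = 0 ∨ φ = φ' ∨ (φ = 0 ∧ φ' = 4*G) ∨ (φ = 4*G ∧ φ' = 0)) := by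
  have h0 : (0:ℝ) < G := by exact_mod_cast hG
  have h1 : s = s' := by
    have := congrArg (fun z : Disc => ‖(z:ℂ)‖) h
    simpa only [dpt_norm, cl_of_mem hs, cl_of_mem hs'] using this
  refine ⟨h1, ?_⟩
  subst h1
  by_cases hz : s = 0
  · exact Or.inl hz
  right
  have h2 := congrArg (fun z : Disc => (z:ℂ)) h
  simp only [dpt_val, cl_of_mem hs] at h2
  have h3 := mul_left_cancel₀ (Complex.ofReal_ne_zero.2 hz) h2
  obtain ⟨n, hn⟩ := EE_eq hG h3
  obtain ⟨a1, a2⟩ := hφ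
  obtain ⟨b1, b2⟩ := hφ'
  have hn1 : (n:ℝ) ≤ 1 := by by_contra hc; push Not at hc; nlinarith
  have hn2 : (-1:ℝ) ≤ n := by by_contra hc; push Not at hc; nlinarith
  have hn1' : n ≤ 1 := by exact_mod_cast hn1
  have hn2' : -1 ≤ n := by exact_mod_cast hn2
  have : n = -1 ∨ n = 0 ∨ n = 1 := by omega
  rcases this with rfl | rfl | rfl
  · right; left; push_cast at hn; constructor <;> linarith
  · left; simpa using hn
  · right; right; push_cast at hn; constructor <;> linarith

/-- the quotient map from the disc -/
def mq (g : ℕ) (z : Disc) : Mg (g+1) := Quot.mk (orientRel (g+1)) z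

lemma mq_quot (g : ℕ) : IsQuotientMap (mq g) := isQuotientMap_quot_mk
lemma mq_cont (g : ℕ) : Continuous (mq g) := continuous_quot_mk
lemma mq_surj (g : ℕ) : Function.Surjective (mq g) := Quot.exists_rep

def mpt (g : ℕ) (s θ : ℝ) : Mg (g+1) := mq g (dpt (g+1) s θ)

lemma mpt_cont (g : ℕ) : Continuous (fun p : ℝ × ℝ => mpt g p.1 p.2) := (mq_cont g).comp (dpt_cont _)

def mpar (g : ℕ) (p : Fin (g+1) × I × I) : Mg (g+1) := mpt g p.2.1 (4 * p.1 + 4 * p.2.2)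

lemma mpt_surj (g : ℕ) (x : Mg (g+1)) :
    ∃ (j : Fin (g+1)) (s θ : ℝ), s ∈ Set.Icc (0:ℝ) 1 ∧ θ ∈ Set.Icc (0:ℝ) 4 ∧ x = mpt g s (4 * j + θ) := by
  obtain ⟨z, rfl⟩ := mq_surj g x
  obtain ⟨j, s, θ, hs, hθ, rfl⟩ := dpt_surj (Nat.succ_pos g) z
  exact ⟨j, s, θ, hs, hθ, rfl⟩

lemma mpar_quot (g : ℕ) : IsQuotientMap (mpar g) := by
  have hc : Continuous (fun p : Fin (g+1) × I × I => dpt (g+1) p.2.1 (4 * p.1 + 4 * p.2.2)) := by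
    refine (dpt_cont (g+1)).comp (f := fun p : Fin (g+1) × I × I => ((p.2.1:ℝ), (4 * (p.1:ℝ) + 4 * (p.2.2:ℝ)))) ?_
    have : Continuous (fun p : Fin (g+1) × I × I => ((p.1 : ℕ) : ℝ)) := 
      (continuous_of_discreteTopology (f := fun j : Fin (g+1) => ((j:ℕ):ℝ))).comp continuous_fst
    fun_prop
  have hs : Function.Surjective (fun p : Fin (g+1) × I × I => dpt (g+1) p.2.1 (4 * p.1 + 4 * p.2.2)) := by
    intro z
    obtain ⟨j, s, θ, hs, hθ, rfl⟩ := dpt_surj (Nat.succ_pos g) z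
    refine ⟨(j, ⟨s, hs⟩, ⟨θ/4, by constructor <;> linarith [hθ.1, hθ.2]⟩), ?_⟩
    simp only
    congr 2; ring
  exact (mq_quot g).comp (hc.isClosedMap.isQuotientMap hc hs)

/-- building functions out of `M_g` -/
theorem Mlift {Z : Type*} (g : ℕ) (Φ : Fin (g+1) → ℝ → ℝ → Z) (z0 : Z)
    (c0 : ∀ j, ∀ θ ∈ Set.Icc (0:ℝ) 4, Φ j 0 θ = z0)
    (c1 : ∀ j, ∀ s ∈ Set.Icc (0:ℝ) 1, Φ j s 4 = Φ (j+1) s 0)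
    (c2 : ∀ j, ∀ t ∈ Set.Icc (0:ℝ) 1, Φ j 1 t = Φ j 1 (3-t))
    (c3 : ∀ j, ∀ t ∈ Set.Icc (0:ℝ) 1, Φ j 1 (1+t) = Φ j 1 (4-t)) :
    ∃ F : Mg (g+1) → Z, ∀ j, ∀ s ∈ Set.Icc (0:ℝ) 1, ∀ θ ∈ Set.Icc (0:ℝ) 4, F (mpt g s (4 * ((j : Fin (g+1)) : ℕ) + θ)) = Φ j s θ := by
  have hG : 0 < g + 1 := Nat.succ_pos g
  choose J S T hS hT hz using fun z => dpt_surj hG z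
  have hrange : ∀ (j : Fin (g+1)) (θ : ℝ), θ ∈ Set.Icc (0:ℝ) 4 → 4 * ((j:ℕ):ℝ) + θ ∈ Set.Icc (0:ℝ) (4 * ((g+1 : ℕ):ℝ)) := by
    intro j θ hθ
    have : ((j:ℕ):ℝ) ≤ g := by exact_mod_cast Nat.lt_succ_iff.1 j.2
    have h2 : (0:ℝ) ≤ ((j:ℕ):ℝ) := by positivity
    push_cast
    constructor <;> linarith [hθ.1, hθ.2]
  -- well-definedness
  have wd : ∀ (j j' : Fin (g+1)) (s s' θ θ' : ℝ), s ∈ Set.Icc (0:ℝ) 1 → s' ∈ Set.Icc (0:ℝ) 1 → θ ∈ Set.Icc (0:ℝ) 4 →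
      θ' ∈ Set.Icc (0:ℝ) 4 → dpt (g+1) s (4*(j:ℕ)+θ) = dpt (g+1) s' (4*(j':ℕ)+θ') → (j:ℕ) ≤ j' → Φ j s θ = Φ j' s' θ' := by
    intro j j' s s' θ θ' hs hs' hθ hθ' h hjj
    obtain ⟨hss, h5⟩ := dpt_inj hG hs hs' (hrange j θ hθ) (hrange j' θ' hθ') h
    clear h
    subst hss
    have hj0 : (0:ℝ) ≤ ((j:ℕ):ℝ) := by positivity
    have hj0' : (0:ℝ) ≤ ((j':ℕ):ℝ) := by positivity
    have hjg : ((j:ℕ):ℝ) ≤ g := by exact_mod_cast Nat.lt_succ_iff.1 j.2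
    have hjg' : ((j':ℕ):ℝ) ≤ g := by exact_mod_cast Nat.lt_succ_iff.1 j'.2
    obtain ⟨t1, t2⟩ := hθ
    obtain ⟨t1', t2'⟩ := hθ'
    rcases h5 with h | h | h | h
    · rw [h, c0 j θ ⟨t1, t2⟩, c0 j' θ' ⟨t1', t2'⟩]
    · rcases Nat.eq_or_lt_of_le hjj with e | hlt
      · have : j = j' := Fin.ext e
        subst this
        have : θ = θ' := by linarith
        rw [this]
      · have : ((j:ℕ):ℝ) + 1 ≤ (j':ℕ) := by exact_mod_cast hlt
        have e1 : θ = 4 := by linarith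
        have e2 : θ' = 0 := by linarith
        have e3 : ((j':ℕ):ℝ) = (j:ℕ) + 1 := by linarith
        have e4 : (j':ℕ) = j + 1 := by exact_mod_cast e3
        have : j' = j + 1 := by
          apply Fin.ext; rw [e4, Fin.val_add_one_of_lt]
          rw [Fin.lt_def]; simp; omega
        rw [e1, e2, this, c1 j s hs]
    · obtain ⟨h1, h2⟩ := h
      push_cast at h2
      have e1 : θ = 0 := by linarith
      have e2 : θ' = 4 := by linarith
      have e3 : ((j:ℕ):ℝ) = 0 := by linarith
      have e4 : ((j':ℕ):ℝ) = g := by linarith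
      have e5 : j = 0 := Fin.ext (Nat.cast_eq_zero.1 e3)
      have e6 : j' = Fin.last g := Fin.ext (by exact_mod_cast e4)
      rw [e1, e2, e5, e6, c1 _ s hs, Fin.last_add_one]
    · obtain ⟨h1, h2⟩ := h
      push_cast at h1
      have e1 : θ = 4 := by linarith
      have e2 : θ' = 0 := by linarith
      have e3 : ((j:ℕ):ℝ) = g := by linarith
      have e4 : ((j':ℕ):ℝ) = 0 := by linarith
      have e5 : j' = 0 := Fin.ext (Nat.cast_eq_zero.1 e4)
      have e6 : j = Fin.last g := Fin.ext (by exact_mod_cast e3)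
      rw [e1, e2, e5, e6, c1 _ s hs, Fin.last_add_one]
  set fD : Disc → Z := fun z => Φ (J z) (S z) (T z) with hfD
  have key : ∀ (j : Fin (g+1)) (s θ : ℝ), s ∈ Set.Icc (0:ℝ) 1 → θ ∈ Set.Icc (0:ℝ) 4 → fD (dpt (g+1) s (4*(j:ℕ)+θ)) = Φ j s θ := by
    intro j s θ hs hθ
    have h1 := hz (dpt (g+1) s (4*(j:ℕ)+θ))
    rcases le_total ((j:ℕ)) (J (dpt (g+1) s (4*(j:ℕ)+θ))) with h | h
    · exact (wd _ _ _ _ _ _ hs (hS _) hθ (hT _) h1 h).symm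
    · exact wd _ _ _ _ _ _ (hS _) hs (hT _) hθ h1.symm h
  have hbd : ∀ z w : Disc, orientRel (g+1) z w → fD z = fD w := by
    rintro z w ⟨j, r, t, t0, t1, h1, h2⟩
    have hz' : z = dpt (g+1) 1 (4*(j:ℕ) + ((r:ℕ) + t)) := by
      apply Subtype.ext
      rw [h1, dpt_val, polyBP_eq, cl_one]
      push_cast
      rw [one_mul]; congr 1; ring
    have hw' : w = dpt (g+1) 1 (4*(j:ℕ) + ((r:ℕ) + 3 - t)) := by
      apply Subtype.ext
      rw [h2, dpt_val, polyBP_eq, cl_one]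
      push_cast
      rw [one_mul]; congr 1; ring
    have hr : (r = 0) ∨ (r = 1) := by fin_cases r <;> simp
    rcases hr with rfl | rfl
    · rw [hz', hw', key, key]
      · simpa using c2 j t ⟨t0, t1⟩
      · simp
      · simp; constructor <;> linarith
      · simp
      · simp; constructor <;> linarith
    · rw [hz', hw', key, key]
      · convert c3 j t ⟨t0, t1⟩ using 2
        · simp
        · simp; norm_num
      · simp
      · simp; constructor <;> linarith
      · simp
      · simp; constructor <;> linarith
  exact ⟨Quot.lift fD hbd, fun j s hs θ hθ => key j s θ hs hθ⟩

theorem Mlift_contH {Z : Type*} [TopologicalSpace Z] (g : ℕ) {S : Set (Mg (g+1))} (hS : IsOpen S)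
    (H : I × Mg (g+1) → Z) (Φ : Fin (g+1) → I → ℝ → ℝ → Z)
    (hF : ∀ j : Fin (g+1), ∀ s ∈ Set.Icc (0:ℝ) 1, ∀ θ ∈ Set.Icc (0:ℝ) 4, mpt g s (4 * (j:ℕ) + θ) ∈ S → ∀ τ,
      H (τ, mpt g s (4 * (j:ℕ) + θ)) = Φ j τ s θ)
    (hc : ∀ j : Fin (g+1), ContinuousOn (fun p : I × ℝ × ℝ => Φ j p.1 p.2.1 p.2.2)
      {p | p.2.1 ∈ Set.Icc (0:ℝ) 1 ∧ p.2.2 ∈ Set.Icc (0:ℝ) 4 ∧ mpt g p.2.1 (4 * (j:ℕ) + p.2.2) ∈ S}) :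
    ContinuousOn H (Set.univ ×ˢ S) := by
  have q := (mpar_quot g).restrictPreimage_isOpen hS
  have h1 : Continuous (fun p : I × S => H (p.1, (p.2 : Mg (g+1)))) := by
    apply q.continuous_lift_prod_right
    rw [continuous_iff_continuousAt]
    rintro ⟨τ, ⟨⟨j, s, θ⟩, hx⟩⟩
    have hev : ∀ᶠ p : I × (mpar g ⁻¹' S) in 𝓝 (τ, ⟨⟨j, s, θ⟩, hx⟩), p.2.1.1 = j := by
      have : Continuous (fun p : I × (mpar g ⁻¹' S) => p.2.1.1) := by fun_prop
      have hj : {i : Fin (g+1) | i = j} ∈ 𝓝 j := IsOpen.mem_nhds (isOpen_discrete _) rfl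
      exact (this.tendsto (τ, ⟨⟨j, s, θ⟩, hx⟩)).eventually hj
    have hcj := hc j
    rw [continuousOn_iff_continuous_domRestrict] at hcj
    have key : ContinuousWithinAt (fun p : I × ℝ × ℝ => Φ j p.1 p.2.1 p.2.2)
      {p | p.2.1 ∈ Set.Icc (0:ℝ) 1 ∧ p.2.2 ∈ Set.Icc (0:ℝ) 4 ∧ mpt g p.2.1 (4 * (j:ℕ) + p.2.2) ∈ S} (τ, s, 4 * (θ:ℝ)) := by
      apply hc j
      refine ⟨s.2, ?_, hx⟩
      simp only [Set.mem_Icc]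
      constructor <;> linarith [θ.2.1, θ.2.2]
    have hmap : Filter.Tendsto (fun p : I × (mpar g ⁻¹' S) => (p.1, (p.2.1.2.1 : ℝ), 4 * (p.2.1.2.2 : ℝ)))
        (𝓝 (τ, ⟨⟨j, s, θ⟩, hx⟩)) (𝓝[{p | p.2.1 ∈ Set.Icc (0:ℝ) 1 ∧ p.2.2 ∈ Set.Icc (0:ℝ) 4 ∧ mpt g p.2.1 (4 * (j:ℕ) + p.2.2) ∈ S}] (τ, s, 4 * (θ:ℝ))) := by
      rw [tendsto_nhdsWithin_iff]
      constructor
      · have : Continuous (fun p : I × (mpar g ⁻¹' S) => (p.1, (p.2.1.2.1 : ℝ), 4 * (p.2.1.2.2 : ℝ))) := by fun_prop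
        exact this.tendsto _
      · filter_upwards [hev] with p hp
        refine ⟨p.2.1.2.1.2, ?_, ?_⟩
        · simp only [Set.mem_Icc]
          constructor <;> linarith [p.2.1.2.2.2.1, p.2.1.2.2.2.2]
        · rw [← hp]; exact p.2.2
    have h2 := Filter.Tendsto.comp key hmap
    unfold ContinuousAt
    have e0 : ∀ p : I × (mpar g ⁻¹' S), p.2.1.1 = j →
        H (p.1, (S.restrictPreimage (mpar g) p.2 : Mg (g+1))) = Φ j p.1 p.2.1.2.1 (4 * (p.2.1.2.2:ℝ)) := by
      intro p hp
      rw [← hp, ← hF _ _ p.2.1.2.1.2 _ _ p.2.2]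
      · rfl
      · simp only [Set.mem_Icc]
        constructor <;> linarith [p.2.1.2.2.2.1, p.2.1.2.2.2.2]
    have e1 := e0 (τ, ⟨⟨j, s, θ⟩, hx⟩) rfl
    simp only at e1 ⊢
    rw [e1]
    refine h2.congr' ?_
    filter_upwards [hev] with p hp
    rw [e0 p hp]; rfl
  rw [continuousOn_iff_continuous_domRestrict]
  exact h1.comp (f := fun p : (Set.univ ×ˢ S : Set (I × Mg (g+1))) => (p.1.1, (⟨p.1.2, p.2.2⟩ : S))) (by fun_prop)

theorem Mlift_contOn {Z : Type*} [TopologicalSpace Z] (g : ℕ) {S : Set (Mg (g+1))} (hS : IsOpen S)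
    (F : Mg (g+1) → Z) (Φ : Fin (g+1) → ℝ → ℝ → Z)
    (hF : ∀ j : Fin (g+1), ∀ s ∈ Set.Icc (0:ℝ) 1, ∀ θ ∈ Set.Icc (0:ℝ) 4, mpt g s (4 * (j:ℕ) + θ) ∈ S → 
      F (mpt g s (4 * (j:ℕ) + θ)) = Φ j s θ)
    (hc : ∀ j : Fin (g+1), ContinuousOn (fun p : ℝ × ℝ => Φ j p.1 p.2)
      {p | p.1 ∈ Set.Icc (0:ℝ) 1 ∧ p.2 ∈ Set.Icc (0:ℝ) 4 ∧ mpt g p.1 (4 * (j:ℕ) + p.2) ∈ S}) :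
    ContinuousOn F S := by
  have h := Mlift_contH g hS (fun p => F p.2) (fun j _ => Φ j) (fun j s hs θ hθ h _ => hF j s hs θ hθ h)
    (fun j => (hc j).comp continuousOn_snd (fun p hp => hp))
  exact h.comp (f := fun x => ((0:I), x)) (by fun_prop) (fun x hx => ⟨trivial, hx⟩)

theorem Mlift_cont {Z : Type*} [TopologicalSpace Z] (g : ℕ)
    (F : Mg (g+1) → Z) (Φ : Fin (g+1) → ℝ → ℝ → Z)
    (hF : ∀ j : Fin (g+1), ∀ s ∈ Set.Icc (0:ℝ) 1, ∀ θ ∈ Set.Icc (0:ℝ) 4, 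
      F (mpt g s (4 * (j:ℕ) + θ)) = Φ j s θ)
    (hc : ∀ j : Fin (g+1), Continuous (fun p : ℝ × ℝ => Φ j p.1 p.2)) : Continuous F := by
  rw [← continuousOn_univ]
  exact Mlift_contOn g isOpen_univ F Φ (fun j s hs θ hθ _ => hF j s hs θ hθ) (fun j => (hc j).continuousOn)

/-- homotopies out of open subsets of `M_g` -/
theorem Mlift_hom {Z : Type*} [TopologicalSpace Z] (g : ℕ) {S : Set (Mg (g+1))} (hS : IsOpen S)
    (Φ : Fin (g+1) → I → ℝ → ℝ → Z) (z0 : I → Z)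
    (c0 : ∀ j τ, ∀ θ ∈ Set.Icc (0:ℝ) 4, Φ j τ 0 θ = z0 τ)
    (c1 : ∀ j τ, ∀ s ∈ Set.Icc (0:ℝ) 1, Φ j τ s 4 = Φ (j+1) τ s 0)
    (c2 : ∀ j τ, ∀ t ∈ Set.Icc (0:ℝ) 1, Φ j τ 1 t = Φ j τ 1 (3-t))
    (c3 : ∀ j τ, ∀ t ∈ Set.Icc (0:ℝ) 1, Φ j τ 1 (1+t) = Φ j τ 1 (4-t))
    (hc : ∀ j : Fin (g+1), ContinuousOn (fun p : I × ℝ × ℝ => Φ j p.1 p.2.1 p.2.2)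
      {p | p.2.1 ∈ Set.Icc (0:ℝ) 1 ∧ p.2.2 ∈ Set.Icc (0:ℝ) 4 ∧ mpt g p.2.1 (4 * (j:ℕ) + p.2.2) ∈ S})
    (f f' : Mg (g+1) → Z) 
    (h0 : ∀ j : Fin (g+1), ∀ s ∈ Set.Icc (0:ℝ) 1, ∀ θ ∈ Set.Icc (0:ℝ) 4, mpt g s (4 * (j:ℕ) + θ) ∈ S → 
      f (mpt g s (4 * (j:ℕ) + θ)) = Φ j 0 s θ)
    (h1 : ∀ j : Fin (g+1), ∀ s ∈ Set.Icc (0:ℝ) 1, ∀ θ ∈ Set.Icc (0:ℝ) 4, mpt g s (4 * (j:ℕ) + θ) ∈ S → 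
      f' (mpt g s (4 * (j:ℕ) + θ)) = Φ j 1 s θ) : HomOn S f f' := by
  obtain ⟨F, hF⟩ := Mlift g (fun j s θ τ => Φ j τ s θ) z0 (fun j θ hθ => funext fun τ => c0 j τ θ hθ)
    (fun j s hs => funext fun τ => c1 j τ s hs) (fun j t ht => funext fun τ => c2 j τ t ht)
    (fun j t ht => funext fun τ => c3 j τ t ht)
  refine ⟨fun p => F p.2 p.1, ?_, ?_⟩
  · exact Mlift_contH g hS _ Φ (fun j s hs θ hθ _ τ => by simp only; rw [hF j s hs θ hθ]) hc
  · intro x hx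
    obtain ⟨j, s, θ, hs, hθ, rfl⟩ := mpt_surj g x
    simp only
    rw [hF j s hs θ hθ, h0 j s hs θ hθ hx, h1 j s hs θ hθ hx]
    exact ⟨rfl, rfl⟩

end LSP

namespace LSP
set_option linter.all false
set_option autoImplicit false
open Topology

/-! ### Combinatorial Stokes theorem on a glued family of grids -/

section Stokes

def skip (i k : ℕ) : ℕ := if k < i then k else k + 1

def gpath {d : ℕ} (v : Fin d → ℕ) (ς : Equiv.Perm (Fin d)) (k : ℕ) : Fin d → ℕ :=
  fun m => v m + if (ς.symm m : ℕ) < k then 1 else 0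

def box (d N : ℕ) : Finset (Fin d → ℕ) := Fintype.piFinset fun _ => Finset.range N

def gint {d : ℕ} {K : Type*} [Fintype K] (N : ℕ) (ε : K → ℝ) (a : K → (ℕ → Fin d → ℕ) → ℝ) : ℝ :=
  ∑ κ, ε κ * ∑ v ∈ box d N, ∑ ς : Equiv.Perm (Fin d), ((Equiv.Perm.sign ς : ℤ) : ℝ) * a κ (gpath v ς)

variable {d : ℕ} {V K : Type*}

def Loc (p : ℕ) (a : (ℕ → V) → ℝ) : Prop :=
  ∀ x y : ℕ → V, (∀ k ≤ p, x k = y k) → a x = a y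

def delta (p : ℕ) (a : (ℕ → V) → ℝ) (x : ℕ → V) : ℝ :=
  ∑ i ∈ Finset.range (p + 2), (-1 : ℝ) ^ i * a (x ∘ skip i)

def cup (p : ℕ) (a b : (ℕ → V) → ℝ) (x : ℕ → V) : ℝ := a x * b (fun k => x (p + k))

/-- gluing data -/
structure Glu (d N : ℕ) (K : Type*) (ε : K → ℝ) where
  inv : Fin d → Bool → K → K
  invol : ∀ m s κ, inv m s (inv m s κ) = κ
  sgn : ∀ m s κ, ε (inv m s κ) = - ε κ

def sideVal (N : ℕ) (s : Bool) : ℕ := if s then N else 0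

def Glu.Inv {N : ℕ} {ε : K → ℝ} (G : Glu d N K ε) (a : K → (ℕ → Fin d → ℕ) → ℝ) : Prop :=
  ∀ m s κ x, (∀ k, x k m = sideVal N s) → (∀ k c, x k c ≤ N) → a (G.inv m s κ) x = a κ x

def fseq {D : ℕ} (w : Fin (D+1) → ℕ) (ς : Equiv.Perm (Fin (D+1))) (k : ℕ) : Fin (D+1) → ℕ :=
  fun c => w c + if (1 ≤ (ς.symm c : ℕ) ∧ (ς.symm c : ℕ) < k + 1) then 1 else 0

lemma gpath_skip_zero {D : ℕ} (v : Fin (D+1) → ℕ) (ς : Equiv.Perm (Fin (D+1))) :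
    gpath v ς ∘ skip 0 = fseq (v + Pi.single (ς 0) 1) ς := by
  funext k c
  simp only [gpath, skip, fseq, Function.comp, Pi.add_apply]
  by_cases hc : c = ς 0
  · subst hc; simp
  · have : (ς.symm c : ℕ) ≠ 0 := by
      intro h
      apply hc
      rw [← Equiv.symm_apply_eq]; exact Fin.ext (by simpa using h)
    simp [Pi.single_apply, hc]
    have h1 : 1 ≤ (ς.symm c : ℕ) := by omega
    simp [h1]

lemma gpath_rot {D : ℕ} (v : Fin (D+1) → ℕ) (ς : Equiv.Perm (Fin (D+1))) (k : ℕ) (hk : k ≤ D) :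
    gpath v ((finRotate (D+1)).trans ς) k = fseq v ς k := by
  funext c
  simp only [gpath, fseq]
  congr 1
  set i := ς.symm c with hi
  have : (((finRotate (D+1)).trans ς).symm c) = (finRotate (D+1)).symm i := by simp [hi]
  rw [this]
  obtain ⟨j, hj⟩ := (finRotate (D+1)).surjective i
  rw [← hj]
  simp only [Equiv.symm_apply_apply]
  by_cases hjD : j = Fin.last D
  · subst hjD; simp; omega
  · have hj' : (j:ℕ) < D := by
      have := j.2
      have h2 : (j:ℕ) ≠ D := fun h => hjD (Fin.ext h)
      omega
    have : ((finRotate (D+1)) j : ℕ) = j + 1 := coe_finRotate_of_ne_last hjD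
    rw [this]; simp

lemma sum_box_shift {d N : ℕ} (m : Fin d) (g : (Fin d → ℕ) → ℝ)
    (hN : ∀ w, (∀ c, w c ≤ N) → w m = N → g w = 0) (h0 : ∀ w, (∀ c, w c ≤ N) → w m = 0 → g w = 0) :
    ∑ v ∈ box d N, g (v + Pi.single m 1) = ∑ v ∈ box d N, g v := by
  classical
  refine Eq.trans (Finset.sum_filter_of_ne (p := fun v => v m + 1 ≠ N) ?_).symm
    (Eq.trans ?_ (Finset.sum_filter_of_ne (p := fun v => v m ≠ 0) ?_))
  rotate_left
  · refine Finset.sum_bij' (fun v _ => v + Pi.single m 1) (fun v _ => v - Pi.single m 1) ?_ ?_ ?_ ?_ ?_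
    · intro v hv
      simp only [box, Finset.mem_filter, Fintype.mem_piFinset, Finset.mem_range] at hv ⊢
      refine ⟨fun c => ?_, by simp⟩
      by_cases hc : c = m
      · subst hc; have := hv.1 c; have := hv.2; simp; omega
      · simpa [Pi.single_apply, hc] using hv.1 c
    · intro v hv
      simp only [box, Finset.mem_filter, Fintype.mem_piFinset, Finset.mem_range] at hv ⊢
      refine ⟨fun c => ?_, by have := hv.1 m; have := hv.2; simp; omega⟩
      have := hv.1 c
      simp only [Pi.sub_apply]; omega
    · intro v hv; funext c; simp
    · intro v hv
      simp only [box, Finset.mem_filter, Fintype.mem_piFinset, Finset.mem_range] at hv ⊢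
      funext c
      by_cases hc : c = m
      · subst hc; simp; omega
      · simp [Pi.single_apply, hc]
    · intro v hv; rfl
  · intro v hv hne h
    simp only [box, Fintype.mem_piFinset, Finset.mem_range] at hv
    exact hne (h0 v (fun c => (hv c).le) h)
  · intro v hv hne h
    simp only [box, Fintype.mem_piFinset, Finset.mem_range] at hv
    refine hne (hN _ (fun c => ?_) (by simpa using h))
    by_cases hc : c = m
    · subst hc; simp; exact hv c
    · simpa [Pi.single_apply, hc] using (hv c).le

lemma stokes_interior {D : ℕ} (v : Fin (D+1) → ℕ) (b : (ℕ → Fin (D+1) → ℕ) → ℝ) (i : ℕ) (hi : i < D) :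
    ∑ ς : Equiv.Perm (Fin (D+1)), ((Equiv.Perm.sign ς : ℤ) : ℝ) * b (gpath v ς ∘ skip (i+1)) = 0 := by
  set p : Fin (D+1) := ⟨i, by omega⟩
  set q : Fin (D+1) := ⟨i+1, by omega⟩
  have hpq : p ≠ q := by simp [p, q]
  set S := ∑ ς : Equiv.Perm (Fin (D+1)), ((Equiv.Perm.sign ς : ℤ) : ℝ) * b (gpath v ς ∘ skip (i+1)) with hS
  have h : S = - S := by
    conv_lhs => rw [hS, ← Equiv.sum_comp (Equiv.mulRight (Equiv.swap p q))]
    rw [hS, ← Finset.sum_neg_distrib]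
    refine Finset.sum_congr rfl fun ς _ => ?_
    have : gpath v (ς * Equiv.swap p q) ∘ skip (i+1) = gpath v ς ∘ skip (i+1) := by
      funext k c
      simp only [Function.comp, gpath]
      congr 1
      have h1 : (ς * Equiv.swap p q).symm c = Equiv.swap p q (ς.symm c) := by
        rw [Equiv.symm_apply_eq]; simp
      rw [h1]
      set r := ς.symm c
      have hk : skip (i+1) k ≠ i + 1 := by unfold skip; split_ifs <;> omega
      rw [Equiv.swap_apply_def]
      split_ifs with h1 h2 h3 h4 h5 h6 <;> simp_all [p, q] <;> omega
    simp [this, Equiv.Perm.sign_swap hpq]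
  linarith

theorem stokes {D N : ℕ} [Fintype K] {ε : K → ℝ} (G : Glu (D+1) N K ε)
    {b : K → (ℕ → Fin (D+1) → ℕ) → ℝ} (hl : ∀ κ, Loc D (b κ)) (hb : G.Inv b) :
    gint N ε (fun κ => delta D (b κ)) = 0 := by
  classical
  -- facet sums vanish on the boundary
  have hfac : ∀ (ς : Equiv.Perm (Fin (D+1))) (s : Bool) (w : Fin (D+1) → ℕ), (∀ c, c ≠ ς 0 → w c + 1 ≤ N) →
      w (ς 0) = sideVal N s → ∑ κ, ε κ * b κ (fseq w ς) = 0 := by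
    intro ς s w hw hs
    set S := ∑ κ, ε κ * b κ (fseq w ς) with hS
    have h : S = - S := by
      conv_lhs => rw [hS, ← Equiv.sum_comp (Function.Involutive.toPerm (G.inv (ς 0) s) (G.invol (ς 0) s))]
      rw [hS, ← Finset.sum_neg_distrib]
      refine Finset.sum_congr rfl fun κ _ => ?_
      change ε (G.inv (ς 0) s κ) * b (G.inv (ς 0) s κ) _ = _
      rw [G.sgn, hb]
      · ring
      · intro k; simp [fseq, hs]
      · intro k c
        by_cases hc : c = ς 0
        · subst hc; simp [fseq, hs, sideVal]; split_ifs <;> omega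
        · have := hw c hc; simp only [fseq]; split_ifs <;> omega
    linarith
  -- split
  have hsplit : ∀ κ v, ∑ ς : Equiv.Perm (Fin (D+1)), ((Equiv.Perm.sign ς : ℤ) : ℝ) * delta D (b κ) (gpath v ς)
      = ∑ ς : Equiv.Perm (Fin (D+1)), ((Equiv.Perm.sign ς : ℤ) : ℝ) *
        (b κ (fseq (v + Pi.single (ς 0) 1) ς) - b κ (fseq v ς)) := by
    intro κ v
    simp only [delta, Finset.mul_sum]
    rw [Finset.sum_comm, Finset.sum_range_succ, Finset.sum_range_succ']
    have hz : ∑ k ∈ Finset.range D, ∑ ς : Equiv.Perm (Fin (D+1)), ((Equiv.Perm.sign ς : ℤ) : ℝ) *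
        ((-1) ^ (k + 1) * b κ (gpath v ς ∘ skip (k+1))) = 0 := by
      refine Finset.sum_eq_zero fun k hk => ?_
      have := stokes_interior v (b κ) k (Finset.mem_range.1 hk)
      calc _ = (-1) ^ (k+1) * ∑ ς : Equiv.Perm (Fin (D+1)), ((Equiv.Perm.sign ς : ℤ) : ℝ) * b κ (gpath v ς ∘ skip (k+1)) := by
            rw [Finset.mul_sum]; refine Finset.sum_congr rfl fun ς _ => by ring
        _ = 0 := by rw [this, mul_zero]
    rw [hz, zero_add]
    have hlast : ∑ ς : Equiv.Perm (Fin (D+1)), ((Equiv.Perm.sign ς : ℤ) : ℝ) *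
        ((-1) ^ (D + 1) * b κ (gpath v ς ∘ skip (D+1))) =
        ∑ ς : Equiv.Perm (Fin (D+1)), ((Equiv.Perm.sign ς : ℤ) : ℝ) * (- b κ (fseq v ς)) := by
      rw [← Equiv.sum_comp (Equiv.mulRight (finRotate (D+1)))]
      refine Finset.sum_congr rfl fun ς _ => ?_
      have h1 : b κ (gpath v (ς * finRotate (D+1)) ∘ skip (D+1)) = b κ (fseq v ς) := by
        apply hl
        intro k hk
        have : skip (D+1) k = k := by unfold skip; rw [if_pos (by omega)]
        simp only [Function.comp, this]
        exact gpath_rot v ς k hk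
      simp only [Equiv.coe_mulRight, h1, Equiv.Perm.sign_mul, sign_finRotate]
      push_cast
      have : ((-1:ℝ)) ^ D * (-1) ^ (D+1) = -1 := by
        rw [← pow_add, show D + (D+1) = 2 * D + 1 by ring, pow_succ, pow_mul]; simp
      calc _ = ((Equiv.Perm.sign ς : ℤ) : ℝ) * (((-1:ℝ)) ^ D * (-1) ^ (D+1) * b κ (fseq v ς)) := by ring
        _ = _ := by rw [this]; ring
    rw [hlast, ← Finset.sum_add_distrib]
    refine Finset.sum_congr rfl fun ς _ => ?_
    rw [gpath_skip_zero]; ring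
  unfold gint
  simp only [hsplit]
  have : ∀ ς : Equiv.Perm (Fin (D+1)), ∑ v ∈ box (D+1) N, ∑ κ, ε κ * b κ (fseq (v + Pi.single (ς 0) 1) ς)
      = ∑ v ∈ box (D+1) N, ∑ κ, ε κ * b κ (fseq v ς) := by
    intro ς
    -- restrict to functions with other coordinates < N
    set g : (Fin (D+1) → ℕ) → ℝ := fun w => if ∀ c, c ≠ ς 0 → w c + 1 ≤ N then ∑ κ, ε κ * b κ (fseq w ς) else 0 with hg
    have := sum_box_shift (N := N) (ς 0) g ?_ ?_
    · refine Eq.trans (Finset.sum_congr rfl fun v hv => ?_) (this.trans (Finset.sum_congr rfl fun v hv => ?_))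
      · simp only [box, Fintype.mem_piFinset, Finset.mem_range] at hv
        simp only [hg]
        rw [if_pos]
        intro c hc
        simpa [Pi.single_apply, hc] using hv c
      · simp only [box, Fintype.mem_piFinset, Finset.mem_range] at hv
        simp only [hg]
        rw [if_pos]
        intro c hc
        exact hv c
    · intro w _ hw
      simp only [hg]
      split_ifs with h
      · exact hfac ς true w h (by simp [sideVal, hw])
      · rfl
    · intro w _ hw
      simp only [hg]
      split_ifs with h
      · exact hfac ς false w h (by simp [sideVal, hw])
      · rfl
  calc _ = ∑ ς : Equiv.Perm (Fin (D+1)), ((Equiv.Perm.sign ς : ℤ) : ℝ) *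
        (∑ v ∈ box (D+1) N, ∑ κ, ε κ * b κ (fseq (v + Pi.single (ς 0) 1) ς)
         - ∑ v ∈ box (D+1) N, ∑ κ, ε κ * b κ (fseq v ς)) := by
        simp only [Finset.mul_sum, mul_sub, ← Finset.sum_sub_distrib]
        rw [Finset.sum_comm]
        conv_lhs => enter [2, v]; rw [Finset.sum_comm]
        rw [Finset.sum_comm]
        refine Finset.sum_congr rfl fun ς _ => Finset.sum_congr rfl fun v _ => 
          Finset.sum_congr rfl fun κ _ => by ring
    _ = 0 := by simp [this]

/-! ### Leibniz rule -/

lemma Loc.cup {p q : ℕ} {a b : (ℕ → V) → ℝ} (ha : Loc p a) (hb : Loc q b) : Loc (p+q) (cup p a b) := by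
  intro x y h
  unfold LSP.cup
  rw [ha x y fun k hk => h k (by omega), hb _ _ fun k hk => h (p+k) (by omega)]

lemma Loc.delta {p : ℕ} {a : (ℕ → V) → ℝ} (ha : Loc p a) : Loc (p+1) (delta p a) := by
  intro x y h
  unfold LSP.delta
  refine Finset.sum_congr rfl fun i hi => ?_
  rw [ha]
  intro k hk
  apply h
  unfold skip; split_ifs <;> omega

lemma leibniz {p q : ℕ} {a b : (ℕ → V) → ℝ} (ha : Loc p a) (hb : Loc q b) (x : ℕ → V) :
    delta (p+q) (cup p a b) x = cup (p+1) (delta p a) b x + (-1)^p * cup p a (delta q b) x := by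
  unfold cup
  have e1 : ∀ i ∈ Finset.range (p+1), (-1:ℝ)^i * (a (x ∘ skip i) * b (fun k => (x ∘ skip i) (p+k)))
      = (-1:ℝ)^i * a (x ∘ skip i) * b (fun k => x (p+1+k)) := by
    intro i hi
    have hi := Finset.mem_range.1 hi
    rw [mul_assoc]
    congr 3
    funext k
    simp only [Function.comp, skip]
    rw [if_neg (by omega)]; congr 1; omega
  have e2 : ∀ i ∈ Finset.range (q+1), (-1:ℝ)^(p+1+i) * (a (x ∘ skip (p+1+i)) * b (fun k => (x ∘ skip (p+1+i)) (p+k)))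
      = (-1:ℝ)^(p+1+i) * (a x * b ((fun k => x (p+k)) ∘ skip (i+1))) := by
    intro i hi
    congr 2
    · apply ha
      intro k hk
      simp only [Function.comp, skip]
      rw [if_pos (by omega)]
    · congr 1
      funext k
      simp only [Function.comp, skip]
      split_ifs <;> first | omega | rfl | (congr 1)
  unfold delta
  unfold cup at *
  rw [show p + q + 2 = (p+1) + (q+1) by ring, Finset.sum_range_add, Finset.sum_congr rfl e1,
    Finset.sum_congr rfl e2, Finset.sum_range_succ _ (p+1), Finset.sum_range_succ' _ (q+1), add_mul,
    Finset.sum_mul]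
  have h1 : a (x ∘ skip (p+1)) = a x := by
    apply ha
    intro k hk
    simp only [Function.comp, skip]
    rw [if_pos (by omega)]
  have h2 : b ((fun k => x (p+k)) ∘ skip 0) = b (fun k => x (p+1+k)) := by
    congr 1
    funext k
    simp only [Function.comp, skip]
    rw [if_neg (by omega)]; congr 1; omega
  rw [h1, h2, mul_add, mul_add, Finset.mul_sum, Finset.mul_sum]
  have h3 : ∑ i ∈ Finset.range (q+1), (-1:ℝ)^(p+1+i) * (a x * b ((fun k => x (p+k)) ∘ skip (i+1)))
      = ∑ i ∈ Finset.range (q+1), (-1:ℝ)^p * (a x * ((-1)^(i+1) * b ((fun k => x (p+k)) ∘ skip (i+1)))) := by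
    refine Finset.sum_congr rfl fun i _ => ?_
    rw [show p + 1 + i = p + (i+1) by ring, pow_add]; ring
  rw [h3]
  ring

end Stokes
end LSP

namespace LSP
set_option linter.all false
set_option autoImplicit false
open Topology

section Telescope
variable {V K : Type*}

def Closed2 (e : V → V → V → ℝ) : Prop := ∀ x y z w, e y z w - e x z w + e x y w - e x y z = 0

def co2 (e : V → V → V → ℝ) (x : ℕ → V) : ℝ := e (x 0) (x 1) (x 2)
def co1 (e : V → V → ℝ) (x : ℕ → V) : ℝ := e (x 0) (x 1)
def d1 (b : V → V → ℝ) (x y z : V) : ℝ := b y z - b x z + b x y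

lemma loc_co2 (e : V → V → V → ℝ) : Loc 2 (co2 e) := by
  intro x y h; simp [co2, h 0, h 1, h 2]
lemma loc_co1 (e : V → V → ℝ) : Loc 1 (co1 e) := by
  intro x y h; simp [co1, h 0, h 1]

lemma delta_co1 (b : V → V → ℝ) (x : ℕ → V) : delta 1 (co1 b) x = co2 (d1 b) x := by
  simp [delta, Finset.sum_range_succ, co1, co2, d1, skip]; ring

lemma delta_co2 {e : V → V → V → ℝ} (h : Closed2 e) (x : ℕ → V) : delta 2 (co2 e) x = 0 := by
  have := h (x 0) (x 1) (x 2) (x 3)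
  simp [delta, Finset.sum_range_succ, co2, skip]; linarith

lemma closed2_d1 (b : V → V → ℝ) : Closed2 (d1 b) := by
  intro x y z w; simp only [d1]; ring

lemma Closed2.sub {e f : V → V → V → ℝ} (he : Closed2 e) (hf : Closed2 f) :
    Closed2 (fun x y z => e x y z - f x y z) := by
  intro x y z w; have := he x y z w; have := hf x y z w; linarith

def PR (e : ℕ → V → V → V → ℝ) (m : ℕ) (x : ℕ → V) : ℝ :=
  ∏ i ∈ Finset.range m, e i (x (2*i)) (x (2*i+1)) (x (2*i+2))

lemma PR_succ (e : ℕ → V → V → V → ℝ) (m : ℕ) : PR e (m+1) = cup (2*m) (PR e m) (co2 (e m)) := by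
  funext x; simp [PR, cup, co2, Finset.prod_range_succ]

lemma loc_PR (e : ℕ → V → V → V → ℝ) (m : ℕ) : Loc (2*m) (PR e m) := by
  intro x y h
  unfold PR
  refine Finset.prod_congr rfl fun i hi => ?_
  have := Finset.mem_range.1 hi
  rw [h (2*i) (by omega), h (2*i+1) (by omega), h (2*i+2) (by omega)]

lemma delta_PR {e : ℕ → V → V → V → ℝ} (h : ∀ i, Closed2 (e i)) (m : ℕ) (x : ℕ → V) :
    delta (2*m) (PR e m) x = 0 := by
  induction m generalizing x with
  | zero => simp [delta, PR, Finset.sum_range_succ]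
  | succ m ih =>
    rw [PR_succ, show 2*(m+1) = 2*m+2 by ring, leibniz (loc_PR e m) (loc_co2 _)]
    simp [cup, ih, delta_co2 (h m)]

lemma PR_split (e : ℕ → V → V → V → ℝ) (m r : ℕ) (x : ℕ → V) :
    PR e (m+1+r) x = PR e m x * co2 (e m) (fun k => x (2*m+k)) * PR (fun i => e (m+1+i)) r (fun k => x (2*m+2+k)) := by
  unfold PR
  rw [Finset.prod_range_add, Finset.prod_range_succ]
  congr 1
  refine Finset.prod_congr rfl fun i _ => ?_
  congr 2 <;> ring

lemma delta_key {e : ℕ → V → V → V → ℝ} (h : ∀ i, Closed2 (e i)) (b : V → V → ℝ) (m r : ℕ) (x : ℕ → V) :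
    delta (2*m + (1+2*r)) (cup (2*m) (PR e m) (cup 1 (co1 b) (PR (fun i => e (m+1+i)) r))) x
      = PR (Function.update e m (d1 b)) (m+1+r) x := by
  rw [leibniz (loc_PR e m) ((loc_co1 b).cup (loc_PR _ r)), PR_split]
  have h1 : ∀ y, delta (1+2*r) (cup 1 (co1 b) (PR (fun i => e (m+1+i)) r)) y =
      cup 2 (co2 (d1 b)) (PR (fun i => e (m+1+i)) r) y := by
    intro y
    rw [leibniz (loc_co1 b) (loc_PR _ r)]
    simp [cup, delta_PR (fun i => h (m+1+i)), delta_co1]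
  have h2 : PR (Function.update e m (d1 b)) m x = PR e m x := by
    unfold PR
    refine Finset.prod_congr rfl fun i hi => ?_
    have := Finset.mem_range.1 hi
    rw [Function.update_of_ne (by omega)]
  have h3 : (fun i => Function.update e m (d1 b) (m+1+i)) = fun i => e (m+1+i) := by
    funext i; rw [Function.update_of_ne (by omega)]
  rw [h2, h3]
  simp only [cup] at h1
  simp only [cup, delta_PR h, h1, pow_mul, zero_mul, zero_add, neg_one_sq, one_pow, one_mul, Function.update_self, mul_assoc, ← add_assoc]

def Inv2 {d N : ℕ} {ε : K → ℝ} (G : Glu d N K ε) (e : K → (Fin d → ℕ) → (Fin d → ℕ) → (Fin d → ℕ) → ℝ) : Prop :=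
  ∀ m s κ x y z, x m = sideVal N s → y m = sideVal N s → z m = sideVal N s →
    (∀ c, x c ≤ N) → (∀ c, y c ≤ N) → (∀ c, z c ≤ N) → e (G.inv m s κ) x y z = e κ x y z

def Inv1 {d N : ℕ} {ε : K → ℝ} (G : Glu d N K ε) (e : K → (Fin d → ℕ) → (Fin d → ℕ) → ℝ) : Prop :=
  ∀ m s κ x y, x m = sideVal N s → y m = sideVal N s →
    (∀ c, x c ≤ N) → (∀ c, y c ≤ N) → e (G.inv m s κ) x y = e κ x y

lemma Inv1.d1 {d N : ℕ} {ε : K → ℝ} {G : Glu d N K ε} {b : K → (Fin d → ℕ) → (Fin d → ℕ) → ℝ}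
    (h : Inv1 G b) : Inv2 G (fun κ => d1 (b κ)) := by
  intro m s κ x y z hx hy hz bx bY bz
  simp [LSP.d1, h m s κ x y hx hy bx bY, h m s κ x z hx hz bx bz, h m s κ y z hy hz bY bz]

lemma gint_sub {d N : ℕ} [Fintype K] (ε : K → ℝ) (a b : K → (ℕ → Fin d → ℕ) → ℝ) :
    gint N ε (fun κ x => a κ x - b κ x) = gint N ε a - gint N ε b := by
  simp [gint, mul_sub, Finset.sum_sub_distrib]

lemma gint_PR_update {N B : ℕ} [Fintype K] {ε : K → ℝ} {d : ℕ} (hd : d = 2 * B) (G : Glu d N K ε)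
    {e : ℕ → K → (Fin d → ℕ) → (Fin d → ℕ) → (Fin d → ℕ) → ℝ} (hc : ∀ i κ, Closed2 (e i κ))
    (hi : ∀ i, Inv2 G (e i)) {b : K → (Fin d → ℕ) → (Fin d → ℕ) → ℝ} (hb : Inv1 G b) (m : ℕ) (hm : m < B) :
    gint N ε (fun κ x => PR (Function.update (fun i => e i κ) m (d1 (b κ))) B x) = 0 := by
  obtain ⟨r, rfl⟩ : ∃ r, B = m + 1 + r := ⟨B - (m+1), by omega⟩
  obtain rfl : d = (2*m + (1+2*r)) + 1 := by omega
  simp only [← delta_key (fun i => hc i _)]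
  refine stokes G (fun κ => (loc_PR _ _).cup ((loc_co1 _).cup (loc_PR _ _))) ?_
  intro m' s κ x hx hxN
  simp only [cup, PR, co1]
  congr 1
  · refine Finset.prod_congr rfl fun i _ => ?_
    rw [hi i] <;> first | exact hx _ | exact hxN _
  congr 1
  · rw [hb] <;> first | exact hx _ | exact hxN _
  · refine Finset.prod_congr rfl fun i _ => ?_
    rw [hi] <;> first | exact hx _ | exact hxN _

theorem telescope {N B : ℕ} [Fintype K] {ε : K → ℝ} {d : ℕ} (hd : d = 2 * B) (G : Glu d N K ε)
    {e : ℕ → K → (Fin d → ℕ) → (Fin d → ℕ) → (Fin d → ℕ) → ℝ} (hc : ∀ i κ, Closed2 (e i κ))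
    (hi : ∀ i, Inv2 G (e i)) {b : ℕ → K → (Fin d → ℕ) → (Fin d → ℕ) → ℝ} (hb : ∀ i, Inv1 G (b i)) :
    gint N ε (fun κ x => PR (fun i => e i κ) B x) =
    gint N ε (fun κ x => PR (fun i x y z => e i κ x y z - d1 (b i κ) x y z) B x) := by
  have key : ∀ m ≤ B, gint N ε (fun κ x => PR (fun i => e i κ) B x) = 
      gint N ε (fun κ x => PR (fun i x y z => if i < m then e i κ x y z - d1 (b i κ) x y z else e i κ x y z) B x) := by
    intro m
    induction m with
    | zero => intro _; simp
    | succ m ih =>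
      intro hm
      rw [ih (by omega)]
      have := gint_PR_update hd G (e := fun i κ x y z => if i < m then e i κ x y z - d1 (b i κ) x y z else e i κ x y z)
        ?_ ?_ (hb m) m (by omega)
      · rw [← sub_eq_zero, ← this, ← gint_sub]
        congr 1
        funext κ x
        obtain ⟨r, rfl⟩ : ∃ r, B = m + 1 + r := ⟨B - (m+1), by omega⟩
        rw [PR_split, PR_split, PR_split]
        have h1 : ∀ i, ¬ (m + 1 + i < m) := fun i => by omega
        have h2 : ∀ i, ¬ (m + 1 + i < m + 1) := fun i => by omega
        have h3 : ∀ i, m + 1 + i ≠ m := fun i => by omega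
        have p1 : ∀ f : ℕ → (Fin d → ℕ) → (Fin d → ℕ) → (Fin d → ℕ) → ℝ, 
          (∀ i < m, f i = fun x y z => e i κ x y z - d1 (b i κ) x y z) → PR f m x = PR (fun i x y z => e i κ x y z - d1 (b i κ) x y z) m x := by
          intro f hf
          unfold PR
          refine Finset.prod_congr rfl fun i hi => ?_
          rw [hf i (Finset.mem_range.1 hi)]
        rw [p1 _ (fun i hi => by simp [hi]), p1 (fun i x y z => if i < m + 1 then _ else _) (fun i hi => by simp [Nat.lt_succ_of_lt hi]),
          p1 (Function.update _ _ _) (fun i hi => by rw [Function.update_of_ne (by omega)]; simp [hi])]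
        simp only [h1, h2, if_false, Function.update_of_ne (h3 _), Function.update_self, co2, lt_irrefl, if_false, Nat.lt_succ_self, if_true]
        ring
      · intro i κ
        by_cases h : i < m
        · simpa [h] using (hc i κ).sub (closed2_d1 (b i κ))
        · simpa [h] using hc i κ
      · intro i m' s κ x y z hx hy hz bx bY bz
        simp only [hi i m' s κ x y z hx hy hz bx bY bz, (hb i).d1 m' s κ x y z hx hy hz bx bY bz]
  rw [key B le_rfl]
  congr 1
  funext κ x
  unfold PR
  refine Finset.prod_congr rfl fun i hi => ?_
  simp [Finset.mem_range.1 hi]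

end Telescope
end LSP

namespace LSP
set_option linter.all false
set_option autoImplicit false
open Topology

section Evaluate
variable {B : ℕ} {S : Fin B → Type} [∀ l, Fintype (S l)]

def blk (x : Fin (B*2) → ℕ) (l : Fin B) : Fin 2 → ℕ := fun a => x (finProdFinEquiv (l, a))

def eterm (ab : Fin B → Bool) (f h : Fin B → ∀ l, S l → (Fin 2 → ℕ) → ℝ) (i : Fin B) (κ : ∀ l, S l)
    (x y z : Fin (B*2) → ℕ) : ℝ :=
  if ab i then (∑ l, (f i l (κ l) (blk y l) - f i l (κ l) (blk x l))) * (∑ l, (h i l (κ l) (blk z l) - h i l (κ l) (blk y l)))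
  else ∑ l, (f i l (κ l) (blk y l) - f i l (κ l) (blk x l)) * (h i l (κ l) (blk z l) - h i l (κ l) (blk y l))

def Aterm (f h : Fin B → ∀ l, S l → (Fin 2 → ℕ) → ℝ) (i l : Fin B) (k : S l) (w : Fin 2 → ℕ) (ω : Equiv.Perm (Fin 2)) : ℝ :=
  (f i l k (w + Pi.single (ω 0) 1) - f i l k w) * (h i l k (w + 1) - h i l k (w + Pi.single (ω 0) 1))

def Jterm (N : ℕ) (ε : ∀ l, S l → ℝ) (f h : Fin B → ∀ l, S l → (Fin 2 → ℕ) → ℝ) (i l : Fin B) : ℝ :=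
  ∑ k : S l, ε l k * ∑ w ∈ box 2 N, ∑ ω : Equiv.Perm (Fin 2), ((Equiv.Perm.sign ω : ℤ) : ℝ) * Aterm f h i l k w ω

/-- transferred path -/
def bpath (v : Fin (B*2) → ℕ) (τ : Equiv.Perm (Fin B × Fin 2)) (k : ℕ) (l : Fin B) : Fin 2 → ℕ :=
  blk (gpath v (finProdFinEquiv.permCongr τ) k) l

lemma bpath_apply (v : Fin (B*2) → ℕ) (τ : Equiv.Perm (Fin B × Fin 2)) (k : ℕ) (l : Fin B) (a : Fin 2) :
    bpath v τ k l a = blk v l a + if ((τ.symm (l, a)).2 : ℕ) + 2 * (τ.symm (l, a)).1 < k then 1 else 0 := by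
  have : (finProdFinEquiv.permCongr τ).symm (finProdFinEquiv (l,a)) = finProdFinEquiv (τ.symm (l,a)) := by
    rw [Equiv.symm_apply_eq]; simp
  simp only [bpath, blk, gpath, this, finProdFinEquiv_apply_val]

lemma bpath_even (v : Fin (B*2) → ℕ) (τ : Equiv.Perm (Fin B × Fin 2)) (i l : Fin B) (hl : (τ (i,0)).1 ≠ l) :
    bpath v τ (2*i+1) l = bpath v τ (2*i) l := by
  funext a
  rw [bpath_apply, bpath_apply]
  congr 2
  apply propext
  set p := τ.symm (l,a) with hp
  have h2 := p.2.2
  constructor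
  · intro h
    by_contra hcon
    have h1 : (p.1 : ℕ) = i := by omega
    have h0 : (p.2 : ℕ) = 0 := by omega
    have : p = (i, 0) := Prod.ext (Fin.ext h1) (Fin.ext h0)
    rw [← this, hp] at hl
    simp at hl
  · intro h; omega

lemma bpath_odd (v : Fin (B*2) → ℕ) (τ : Equiv.Perm (Fin B × Fin 2)) (i l : Fin B) (hl : (τ (i,1)).1 ≠ l) :
    bpath v τ (2*i+2) l = bpath v τ (2*i+1) l := by
  funext a
  rw [bpath_apply, bpath_apply]
  congr 2
  apply propext
  set p := τ.symm (l,a) with hp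
  have h2 := p.2.2
  constructor
  · intro h
    by_contra hcon
    have h1 : (p.1 : ℕ) = i := by omega
    have h0 : (p.2 : ℕ) = 1 := by omega
    have : p = (i, 1) := Prod.ext (Fin.ext h1) (Fin.ext h0)
    rw [← this, hp] at hl
    simp at hl
  · intro h; omega

lemma eterm_bpath (ab : Fin B → Bool) (f h : Fin B → ∀ l, S l → (Fin 2 → ℕ) → ℝ) (i : Fin B) (κ : ∀ l, S l)
    (v : Fin (B*2) → ℕ) (τ : Equiv.Perm (Fin B × Fin 2)) :
    eterm ab f h i κ (gpath v (finProdFinEquiv.permCongr τ) (2*i)) (gpath v (finProdFinEquiv.permCongr τ) (2*i+1))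
      (gpath v (finProdFinEquiv.permCongr τ) (2*i+2)) =
    if ab i ∨ (τ (i,0)).1 = (τ (i,1)).1 then
      (f i (τ (i,0)).1 (κ (τ (i,0)).1) (bpath v τ (2*i+1) (τ (i,0)).1) - f i (τ (i,0)).1 (κ (τ (i,0)).1) (bpath v τ (2*i) (τ (i,0)).1)) *
      (h i (τ (i,1)).1 (κ (τ (i,1)).1) (bpath v τ (2*i+2) (τ (i,1)).1) - h i (τ (i,1)).1 (κ (τ (i,1)).1) (bpath v τ (2*i+1) (τ (i,1)).1)) else 0 := by
  have e1 : ∀ l, l ≠ (τ (i,0)).1 → f i l (κ l) (bpath v τ (2*i+1) l) - f i l (κ l) (bpath v τ (2*i) l) = 0 := by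
    intro l hl; rw [bpath_even _ _ _ _ hl.symm, sub_self]
  have e2 : ∀ l, l ≠ (τ (i,1)).1 → h i l (κ l) (bpath v τ (2*i+2) l) - h i l (κ l) (bpath v τ (2*i+1) l) = 0 := by
    intro l hl; rw [bpath_odd _ _ _ _ hl.symm, sub_self]
  unfold eterm
  change (if ab i then (∑ l, (f i l (κ l) (bpath v τ (2*i+1) l) - f i l (κ l) (bpath v τ (2*i) l))) *
    (∑ l, (h i l (κ l) (bpath v τ (2*i+2) l) - h i l (κ l) (bpath v τ (2*i+1) l)))
    else ∑ l, (f i l (κ l) (bpath v τ (2*i+1) l) - f i l (κ l) (bpath v τ (2*i) l)) *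
      (h i l (κ l) (bpath v τ (2*i+2) l) - h i l (κ l) (bpath v τ (2*i+1) l))) = _
  by_cases hab : ab i = true
  · rw [if_pos hab, if_pos (Or.inl hab), Finset.sum_eq_single (τ (i,0)).1 (fun l _ hl => e1 l hl) (by simp),
      Finset.sum_eq_single (τ (i,1)).1 (fun l _ hl => e2 l hl) (by simp)]
  · rw [if_neg hab, Finset.sum_eq_single (τ (i,0)).1 (fun l _ hl => by rw [e1 l hl, zero_mul]) (by simp)]
    by_cases heq : (τ (i,0)).1 = (τ (i,1)).1
    · rw [if_pos (Or.inr heq), ← heq]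
    · rw [if_neg (by tauto), e2 _ heq, mul_zero]

def shear (p : Equiv.Perm (Fin B) × (Fin B → Equiv.Perm (Fin 2))) : Equiv.Perm (Fin B × Fin 2) :=
  Equiv.prodShear p.1 p.2

lemma shear_inj : Function.Injective (shear : _ → Equiv.Perm (Fin B × Fin 2)) := by
  rintro ⟨π, ω⟩ ⟨π', ω'⟩ h
  have : ∀ i a, (π i, ω i a) = (π' i, ω' i a) := fun i a => by
    have := congrArg (fun e : Equiv.Perm (Fin B × Fin 2) => e (i,a)) h
    simpa [shear] using this
  refine Prod.ext ?_ ?_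
  · ext i; simpa using congrArg (fun q => (q.1 : ℕ)) (this i 0)
  · funext i; ext a; simpa using congrArg (fun q => (q.2 : ℕ)) (this i a)

lemma shear_sign (p : Equiv.Perm (Fin B) × (Fin B → Equiv.Perm (Fin 2))) :
    Equiv.Perm.sign (shear p) = ∏ i, Equiv.Perm.sign (p.2 i) := by
  have : shear p = (Equiv.prodCongrLeft (fun _ => p.1) : Equiv.Perm (Fin B × Fin 2)) * Equiv.prodCongrRight p.2 := by
    ext ⟨i, a⟩ <;> simp [shear]
  rw [this, Equiv.Perm.sign_mul, Equiv.Perm.sign_prodCongrLeft, Equiv.Perm.sign_prodCongrRight]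
  simp

lemma mem_range_shear (τ : Equiv.Perm (Fin B × Fin 2)) (h : ∀ i, (τ (i,0)).1 = (τ (i,1)).1) :
    τ ∈ Set.range shear := by
  have hinj : Function.Injective fun i => (τ (i,0)).1 := by
    intro i j hij
    by_contra hne
    simp only at hij
    have h01 := τ.injective.ne (show ((i:Fin B),(0:Fin 2)) ≠ (i,1) by simp)
    have h02 := τ.injective.ne (show ((i:Fin B),(0:Fin 2)) ≠ (j,0) by simp [hne])
    have h12 := τ.injective.ne (show ((i:Fin B),(1:Fin 2)) ≠ (j,0) by simp [hne])
    have g1 := h i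
    rw [Ne, Prod.ext_iff] at h01 h02 h12
    have a := (τ (i,0)).2
    rcases ha : (τ (i,0)).2 with ⟨u, hu⟩
    rcases hb : (τ (i,1)).2 with ⟨u', hu'⟩
    rcases hc : (τ (j,0)).2 with ⟨u'', hu''⟩
    rw [ha, hb] at h01; rw [ha, hc] at h02; rw [hb, hc] at h12
    simp only [Fin.mk.injEq] at h01 h02 h12
    have q1 : ¬ u = u' := fun e => h01 ⟨g1, e⟩
    have q2 : ¬ u = u'' := fun e => h02 ⟨hij, e⟩
    have q3 : ¬ u' = u'' := fun e => h12 ⟨g1.symm.trans hij, e⟩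
    omega
  set π : Equiv.Perm (Fin B) := Equiv.ofBijective _ (Finite.injective_iff_bijective.1 hinj) with hπ
  have hall : ∀ i a, (τ (i,a)).1 = π i := by
    intro i a
    fin_cases a
    · rfl
    · exact (h i).symm
  have hinj2 : ∀ i, Function.Injective fun a => (τ (i,a)).2 := by
    intro i a b hab
    have : τ (i,a) = τ (i,b) := Prod.ext ((hall i a).trans (hall i b).symm) hab
    simpa using τ.injective this
  refine ⟨(π, fun i => Equiv.ofBijective _ (Finite.injective_iff_bijective.1 (hinj2 i))), ?_⟩
  ext ⟨i, a⟩
  · simp [shear, hall]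
  · simp [shear]

lemma bpath_shear (v : Fin (B*2) → ℕ) (p : Equiv.Perm (Fin B) × (Fin B → Equiv.Perm (Fin 2))) (i : Fin B) :
    bpath v (shear p) (2*i) (p.1 i) = blk v (p.1 i) ∧
    bpath v (shear p) (2*i+1) (p.1 i) = blk v (p.1 i) + Pi.single (p.2 i 0) 1 ∧
    bpath v (shear p) (2*i+2) (p.1 i) = blk v (p.1 i) + 1 := by
  have hs : ∀ a, (shear p).symm (p.1 i, a) = (i, (p.2 i).symm a) := by
    intro a; rw [Equiv.symm_apply_eq]; simp [shear]
  refine ⟨?_, ?_, ?_⟩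
  · funext a; rw [bpath_apply, hs]; simp
  · funext a; rw [bpath_apply, hs]
    simp only [Pi.add_apply, Pi.single_apply]
    congr 1
    by_cases ha : a = p.2 i 0
    · subst ha; simp
    · have : ((p.2 i).symm a) ≠ 0 := by
        intro h; exact ha ((Equiv.symm_apply_eq _).1 h)
      have h2 : (((p.2 i).symm a : Fin 2) : ℕ) ≠ 0 := fun h => this (Fin.ext h)
      rw [if_neg ha, if_neg (by omega)]
  · funext a; rw [bpath_apply, hs]
    have := ((p.2 i).symm a).2
    simp only [Pi.add_apply, Pi.one_apply]
    rw [if_pos (by omega)]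

theorem evaluate (N : ℕ) (ε : ∀ l, S l → ℝ) (ab : Fin B → Bool) (f h : Fin B → ∀ l, S l → (Fin 2 → ℕ) → ℝ)
    (P : ∀ i l, S l → Prop)
    (hf : ∀ i l k, ab i = true → ¬ P i l k → ∀ x y, f i l k x = f i l k y)
    (hh : ∀ i l k, ab i = true → ¬ P i l k → ∀ x y, h i l k x = h i l k y)
    (hP : ∀ i i' l k, ab i = true → ab i' = true → P i l k → P i' l k → i = i') 
    (e : ℕ → (∀ l, S l) → (Fin (B*2) → ℕ) → (Fin (B*2) → ℕ) → (Fin (B*2) → ℕ) → ℝ)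
    (he : ∀ i : Fin B, e i = eterm ab f h i) :
    gint N (fun κ : ∀ l, S l => ∏ l, ε l (κ l)) (fun κ x => PR (fun i => e i κ) B x) =
      ∑ π : Equiv.Perm (Fin B), ∏ i, Jterm N ε f h i (π i) := by
  classical
  -- inner sum over permutations
  have hin : ∀ κ v, ∑ ς : Equiv.Perm (Fin (B*2)), ((Equiv.Perm.sign ς : ℤ) : ℝ) * PR (fun i => e i κ) B (gpath v ς)
      = ∑ p : Equiv.Perm (Fin B) × (Fin B → Equiv.Perm (Fin 2)),
        ∏ i, ((Equiv.Perm.sign (p.2 i) : ℤ) : ℝ) * Aterm f h i (p.1 i) (κ (p.1 i)) (blk v (p.1 i)) (p.2 i) := by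
    intro κ v
    rw [← Equiv.sum_comp (finProdFinEquiv.permCongr : Equiv.Perm (Fin B × Fin 2) ≃ _)]
    symm
    refine Fintype.sum_of_injective shear shear_inj _ _ ?_ ?_
    · intro τ hτ
      have : ∃ i, (τ (i,0)).1 ≠ (τ (i,1)).1 := by
        by_contra! hcon; exact hτ (mem_range_shear τ hcon)
      obtain ⟨i, hi⟩ := this
      apply mul_eq_zero_of_right
      rw [PR, Finset.prod_range]
      by_contra hne
      replace hne := Finset.prod_ne_zero_iff.1 hne
      have hne' : ∀ j : Fin B, _ ≠ _ := fun j => hne j (Finset.mem_univ j)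
      simp only [he, eterm_bpath] at hne'
      have hi1 := hne' i
      have habi : ab i = true := by
        by_contra hc
        rw [if_neg (by tauto)] at hi1
        exact hi1 rfl
      rw [if_pos (Or.inl habi)] at hi1
      set l := (τ (i,0)).1 with hl
      have hPi : P i l (κ l) := by
        by_contra hc
        exact hi1 (by rw [hf i _ _ habi hc _ (bpath v τ (2*i) l), sub_self, zero_mul])
      -- the other coordinate of block l
      set a := (τ (i,0)).2 with ha
      set q := τ.symm (l, Fin.rev a) with hq
      have hτq : τ q = (l, Fin.rev a) := by simp [hq]
      have hqi : q.1 ≠ i := by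
        intro hqi
        rcases q with ⟨i', c⟩
        simp only at hqi
        subst hqi
        fin_cases c
        · have := hτq
          have h2 : (τ (i',0)).2 = Fin.rev a := by simpa using congrArg Prod.snd this
          rw [← ha] at h2
          revert h2
          generalize a = a'
          fin_cases a' <;> simp [Fin.rev]
        · have : (τ (i',1)).1 = l := by simpa using congrArg Prod.fst hτq
          exact hi this.symm
      have hj := hne' q.1
      by_cases habj : ab q.1 = true
      · rw [if_pos (Or.inl habj)] at hj
        have hPj : P q.1 l (κ l) := by
          rcases q with ⟨i', c⟩
          simp only at hj hqi habj hτq ⊢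
          by_contra hc
          fin_cases c
          · have h1 : (τ (i',0)).1 = l := by simpa using congrArg Prod.fst hτq
            apply hj
            rw [h1, hf i' _ _ habj hc _ (bpath v τ (2*i') l), sub_self, zero_mul]
          · have h1 : (τ (i',1)).1 = l := by simpa using congrArg Prod.fst hτq
            apply hj
            rw [h1, hh i' _ _ habj hc _ (bpath v τ (2*i'+1) l), sub_self, mul_zero]
        exact hqi (hP _ _ _ _ habj habi hPj hPi)
      · have hsame : (τ (q.1,0)).1 = (τ (q.1,1)).1 := by
          by_contra hc
          rw [if_neg (by tauto)] at hj
          exact hj rfl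
        have hl1 : (τ (q.1,0)).1 = l := by
          rcases q with ⟨i', c⟩
          simp only at hsame hτq ⊢
          fin_cases c
          · simpa using congrArg Prod.fst hτq
          · rw [hsame]; simpa using congrArg Prod.fst hτq
        have h01 := τ.injective.ne (show ((q.1:Fin B),(0:Fin 2)) ≠ (q.1,1) by simp)
        have h02 := τ.injective.ne (show ((q.1:Fin B),(0:Fin 2)) ≠ (i,0) by simp [hqi])
        have h12 := τ.injective.ne (show ((q.1:Fin B),(1:Fin 2)) ≠ (i,0) by simp [hqi])
        rw [Ne, Prod.ext_iff] at h01 h02 h12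
        rcases ha : (τ (q.1,0)).2 with ⟨u, hu⟩
        rcases hb : (τ (q.1,1)).2 with ⟨u', hu'⟩
        rcases hc : (τ (i,0)).2 with ⟨u'', hu''⟩
        rw [ha, hb] at h01; rw [ha, hc] at h02; rw [hb, hc] at h12
        simp only [Fin.mk.injEq] at h01 h02 h12
        have q1 : ¬ u = u' := fun e => h01 ⟨hsame, e⟩
        have q2 : ¬ u = u'' := fun e => h02 ⟨hl1, e⟩
        have q3 : ¬ u' = u'' := fun e => h12 ⟨hsame.symm.trans hl1, e⟩
        omega
    · intro p
      rw [Equiv.Perm.sign_permCongr, shear_sign, PR, Finset.prod_range]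
      push_cast
      rw [← Finset.prod_mul_distrib]
      refine Finset.prod_congr rfl fun i _ => ?_
      congr 1
      rw [he, eterm_bpath]
      have h0 : ∀ a, (shear p (i,a)).1 = p.1 i := fun a => by simp [shear]
      rw [if_pos (Or.inr (by rw [h0, h0])), h0, h0]
      obtain ⟨b1, b2, b3⟩ := bpath_shear v p i
      rw [b1, b2, b3]; rfl
  unfold gint
  simp only [hin]
  simp only [Fintype.sum_prod_type]
  calc _ = ∑ π : Equiv.Perm (Fin B), ∑ κ : ∀ l, S l, ∑ v ∈ box (B*2) N, ∑ ω : Fin B → Equiv.Perm (Fin 2), 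
        ∏ i, (ε (π i) (κ (π i)) * (((Equiv.Perm.sign (ω i) : ℤ) : ℝ) * Aterm f h i (π i) (κ (π i)) (blk v (π i)) (ω i))) := by
        simp only [Finset.mul_sum]
        conv_lhs => enter [2, κ]; rw [Finset.sum_comm]
        rw [Finset.sum_comm]
        refine Finset.sum_congr rfl fun π _ => Finset.sum_congr rfl fun κ _ => Finset.sum_congr rfl fun v _ => 
          Finset.sum_congr rfl fun ω _ => ?_
        symm
        rw [Finset.prod_mul_distrib, Equiv.prod_comp π (fun l => ε l (κ l))]
    _ = _ := by
        refine Finset.sum_congr rfl fun π _ => ?_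
        -- reindex i = π⁻¹ l
        have h1 : ∏ i, Jterm N ε f h i (π i) = ∏ l, Jterm N ε f h (π.symm l) l := by
          rw [← Equiv.prod_comp π (fun l => Jterm N ε f h (π.symm l) l)]; simp
        rw [h1]
        unfold Jterm
        rw [Finset.prod_univ_sum]
        simp only [Fintype.piFinset_univ]
        refine Finset.sum_congr rfl fun κ _ => ?_
        rw [Finset.prod_mul_distrib, Finset.prod_univ_sum, Finset.mul_sum]
        refine Finset.sum_bij' (fun v _ => fun l => blk v l) 
          (fun (u : Fin B → Fin 2 → ℕ) _ => fun c => u (finProdFinEquiv.symm c).1 (finProdFinEquiv.symm c).2) ?_ ?_ ?_ ?_ ?_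
        · intro v hv
          simp only [box, Fintype.mem_piFinset] at hv ⊢
          intro l a; exact hv _
        · intro v hv
          simp only [box, Fintype.mem_piFinset] at hv ⊢
          intro c; exact hv _ _
        · intro v hv; funext c; simp only [blk, Prod.mk.eta, Equiv.apply_symm_apply]
        · intro u hu; funext l a; simp [blk]
        · intro v hv
          rw [Finset.prod_univ_sum, Finset.mul_sum]
          simp only [Fintype.piFinset_univ]
          rw [← Equiv.sum_comp (Equiv.arrowCongr π.symm (Equiv.refl (Equiv.Perm (Fin 2))))]
          refine Finset.sum_congr rfl fun ω _ => ?_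
          rw [Finset.prod_mul_distrib, Equiv.prod_comp π (fun l => ε l (κ l))]
          congr 1
          symm
          rw [← Equiv.prod_comp π]
          refine Finset.prod_congr rfl fun i _ => ?_
          simp [Equiv.arrowCongr]

end Evaluate
end LSP

namespace LSP
set_option linter.all false
set_option autoImplicit false
open Topology

/-! ### Trivialising classes on null-homotopic sets -/

theorem deg1_lift {X : Type*} [TopologicalSpace X] {U : Set X} (hU : NullOn U) {φ : X → UnitAddCircle}
    (hφ : Continuous φ) : ∃ α : X → ℝ, ContinuousOn α U ∧ ∀ x ∈ U, (α x : UnitAddCircle) = φ x := by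
  classical
  obtain ⟨y, h⟩ := hU
  obtain ⟨H, hH, h1⟩ := h.symm
  have cov : IsCoveringMap ((↑) : ℝ → AddCircle (1:ℝ)) := AddCircle.isCoveringMap_coe (1:ℝ)
  have hc : Continuous (fun p : I × U => φ (H (p.1, p.2))) := by
    rw [continuousOn_iff_continuous_domRestrict] at hH
    refine hφ.comp (hH.comp (f := fun p : I × U => (⟨(p.1, p.2.1), ⟨trivial, p.2.2⟩⟩ : (Set.univ ×ˢ U : Set (I × X)))) ?_)
    fun_prop
  obtain ⟨c, hcc⟩ := QuotientAddGroup.mk_surjective (φ y)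
  have H0 : ∀ a : U, (⟨_, hc⟩ : C(I × U, AddCircle (1:ℝ))) (0, a) = ((↑) : ℝ → AddCircle (1:ℝ)) ((ContinuousMap.const U c) a) := by
    intro a
    simp only [ContinuousMap.coe_mk, ContinuousMap.const_apply]
    rw [(h1 a a.2).1]; exact hcc.symm
  let L := cov.liftHomotopy ⟨_, hc⟩ (ContinuousMap.const U c) H0
  have hL : ∀ t (a : U), ((L (t, a) : ℝ) : AddCircle (1:ℝ)) = φ (H (t, a)) := fun t a => 
    congrFun (cov.liftHomotopy_lifts ⟨_, hc⟩ (ContinuousMap.const U c) H0) (t, a)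
  refine ⟨fun x => if hx : x ∈ U then L (1, ⟨x, hx⟩) else 0, ?_, ?_⟩
  · rw [continuousOn_iff_continuous_domRestrict]
    have : (U.domRestrict fun x => if hx : x ∈ U then L (1, ⟨x, hx⟩) else 0) = fun a : U => L (1, a) := by
      funext a; simp [Set.domRestrict, a.2]
    rw [this]
    exact L.continuous.comp (by fun_prop)
  · intro x hx
    simp only [hx, dif_pos]
    exact (hL 1 ⟨x, hx⟩).trans (by rw [(h1 x hx).2]; rfl)

/-- on connected sets real lifts agree up to constants -/
theorem lift_diff {Y X : Type*} [TopologicalSpace Y] [TopologicalSpace X] {U : Set X} {φ : X → UnitAddCircle} {α : X → ℝ}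
    (hα : ContinuousOn α U) (hα' : ∀ x ∈ U, (α x : UnitAddCircle) = φ x) {q : Y → X} (hq : Continuous q)
    {F : Y → ℝ} (hF : Continuous F) (hF' : ∀ y, (F y : UnitAddCircle) = φ (q y)) {A : Set Y} (hA : IsPreconnected A)
    (hAU : A ⊆ q ⁻¹' U) {y y' : Y} (hy : y ∈ A) (hy' : y' ∈ A) : α (q y') - α (q y) = F y' - F y := by
  have hc : ContinuousOn (fun y => α (q y) - F y) A :=
    (hα.comp hq.continuousOn hAU).sub hF.continuousOn
  have hInt : ∀ y ∈ A, ∃ n : ℤ, α (q y) - F y = n := by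
    intro y hy
    have h1 : ((α (q y) : ℝ) : UnitAddCircle) = (F y : ℝ) := by rw [hF', hα' _ (hAU hy)]
    rw [← sub_eq_zero, ← AddCircle.coe_sub, AddCircle.coe_eq_zero_iff] at h1
    obtain ⟨n, hn⟩ := h1
    exact ⟨n, by rw [← hn]; simp⟩
  have hp := hA.image _ hc
  have key : α (q y) - F y = α (q y') - F y' := by
    by_contra hne
    have m1 : α (q y) - F y ∈ (fun y => α (q y) - F y) '' A := ⟨y, hy, rfl⟩
    have m2 : α (q y') - F y' ∈ (fun y => α (q y) - F y) '' A := ⟨y', hy', rfl⟩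
    have hoc := hp.ordConnected
    obtain ⟨n, hn⟩ := hInt y hy
    obtain ⟨n', hn'⟩ := hInt y' hy'
    rw [hn] at m1 hne
    rw [hn'] at m2 hne
    have hne' : n ≠ n' := fun h => hne (by rw [h])
    rcases lt_or_gt_of_ne hne' with h | h
    · have : (n:ℝ) + 1 ≤ n' := by exact_mod_cast h
      obtain ⟨y2, hy2, e⟩ := hoc.out m1 m2 (⟨by linarith, by linarith⟩ : (n:ℝ) + 1/2 ∈ Set.Icc (n:ℝ) n')
      obtain ⟨k, hk⟩ := hInt y2 hy2
      simp only at e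
      rw [hk] at e
      have e1 : (2:ℝ) * k = 2 * n + 1 := by linarith
      have e2 : (2:ℤ) * k = 2 * n + 1 := by exact_mod_cast e1
      omega
    · have : (n':ℝ) + 1 ≤ n := by exact_mod_cast h
      obtain ⟨y2, hy2, e⟩ := hoc.out m2 m1 (⟨by linarith, by linarith⟩ : (n':ℝ) + 1/2 ∈ Set.Icc (n':ℝ) n)
      obtain ⟨k, hk⟩ := hInt y2 hy2
      simp only at e
      rw [hk] at e
      have e1 : (2:ℝ) * k = 2 * n' + 1 := by linarith
      have e2 : (2:ℤ) * k = 2 * n' + 1 := by exact_mod_cast e1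
      omega
  linarith

open Matrix in
open scoped ComplexOrder in
set_option maxHeartbeats 1000000 in
theorem deg2_section {X : Type*} [TopologicalSpace X] {M : ℕ} {U K : Set X} (hU : NullOn U) (hK : IsCompact K) (hKU : K ⊆ U)
    {P : X → Matrix (Fin M) (Fin M) ℂ} (hP : Continuous P)
    (hp : ∀ x, ∃ p : Fin M → ℂ, p ≠ 0 ∧ P x = Matrix.vecMulVec p (star p)) :
    ∃ u : X → Fin M → ℂ, ContinuousOn u K ∧ ∀ x ∈ K, P x *ᵥ u x ≠ 0 := by
  obtain ⟨y, H, hH, h1⟩ := hU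
  have hHK : ContinuousOn H (Set.univ ×ˢ K) := hH.mono (Set.prod_mono le_rfl hKU)
  choose p hp0 hp using hp
  have hmv : ∀ x (u : Fin M → ℂ), P x *ᵥ u = (star (p x) ⬝ᵥ u) • p x := by
    intro x u; rw [hp, Matrix.vecMulVec_mulVec]; ext i; simp [mul_comm]
  have hpp : ∀ x, star (p x) ⬝ᵥ p x ≠ 0 := fun x => by
    rw [Ne, dotProduct_star_self_eq_zero]; exact hp0 x
  have htr : ∀ x x', (P x * P x').trace = (star (p x) ⬝ᵥ p x') * (star (p x') ⬝ᵥ p x) := by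
    intro x x'
    rw [hp x, hp x', Matrix.vecMulVec_mul_vecMulVec, Matrix.trace_vecMulVec]
    simp [dotProduct_comm, smul_dotProduct]
    try ring
  -- continuity of each slice
  have hslice : ∀ t : I, ContinuousOn (fun x => P (H (t, x))) K := fun t =>
    (hP.comp_continuousOn hHK).comp (f := fun x => (t, x)) (by fun_prop) (fun x hx => ⟨trivial, hx⟩)
  let T : I × I → X → ℂ := fun tt x => (P (H (tt.1, x)) * P (H (tt.2, x))).trace
  have hopen : ∀ t : I, ∀ᶠ tt : I × I in 𝓝 (t, t), ∀ x ∈ K, T tt x ≠ 0 := by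
    intro t
    have hTc : ContinuousOn (fun z : (I × I) × X => T z.1 z.2) (Set.univ ×ˢ K) := by
      have a1 : ContinuousOn (fun z : (I × I) × X => P (H (z.1.1, z.2))) (Set.univ ×ˢ K) :=
        (hP.comp_continuousOn hHK).comp (f := fun z : (I × I) × X => (z.1.1, z.2)) (by fun_prop) (fun x hx => ⟨trivial, hx.2⟩)
      have a2 : ContinuousOn (fun z : (I × I) × X => P (H (z.1.2, z.2))) (Set.univ ×ˢ K) :=
        (hP.comp_continuousOn hHK).comp (f := fun z : (I × I) × X => (z.1.2, z.2)) (by fun_prop) (fun x hx => ⟨trivial, hx.2⟩)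
      have a3 : ContinuousOn (fun z : (I × I) × X => P (H (z.1.1, z.2)) * P (H (z.1.2, z.2))) (Set.univ ×ˢ K) := by
        have : Continuous (fun AB : Matrix (Fin M) (Fin M) ℂ × Matrix (Fin M) (Fin M) ℂ => AB.1 * AB.2) := by fun_prop
        exact this.comp_continuousOn (a1.prodMk a2)
      have : Continuous (fun A : Matrix (Fin M) (Fin M) ℂ => A.trace) := by fun_prop
      exact this.comp_continuousOn a3
    -- transfer to the compact subtype
    have hcK : Continuous (fun z : (I × I) × K => T z.1 z.2) := by
      rw [continuousOn_iff_continuous_domRestrict] at hTc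
      exact hTc.comp (f := fun z : (I × I) × K => (⟨(z.1, z.2.1), ⟨trivial, z.2.2⟩⟩ : (Set.univ ×ˢ K : Set ((I×I) × X)))) (by fun_prop)
    haveI : CompactSpace K := isCompact_iff_compactSpace.1 hK
    have := isCompact_univ.eventually_forall_of_forall_eventually (x₀ := (t,t)) (P := fun tt (x : K) => T tt x ≠ 0) (K := (Set.univ : Set K)) ?_
    · filter_upwards [this] with tt h x hx
      exact h ⟨x, hx⟩ trivial
    · intro x _
      refine hcK.continuousAt.eventually_ne ?_
      simp only [T]
      rw [htr]
      exact mul_ne_zero (hpp _) (hpp _)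
  -- good times
  let Good : I → Prop := fun t => ∃ u : X → Fin M → ℂ, ContinuousOn u K ∧ ∀ x ∈ K, P (H (t, x)) *ᵥ u x ≠ 0
  have step : ∀ t t' : I, (∀ x ∈ K, T (t, t') x ≠ 0) → Good t' → Good t := by
    rintro t t' hT ⟨u, hu, hu'⟩
    refine ⟨fun x => P (H (t', x)) *ᵥ u x, ?_, ?_⟩
    · have : Continuous (fun z : Matrix (Fin M) (Fin M) ℂ × (Fin M → ℂ) => z.1 *ᵥ z.2) := by fun_prop
      exact this.comp_continuousOn (f := fun x => (P (H (t', x)), u x)) (ContinuousOn.prodMk (hslice t') hu)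
    · intro x hx
      have h2 := hT x hx
      simp only [T] at h2
      rw [htr] at h2
      have h3 := hu' x hx
      rw [hmv] at h3 ⊢
      simp only [hmv, dotProduct_smul, smul_eq_mul]
      refine smul_ne_zero (mul_ne_zero ?_ (left_ne_zero_of_mul h2)) (hp0 _)
      exact fun h => h3 (by rw [h, zero_smul])
  have hgood1 : Good 1 := by
    refine ⟨fun _ => p y, continuousOn_const, fun x hx => ?_⟩
    rw [(h1 x (hKU hx)).2, hmv]
    exact smul_ne_zero (hpp y) (hp0 y)
  have hgood0 : Good 0 := by
    have hclopen : IsClopen {t | Good t} := by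
      have hnear : ∀ t : I, ∀ᶠ t' in 𝓝 t, (Good t' ↔ Good t) := by
        intro t
        have ha : Filter.Tendsto (fun t' : I => (t', t)) (𝓝 t) (𝓝 (t, t)) := (by fun_prop : Continuous (fun t' : I => (t', t))).tendsto t
        have hb : Filter.Tendsto (fun t' : I => (t, t')) (𝓝 t) (𝓝 (t, t)) := (by fun_prop : Continuous (fun t' : I => (t, t'))).tendsto t
        filter_upwards [ha.eventually (hopen t), hb.eventually (hopen t)] with t' h h'
        exact ⟨step _ _ h', step _ _ h⟩
      constructor
      · rw [← isOpen_compl_iff, isOpen_iff_mem_nhds]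
        intro t ht
        filter_upwards [hnear t] with t' h h2
        exact ht (h.1 h2)
      · rw [isOpen_iff_mem_nhds]
        intro t ht
        filter_upwards [hnear t] with t' h
        exact h.2 ht
    have : {t | Good t} = Set.univ := hclopen.eq_univ ⟨1, hgood1⟩
    have h0 : (0:I) ∈ {t | Good t} := by rw [this]; trivial
    exact h0
  obtain ⟨u, hu, hu'⟩ := hgood0
  refine ⟨u, hu, fun x hx => ?_⟩
  have := hu' x hx
  rwa [(h1 x (hKU hx)).1] at this

end LSP

namespace LSP
set_option linter.all false
set_option autoImplicit false
open Topology

lemma exists_pos_le {ι : Type*} [Finite ι] (f : ι → ℝ) (h : ∀ i, 0 < f i) : ∃ δ > 0, ∀ i, δ ≤ f i := by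
  classical
  haveI := Fintype.ofFinite ι
  by_cases hn : Nonempty ι
  · obtain ⟨i, hi⟩ := Finite.exists_min f
    exact ⟨f i, h i, hi⟩
  · exact ⟨1, one_pos, fun i => (hn ⟨i⟩).elim⟩

/-- side value in the unit square -/
def sv (s : Bool) : ℝ := if s then 1 else 0

def InCube {B : ℕ} (y : Fin B → Fin 2 → ℝ) : Prop := ∀ l a, y l a ∈ Set.Icc (0:ℝ) 1

/-- Abstract data for the cup-length type lower bound. -/
structure LB (X : Type*) [TopologicalSpace X] (B : ℕ) (S : Fin B → Type) [∀ l, Fintype (S l)] where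
  ε : ∀ l, S l → ℝ
  inv : ∀ l, Fin 2 → Bool → S l → S l
  invol : ∀ l a s k, inv l a s (inv l a s k) = k
  sgn : ∀ l a s k, ε l (inv l a s k) = - ε l k
  q : (∀ l, S l) → (Fin B → Fin 2 → ℝ) → X
  q_cont : ∀ κ, Continuous (q κ)
  q_inv : ∀ κ l a s y, InCube y → y l a = sv s → q (Function.update κ l (inv l a s (κ l))) y = q κ y
  ab : Fin B → Bool
  f : Fin B → ∀ l, S l → (Fin 2 → ℝ) → ℝ
  h : Fin B → ∀ l, S l → (Fin 2 → ℝ) → ℝ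
  f_cont : ∀ i l k, Continuous (f i l k)
  h_cont : ∀ i l k, Continuous (h i l k)
  φ : Fin B → X → UnitAddCircle
  ψ : Fin B → X → UnitAddCircle
  φ_cont : ∀ i, Continuous (φ i)
  ψ_cont : ∀ i, Continuous (ψ i)
  f_lift : ∀ i, ab i = true → ∀ κ y, ((∑ l, f i l (κ l) (y l) : ℝ) : UnitAddCircle) = φ i (q κ y)
  h_lift : ∀ i, ab i = true → ∀ κ y, ((∑ l, h i l (κ l) (y l) : ℝ) : UnitAddCircle) = ψ i (q κ y)
  f_inv : ∀ i, ab i = true → ∀ l k a s (w w' : Fin 2 → ℝ), (∀ a, w a ∈ Set.Icc (0:ℝ) 1) → (∀ a, w' a ∈ Set.Icc (0:ℝ) 1) →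
    w a = sv s → w' a = sv s → f i l (inv l a s k) w' - f i l (inv l a s k) w = f i l k w' - f i l k w
  h_inv : ∀ i, ab i = true → ∀ l k a s (w w' : Fin 2 → ℝ), (∀ a, w a ∈ Set.Icc (0:ℝ) 1) → (∀ a, w' a ∈ Set.Icc (0:ℝ) 1) →
    w a = sv s → w' a = sv s → h i l (inv l a s k) w' - h i l (inv l a s k) w = h i l k w' - h i l k w
  M : Fin B → ℕ
  p : ∀ i, (∀ l, S l) → (Fin B → Fin 2 → ℝ) → Fin (M i) → ℂ
  p_cont : ∀ i κ, Continuous (p i κ)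
  P : ∀ i, X → Matrix (Fin (M i)) (Fin (M i)) ℂ
  P_cont : ∀ i, Continuous (P i)
  P_rank : ∀ i, ab i = false → ∀ x, ∃ p : Fin (M i) → ℂ, p ≠ 0 ∧ P i x = Matrix.vecMulVec p (star p)
  P_q : ∀ i, ab i = false → ∀ κ y, P i (q κ y) = Matrix.vecMulVec (p i κ y) (star (p i κ y))
  p_inv : ∀ i, ab i = false → ∀ κ l a s, ∃ ζ : (Fin B → Fin 2 → ℝ) → ℂ,
    (∀ y, InCube y → y l a = sv s → ‖ζ y‖ = 1 ∧ p i (Function.update κ l (inv l a s (κ l))) y = ζ y • p i κ y) ∧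
    (∀ x y, InCube x → InCube y → x l a = sv s → y l a = sv s →
      ζ x * Complex.exp ((∑ l', f i l' (Function.update κ l (inv l a s (κ l)) l') (x l') *
        (h i l' (Function.update κ l (inv l a s (κ l)) l') (y l') - h i l' (Function.update κ l (inv l a s (κ l)) l') (x l')) : ℝ) * Complex.I)
      = ζ y * Complex.exp ((∑ l', f i l' (κ l') (x l') * (h i l' (κ l') (y l') - h i l' (κ l') (x l')) : ℝ) * Complex.I))
  e_inv : ∀ i, ab i = false → ∀ l k a s (w w' w'' : Fin 2 → ℝ), (∀ a, w a ∈ Set.Icc (0:ℝ) 1) → (∀ a, w' a ∈ Set.Icc (0:ℝ) 1) →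
    (∀ a, w'' a ∈ Set.Icc (0:ℝ) 1) → w a = sv s → w' a = sv s → w'' a = sv s →
    (f i l (inv l a s k) w' - f i l (inv l a s k) w) * (h i l (inv l a s k) w'' - h i l (inv l a s k) w') =
    (f i l k w' - f i l k w) * (h i l k w'' - h i l k w')

namespace LB
variable {X : Type*} [TopologicalSpace X] {B : ℕ} {S : Fin B → Type} [∀ l, Fintype (S l)] (D : LB X B S)

def gp (N : ℕ) (x : Fin (B*2) → ℕ) : Fin B → Fin 2 → ℝ := fun l a => (blk x l a : ℝ) / N

def toGrid (f : Fin B → ∀ l, S l → (Fin 2 → ℝ) → ℝ) (N : ℕ) : Fin B → ∀ l, S l → (Fin 2 → ℕ) → ℝ :=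
  fun i l k w => f i l k (fun a => (w a : ℝ) / N)

def fN (N : ℕ) := toGrid D.f N
def hN (N : ℕ) := toGrid D.h N

def glu (N : ℕ) : Glu (B*2) N (∀ l, S l) (fun κ => ∏ l, D.ε l (κ l)) where
  inv m s κ := Function.update κ (finProdFinEquiv.symm m).1 (D.inv _ (finProdFinEquiv.symm m).2 s (κ (finProdFinEquiv.symm m).1))
  invol m s κ := by simp [D.invol]
  sgn m s κ := by
    set l := (finProdFinEquiv.symm m).1
    rw [← Finset.mul_prod_erase _ _ (Finset.mem_univ l), ← Finset.mul_prod_erase (s := Finset.univ) (a := l) (f := fun l => D.ε l (κ l)) (Finset.mem_univ l)]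
    rw [Function.update_self, D.sgn, neg_mul]
    congr 2
    apply Finset.prod_congr rfl
    intro l' hl'
    rw [Function.update_of_ne (Finset.ne_of_mem_erase hl')]

lemma gp_cube {N : ℕ} (x : Fin (B*2) → ℕ) (hx : ∀ c, x c ≤ N) : InCube (gp N x) := by
  intro l a
  refine ⟨by unfold gp; positivity, ?_⟩
  unfold gp
  apply div_le_one_of_le₀
  · exact_mod_cast hx _
  · positivity

lemma gp_side {N : ℕ} (hN : 0 < N) (x : Fin (B*2) → ℕ) (m : Fin (B*2)) (s : Bool) (h : x m = sideVal N s) :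
    gp N x (finProdFinEquiv.symm m).1 (finProdFinEquiv.symm m).2 = sv s := by
  have : (N:ℝ) ≠ 0 := by positivity
  unfold gp blk
  rw [Prod.mk.eta, Equiv.apply_symm_apply, h]
  cases s <;> simp [sideVal, sv, this]

lemma eterm_eq (N : ℕ) (i : Fin B) (κ : ∀ l, S l) (x y z : Fin (B*2) → ℕ) : eterm D.ab (D.fN N) (D.hN N) i κ x y z =
    if D.ab i then (∑ l, (D.f i l (κ l) (gp N y l) - D.f i l (κ l) (gp N x l))) * (∑ l, (D.h i l (κ l) (gp N z l) - D.h i l (κ l) (gp N y l)))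
    else ∑ l, (D.f i l (κ l) (gp N y l) - D.f i l (κ l) (gp N x l)) * (D.h i l (κ l) (gp N z l) - D.h i l (κ l) (gp N y l)) := rfl

lemma sum_update (κ : ∀ l, S l) (l : Fin B) (k : S l) (F : ∀ l, S l → ℝ) (h : F l k = F l (κ l)) :
    ∑ l', F l' (Function.update κ l k l') = ∑ l', F l' (κ l') := by
  apply Finset.sum_congr rfl
  intro l' _
  by_cases hl : l' = l
  · subst hl; rw [Function.update_self, h]
  · rw [Function.update_of_ne hl]

lemma eterm_closed (N : ℕ) (i : Fin B) (κ : ∀ l, S l) : Closed2 (eterm D.ab (D.fN N) (D.hN N) i κ) := by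
  intro x y z w
  simp only [eterm_eq]
  split_ifs
  · simp only [Finset.sum_sub_distrib]; ring
  · rw [← Finset.sum_sub_distrib, ← Finset.sum_add_distrib, ← Finset.sum_sub_distrib]
    apply Finset.sum_eq_zero
    intro l _; ring

lemma eterm_inv {N : ℕ} (hN : 0 < N) (i : Fin B) : Inv2 (D.glu N) (eterm D.ab (D.fN N) (D.hN N) i) := by
  intro m s κ x y z hx hy hz bx bY bz
  have gx := gp_side hN x m s hx
  have gy := gp_side hN y m s hy
  have gz := gp_side hN z m s hz
  have cx := gp_cube x bx
  have cy := gp_cube y bY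
  have cz := gp_cube z bz
  simp only [eterm_eq]
  split_ifs with hab
  · congr 1
    · exact sum_update κ _ _ (fun l k => D.f i l k (gp N y l) - D.f i l k (gp N x l))
        (D.f_inv i hab _ _ _ s _ _ (cx _) (cy _) gx gy)
    · exact sum_update κ _ _ (fun l k => D.h i l k (gp N z l) - D.h i l k (gp N y l))
        (D.h_inv i hab _ _ _ s _ _ (cy _) (cz _) gy gz)
  · exact sum_update κ _ _ (fun l k => (D.f i l k (gp N y l) - D.f i l k (gp N x l)) * (D.h i l k (gp N z l) - D.h i l k (gp N y l)))
        (D.e_inv i (by simpa using hab) _ _ _ s _ _ _ (cx _) (cy _) (cz _) gx gy gz)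

lemma gp_dist {N : ℕ} (hN : 0 < N) (v x : Fin (B*2) → ℕ) (h : ∀ c, v c ≤ x c ∧ x c ≤ v c + 1) : dist (gp N x) (gp N v) ≤ 1 / N := by
  have hN' : (0:ℝ) < N := by positivity
  rw [dist_pi_le_iff (by positivity)]
  intro l
  rw [dist_pi_le_iff (by positivity)]
  intro a
  unfold gp
  rw [Real.dist_eq, ← sub_div, abs_div, abs_of_pos hN']
  gcongr
  have := h (finProdFinEquiv (l, a))
  have h1 : (blk v l a : ℝ) ≤ blk x l a := by exact_mod_cast this.1
  have h2 : (blk x l a : ℝ) ≤ blk v l a + 1 := by exact_mod_cast this.2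
  rw [abs_le]; constructor <;> linarith

/-- the degree one slots -/
lemma slot_ab (i : Fin B) (hab : D.ab i = true) {V0 V1 : Set X} (h0 : NullOn V0) (h1 : NullOn V1) {δ : ℝ} (hδ : 0 < δ) :
    ∃ N0 : ℕ, ∀ N ≥ N0, 0 < N → ∃ b : (∀ l, S l) → (Fin (B*2) → ℕ) → (Fin (B*2) → ℕ) → ℝ, Inv1 (D.glu N) b ∧
      ∀ κ v x y z, (∀ c, v c + 1 ≤ N) → (∀ c, v c ≤ x c ∧ x c ≤ v c + 1) → (∀ c, v c ≤ y c ∧ y c ≤ v c + 1) → (∀ c, v c ≤ z c ∧ z c ≤ v c + 1) →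
      (Metric.ball (gp N v) δ ⊆ D.q κ ⁻¹' V0 ∨ Metric.ball (gp N v) δ ⊆ D.q κ ⁻¹' V1) →
      eterm D.ab (D.fN N) (D.hN N) i κ x y z - d1 (b κ) x y z = 0 := by
  obtain ⟨α, hα, hα'⟩ := deg1_lift h0 (D.φ_cont i)
  obtain ⟨β, hβ, hβ'⟩ := deg1_lift h1 (D.ψ_cont i)
  obtain ⟨N0, hN0⟩ := exists_nat_gt (1/δ)
  refine ⟨N0, fun N hNN hN => ?_⟩
  have hN' : (0:ℝ) < N := by positivity
  have hNδ : 1 / (N:ℝ) < δ := by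
    have : (N0:ℝ) ≤ N := by exact_mod_cast hNN
    rw [one_div_lt hN' hδ]; linarith
  let F : (∀ l, S l) → (Fin B → Fin 2 → ℝ) → ℝ := fun κ y => ∑ l, D.f i l (κ l) (y l)
  let H : (∀ l, S l) → (Fin B → Fin 2 → ℝ) → ℝ := fun κ y => ∑ l, D.h i l (κ l) (y l)
  have hFc : ∀ κ, Continuous (F κ) := fun κ => continuous_finsetSum _ fun l _ => (D.f_cont i l (κ l)).comp (continuous_apply l)
  have hHc : ∀ κ, Continuous (H κ) := fun κ => continuous_finsetSum _ fun l _ => (D.h_cont i l (κ l)).comp (continuous_apply l)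
  refine ⟨fun κ x y => α (D.q κ (gp N x)) * ((H κ (gp N y) - H κ (gp N x)) - (β (D.q κ (gp N y)) - β (D.q κ (gp N x)))) -
    (F κ (gp N y) - F κ (gp N x)) * β (D.q κ (gp N y)), ?_, ?_⟩
  · intro m s κ x y hx hy bx bY
    have gx := gp_side hN x m s hx
    have gy := gp_side hN y m s hy
    have cx := gp_cube x bx
    have cy := gp_cube y bY
    have qx : D.q ((D.glu N).inv m s κ) (gp N x) = D.q κ (gp N x) := D.q_inv κ _ _ s _ cx gx
    have qy : D.q ((D.glu N).inv m s κ) (gp N y) = D.q κ (gp N y) := D.q_inv κ _ _ s _ cy gy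
    have e1 : H ((D.glu N).inv m s κ) (gp N y) - H ((D.glu N).inv m s κ) (gp N x) = H κ (gp N y) - H κ (gp N x) := by
      simp only [H, ← Finset.sum_sub_distrib]
      exact sum_update κ _ _ (fun l k => D.h i l k (gp N y l) - D.h i l k (gp N x l))
        (D.h_inv i hab _ _ _ s _ _ (cx _) (cy _) gx gy)
    have e2 : F ((D.glu N).inv m s κ) (gp N y) - F ((D.glu N).inv m s κ) (gp N x) = F κ (gp N y) - F κ (gp N x) := by
      simp only [F, ← Finset.sum_sub_distrib]
      exact sum_update κ _ _ (fun l k => D.f i l k (gp N y l) - D.f i l k (gp N x l))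
        (D.f_inv i hab _ _ _ s _ _ (cx _) (cy _) gx gy)
    simp only [qx, qy, e1, e2]
  · intro κ v x y z hv hx hy hz hball
    have inb : ∀ x, (∀ c, v c ≤ x c ∧ x c ≤ v c + 1) → gp N x ∈ Metric.ball (gp N v) δ := fun x hx =>
      lt_of_le_of_lt (gp_dist hN v x hx) hNδ
    have hpre : IsPreconnected (Metric.ball (gp N v) δ) := (convex_ball _ _).isPreconnected
    have main : eterm D.ab (D.fN N) (D.hN N) i κ x y z - d1 (fun x y => α (D.q κ (gp N x)) * ((H κ (gp N y) - H κ (gp N x)) - (β (D.q κ (gp N y)) - β (D.q κ (gp N x)))) -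
        (F κ (gp N y) - F κ (gp N x)) * β (D.q κ (gp N y))) x y z = 
        ((F κ (gp N y) - F κ (gp N x)) - (α (D.q κ (gp N y)) - α (D.q κ (gp N x)))) * 
        ((H κ (gp N z) - H κ (gp N y)) - (β (D.q κ (gp N z)) - β (D.q κ (gp N y)))) := by
      rw [eterm_eq, if_pos hab]
      simp only [Finset.sum_sub_distrib, d1, F, H]
      ring
    refine main.trans ?_
    rcases hball with hb | hb
    · have := lift_diff hα hα' (D.q_cont κ) (hFc κ) (fun y => D.f_lift i hab κ y) hpre hb (inb x hx) (inb y hy)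
      rw [this]; ring
    · have := lift_diff hβ hβ' (D.q_cont κ) (hHc κ) (fun y => D.h_lift i hab κ y) hpre hb (inb y hy) (inb z hz)
      rw [this]; ring

end LB
end LSP

namespace LSP
set_option linter.all false
set_option autoImplicit false
open Topology

lemma arg_alg {r1 r2 r3 : ℂ} {c : ℝ} (h1 : 0 < r1.re) (h2 : 0 < r2.re) (h3 : 0 < r3.re) (hc : |c| < Real.pi / 2)
    (h : r1 * r3 = r2 * Complex.exp (c * Complex.I)) : r1.arg - r2.arg + r3.arg = c := by
  have n1 : r1 ≠ 0 := fun e => by simp [e] at h1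
  have n2 : r2 ≠ 0 := fun e => by simp [e] at h2
  have n3 : r3 ≠ 0 := fun e => by simp [e] at h3
  have a1 := Complex.abs_arg_lt_pi_div_two_iff.2 (Or.inl h1)
  have a2 := Complex.abs_arg_lt_pi_div_two_iff.2 (Or.inl h2)
  have a3 := Complex.abs_arg_lt_pi_div_two_iff.2 (Or.inl h3)
  have hn : ‖r1‖ * ‖r3‖ = ‖r2‖ := by
    have := congrArg norm h
    rwa [norm_mul, norm_mul, Complex.norm_exp_ofReal_mul_I, mul_one] at this
  have he : Complex.exp ((r1.arg + r3.arg : ℝ) * Complex.I) = Complex.exp ((r2.arg + c : ℝ) * Complex.I) := by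
    rw [← Complex.norm_mul_exp_arg_mul_I r1, ← Complex.norm_mul_exp_arg_mul_I r2, ← Complex.norm_mul_exp_arg_mul_I r3] at h
    have hn' : (‖r1‖ : ℂ) * ‖r3‖ = ‖r2‖ := by exact_mod_cast hn
    have n2' : (‖r2‖ : ℂ) ≠ 0 := by simpa using n2
    apply mul_left_cancel₀ n2'
    push_cast
    rw [add_mul, add_mul, Complex.exp_add, Complex.exp_add]
    calc _ = ((‖r1‖ : ℂ) * ‖r3‖) * (Complex.exp (r1.arg * Complex.I) * Complex.exp (r3.arg * Complex.I)) := by rw [hn']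
      _ = (‖r1‖ : ℂ) * Complex.exp (r1.arg * Complex.I) * (‖r3‖ * Complex.exp (r3.arg * Complex.I)) := by ring
      _ = _ := by rw [h]; ring
  rw [Complex.exp_eq_exp_iff_exists_int] at he
  obtain ⟨n, hn⟩ := he
  have e1 : ((r1.arg + r3.arg : ℝ) : ℂ) = ((r2.arg + c + n * (2 * Real.pi) : ℝ) : ℂ) := by
    apply mul_right_cancel₀ Complex.I_ne_zero
    rw [hn]; push_cast; ring
  have e2 := Complex.ofReal_injective e1
  have hp := Real.pi_pos
  rw [abs_lt] at a1 a2 a3 hc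
  have hn1 : (n:ℝ) < 1 := by by_contra hh; push Not at hh; nlinarith [a1.1, a1.2, a2.1, a2.2, a3.1, a3.2, hc.1, hc.2]
  have hn2 : (-1:ℝ) < n := by by_contra hh; push Not at hh; nlinarith [a1.1, a1.2, a2.1, a2.2, a3.1, a3.2, hc.1, hc.2]
  have hn1' : n < 1 := by exact_mod_cast hn1
  have hn2' : -1 < n := by exact_mod_cast hn2
  have : n = 0 := by omega
  subst this
  push_cast at e2
  linarith

namespace LB
variable {X : Type*} [TopologicalSpace X] {B : ℕ} {S : Fin B → Type} [∀ l, Fintype (S l)] (D : LB X B S)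

def cubeSet (B : ℕ) : Set (Fin B → Fin 2 → ℝ) := {y | InCube y}

lemma cubeSet_compact (B : ℕ) : IsCompact (cubeSet B) := by
  have : cubeSet B = Set.univ.pi (fun _ => Set.univ.pi (fun _ => Set.Icc (0:ℝ) 1)) := by
    ext y; simp only [cubeSet, InCube, Set.mem_setOf_eq, Set.mem_pi, Set.mem_univ, true_implies, forall_const]
  rw [this]
  exact isCompact_univ_pi fun _ => isCompact_univ_pi fun _ => isCompact_Icc

set_option maxHeartbeats 1000000 in
open Matrix in
/-- the degree two slots -/
lemma slot_eta (i : Fin B) (hab : D.ab i = false) {V : Set X} (h0 : NullOn V) {δ : ℝ} (hδ : 0 < δ) :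
    ∃ N0 : ℕ, ∀ N ≥ N0, 0 < N → ∃ b : (∀ l, S l) → (Fin (B*2) → ℕ) → (Fin (B*2) → ℕ) → ℝ, Inv1 (D.glu N) b ∧
      ∀ κ v x y z, (∀ c, v c + 1 ≤ N) → (∀ c, v c ≤ x c ∧ x c ≤ v c + 1) → (∀ c, v c ≤ y c ∧ y c ≤ v c + 1) → (∀ c, v c ≤ z c ∧ z c ≤ v c + 1) →
      (Metric.ball (gp N v) δ ⊆ D.q κ ⁻¹' V) →
      eterm D.ab (D.fN N) (D.hN N) i κ x y z - d1 (b κ) x y z = 0 := by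
  classical
  -- compact sets
  let K : (∀ l, S l) → Set (Fin B → Fin 2 → ℝ) := fun κ => cubeSet B \ ⋃ z ∈ (D.q κ ⁻¹' V)ᶜ, Metric.ball z (δ/2)
  have hKc : ∀ κ, IsCompact (K κ) := fun κ => (cubeSet_compact B).diff (isOpen_biUnion fun _ _ => Metric.isOpen_ball)
  have hKV : ∀ κ, ∀ x ∈ K κ, D.q κ x ∈ V := by
    intro κ x hx
    by_contra hc
    apply hx.2
    simp only [Set.mem_iUnion]
    exact ⟨x, hc, Metric.mem_ball_self (by positivity)⟩
  let Kh : Set X := ⋃ κ, D.q κ '' K κ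
  have hKh : IsCompact Kh := isCompact_iUnion fun κ => (hKc κ).image (D.q_cont κ)
  have hKhV : Kh ⊆ V := by
    intro x hx
    simp only [Kh, Set.mem_iUnion] at hx
    obtain ⟨κ, y, hy, rfl⟩ := hx
    exact hKV κ y hy
  obtain ⟨u, hu, hu'⟩ := deg2_section h0 hKh hKhV (D.P_cont i) (D.P_rank i hab)
  let lam : (∀ l, S l) → (Fin B → Fin 2 → ℝ) → ℂ := fun κ y => star (D.p i κ y) ⬝ᵥ u (D.q κ y)
  have hlam : ∀ κ, ∀ y ∈ K κ, lam κ y ≠ 0 := by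
    intro κ y hy h
    have h2 := hu' (D.q κ y) (Set.mem_iUnion.2 ⟨κ, y, hy, rfl⟩)
    apply h2
    rw [D.P_q i hab, Matrix.vecMulVec_mulVec]
    simp only [lam] at h
    rw [h]; simp
  have hlamc : ∀ κ, ContinuousOn (lam κ) (K κ) := by
    intro κ
    have a1 : ContinuousOn (fun y => u (D.q κ y)) (K κ) :=
      hu.comp (D.q_cont κ).continuousOn (fun y hy => Set.mem_iUnion.2 ⟨κ, y, hy, rfl⟩)
    have a2 : Continuous (fun z : (Fin (D.M i) → ℂ) × (Fin (D.M i) → ℂ) => star z.1 ⬝ᵥ z.2) := by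
      unfold dotProduct; simp only [Pi.star_apply]; fun_prop
    have a3 : ContinuousOn (fun y => (D.p i κ y, u (D.q κ y))) (K κ) := ContinuousOn.prodMk (D.p_cont i κ).continuousOn a1
    exact Continuous.comp_continuousOn (f := fun y => (D.p i κ y, u (D.q κ y))) a2 a3
  let Xi : (∀ l, S l) → (Fin B → Fin 2 → ℝ) → (Fin B → Fin 2 → ℝ) → ℝ := fun κ x y => 
    ∑ l, D.f i l (κ l) (x l) * (D.h i l (κ l) (y l) - D.h i l (κ l) (x l))
  have hXic : ∀ κ, Continuous (fun z : (Fin B → Fin 2 → ℝ) × (Fin B → Fin 2 → ℝ) => Xi κ z.1 z.2) := by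
    intro κ
    refine continuous_finsetSum _ fun l _ => ?_
    have := D.f_cont i l (κ l)
    have := D.h_cont i l (κ l)
    fun_prop
  let rr : (∀ l, S l) → (Fin B → Fin 2 → ℝ) → (Fin B → Fin 2 → ℝ) → ℂ := fun κ x y => 
    lam κ y / lam κ x * Complex.exp (Xi κ x y * Complex.I)
  have hrrc : ∀ κ, ContinuousOn (fun z : (Fin B → Fin 2 → ℝ) × (Fin B → Fin 2 → ℝ) => rr κ z.1 z.2) (K κ ×ˢ K κ) := by
    intro κ
    refine ContinuousOn.mul (ContinuousOn.div ?_ ?_ ?_) ?_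
    · exact (hlamc κ).comp continuousOn_snd (fun z hz => hz.2)
    · exact (hlamc κ).comp continuousOn_fst (fun z hz => hz.1)
    · exact fun z hz => hlam κ _ hz.1
    · have := hXic κ
      exact Continuous.continuousOn (by fun_prop)
  let cc : (∀ l, S l) → (Fin B → Fin 2 → ℝ) → (Fin B → Fin 2 → ℝ) → (Fin B → Fin 2 → ℝ) → ℝ := fun κ x y z => 
    ∑ l, (D.f i l (κ l) (y l) - D.f i l (κ l) (x l)) * (D.h i l (κ l) (z l) - D.h i l (κ l) (y l))
  have hccc : ∀ κ, Continuous (fun z : (Fin B → Fin 2 → ℝ) × (Fin B → Fin 2 → ℝ) × (Fin B → Fin 2 → ℝ) => cc κ z.1 z.2.1 z.2.2) := by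
    intro κ
    refine continuous_finsetSum _ fun l _ => ?_
    have := D.f_cont i l (κ l)
    have := D.h_cont i l (κ l)
    fun_prop
  -- uniform smallness
  have hsm1 : ∀ κ, ∃ η > 0, ∀ x ∈ K κ, ∀ y ∈ K κ, dist x y < η → 0 < (rr κ x y).re := by
    intro κ
    have huc := ((hKc κ).prod (hKc κ)).uniformContinuousOn_of_continuous (hrrc κ)
    rw [Metric.uniformContinuousOn_iff] at huc
    obtain ⟨η, hη, h⟩ := huc 1 one_pos
    refine ⟨η, hη, fun x hx y hy hd => ?_⟩
    have h2 := h (x, y) ⟨hx, hy⟩ (x, x) ⟨hx, hx⟩ (by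
      rw [Prod.dist_eq]; simp only [dist_self]; rw [dist_comm]; exact max_lt hη hd)
    have h3 : rr κ x x = 1 := by
      simp only [rr, Xi, sub_self, mul_zero, Finset.sum_const_zero, Complex.ofReal_zero, zero_mul, Complex.exp_zero, mul_one]
      exact div_self (hlam κ x hx)
    simp only [h3] at h2
    rw [dist_eq_norm] at h2
    have h4 := (Complex.abs_re_le_norm (rr κ x y - 1)).trans_lt h2
    rw [abs_lt] at h4
    simp at h4
    linarith [h4.1]
  have hsm2 : ∀ κ, ∃ η > 0, ∀ x ∈ cubeSet B, ∀ y ∈ cubeSet B, ∀ z ∈ cubeSet B, dist x y < η → dist x z < η → |cc κ x y z| < Real.pi / 2 := by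
    intro κ
    have huc := ((cubeSet_compact B).prod ((cubeSet_compact B).prod (cubeSet_compact B))).uniformContinuousOn_of_continuous (hccc κ).continuousOn
    rw [Metric.uniformContinuousOn_iff] at huc
    obtain ⟨η, hη, h⟩ := huc (Real.pi / 2) (by have := Real.pi_pos; positivity)
    refine ⟨η, hη, fun x hx y hy z hz hd hd' => ?_⟩
    have h2 := h (x, y, z) ⟨hx, hy, hz⟩ (x, x, x) ⟨hx, hx, hx⟩ (by
      rw [Prod.dist_eq, Prod.dist_eq]; simp only [dist_self]
      rw [dist_comm y, dist_comm z]; exact max_lt hη (max_lt hd hd'))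
    have h3 : cc κ x x x = 0 := by simp [cc]
    simp only [h3, dist_zero_right, Real.norm_eq_abs] at h2
    exact h2
  choose η1 hη1 hsm1 using hsm1
  choose η2 hη2 hsm2 using hsm2
  obtain ⟨θ1, hθ1, hθ1'⟩ := exists_pos_le η1 hη1
  obtain ⟨θ2, hθ2, hθ2'⟩ := exists_pos_le η2 hη2
  obtain ⟨N0, hN0⟩ := exists_nat_gt (2/δ + 2/θ1 + 2/θ2)
  refine ⟨N0, fun N hNN hN => ?_⟩
  have hN' : (0:ℝ) < N := by positivity
  have hNN' : (N0:ℝ) ≤ N := by exact_mod_cast hNN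
  have p1 : 0 < 2/δ := by positivity
  have p2 : 0 < 2/θ1 := by positivity
  have p3 : 0 < 2/θ2 := by positivity
  have hNδ : 1 / (N:ℝ) < δ/2 := by
    rw [one_div_lt hN' (by positivity), one_div_div]; linarith
  have hN1 : 2 / (N:ℝ) < θ1 := by
    rw [div_lt_comm₀ hN' hθ1]; linarith
  have hN2 : 2 / (N:ℝ) < θ2 := by
    rw [div_lt_comm₀ hN' hθ2]; linarith
  refine ⟨fun κ x y => (rr κ (gp N x) (gp N y)).arg, ?_, ?_⟩
  · intro m s κ x y hx hy bx bY
    have gx := gp_side hN x m s hx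
    have gy := gp_side hN y m s hy
    have cx := gp_cube x bx
    have cy := gp_cube y bY
    have qx : D.q ((D.glu N).inv m s κ) (gp N x) = D.q κ (gp N x) := D.q_inv κ _ _ s _ cx gx
    have qy : D.q ((D.glu N).inv m s κ) (gp N y) = D.q κ (gp N y) := D.q_inv κ _ _ s _ cy gy
    obtain ⟨ζ, hζ, hζ'⟩ := D.p_inv i hab κ (finProdFinEquiv.symm m).1 (finProdFinEquiv.symm m).2 s
    obtain ⟨zx, px⟩ := hζ _ cx gx
    obtain ⟨zy, py⟩ := hζ _ cy gy
    have hz := hζ' _ _ cx cy gx gy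
    change D.p i ((D.glu N).inv m s κ) (gp N x) = _ at px
    change D.p i ((D.glu N).inv m s κ) (gp N y) = _ at py
    change ζ (gp N x) * Complex.exp ((Xi ((D.glu N).inv m s κ) (gp N x) (gp N y) : ℝ) * Complex.I) = ζ (gp N y) * Complex.exp ((Xi κ (gp N x) (gp N y) : ℝ) * Complex.I) at hz
    have lx : lam ((D.glu N).inv m s κ) (gp N x) = star (ζ (gp N x)) * lam κ (gp N x) := by
      simp only [lam]; rw [qx, px, star_smul, smul_dotProduct, smul_eq_mul]
    have ly : lam ((D.glu N).inv m s κ) (gp N y) = star (ζ (gp N y)) * lam κ (gp N y) := by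
      simp only [lam]; rw [qy, py, star_smul, smul_dotProduct, smul_eq_mul]
    have nx : ζ (gp N x) ≠ 0 := fun h => by rw [h] at zx; simp at zx
    have ny : ζ (gp N y) ≠ 0 := fun h => by rw [h] at zy; simp at zy
    have sx : star (ζ (gp N x)) = (ζ (gp N x))⁻¹ := (Complex.inv_eq_conj zx).symm
    have sy : star (ζ (gp N y)) = (ζ (gp N y))⁻¹ := (Complex.inv_eq_conj zy).symm
    have : rr ((D.glu N).inv m s κ) (gp N x) (gp N y) = rr κ (gp N x) (gp N y) := by
      simp only [rr]
      rw [lx, ly, sx, sy]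
      have e1 : Complex.exp ((Xi ((D.glu N).inv m s κ) (gp N x) (gp N y) : ℝ) * Complex.I) = 
        (ζ (gp N x))⁻¹ * ζ (gp N y) * Complex.exp ((Xi κ (gp N x) (gp N y) : ℝ) * Complex.I) := by
        rw [mul_assoc, ← hz, inv_mul_cancel_left₀ nx]
      rw [e1]
      by_cases hl : lam κ (gp N x) = 0
      · simp [hl]
      · field_simp
    simp only [this]
  · intro κ v x y z hv hx hy hz hball
    have inK : ∀ x, (∀ c, v c ≤ x c ∧ x c ≤ v c + 1) → gp N x ∈ K κ := by
      intro x hx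
      refine ⟨gp_cube x (fun c => (hx c).2.trans (hv c)), ?_⟩
      simp only [Set.mem_iUnion, not_exists]
      intro w hw hxw
      apply hw
      apply hball
      rw [Metric.mem_ball] at hxw ⊢
      calc dist w (gp N v) ≤ dist w (gp N x) + dist (gp N x) (gp N v) := dist_triangle _ _ _
        _ < δ/2 + δ/2 := by
          rw [dist_comm w]
          exact add_lt_add hxw (lt_of_le_of_lt (gp_dist hN v x hx) hNδ)
        _ = δ := by ring
    have near : ∀ x y, (∀ c, v c ≤ x c ∧ x c ≤ v c + 1) → (∀ c, v c ≤ y c ∧ y c ≤ v c + 1) → dist (gp N x) (gp N y) ≤ 2 / N := by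
      intro x y hx hy
      calc dist (gp N x) (gp N y) ≤ dist (gp N x) (gp N v) + dist (gp N y) (gp N v) := dist_triangle_right _ _ _
        _ ≤ 1/N + 1/N := add_le_add (gp_dist hN v x hx) (gp_dist hN v y hy)
        _ = 2/N := by ring
    have kx := inK x hx
    have ky := inK y hy
    have kz := inK z hz
    have nxy := near x y hx hy
    have nxz := near x z hx hz
    have nyz := near y z hy hz
    have r1 := hsm1 κ _ ky _ kz (lt_of_le_of_lt nyz (hN1.trans_le (hθ1' κ)))
    have r2 := hsm1 κ _ kx _ kz (lt_of_le_of_lt nxz (hN1.trans_le (hθ1' κ)))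
    have r3 := hsm1 κ _ kx _ ky (lt_of_le_of_lt nxy (hN1.trans_le (hθ1' κ)))
    have hc := hsm2 κ _ kx.1 _ ky.1 _ kz.1 (lt_of_le_of_lt nxy (hN2.trans_le (hθ2' κ))) (lt_of_le_of_lt nxz (hN2.trans_le (hθ2' κ)))
    have alg : rr κ (gp N y) (gp N z) * rr κ (gp N x) (gp N y) = rr κ (gp N x) (gp N z) * Complex.exp (cc κ (gp N x) (gp N y) (gp N z) * Complex.I) := by
      have hXi : Xi κ (gp N y) (gp N z) + Xi κ (gp N x) (gp N y) = Xi κ (gp N x) (gp N z) + cc κ (gp N x) (gp N y) (gp N z) := by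
        simp only [Xi, cc, ← Finset.sum_add_distrib]
        apply Finset.sum_congr rfl; intro l _; ring
      have hE : Complex.exp (Xi κ (gp N y) (gp N z) * Complex.I) * Complex.exp (Xi κ (gp N x) (gp N y) * Complex.I) = 
          Complex.exp (Xi κ (gp N x) (gp N z) * Complex.I) * Complex.exp (cc κ (gp N x) (gp N y) (gp N z) * Complex.I) := by
        rw [← Complex.exp_add, ← Complex.exp_add, ← add_mul, ← add_mul]
        congr 2
        exact_mod_cast hXi
      have l1 := hlam κ _ kx
      have l2 := hlam κ _ ky
      simp only [rr]
      calc _ = (lam κ (gp N z) / lam κ (gp N y)) * (lam κ (gp N y) / lam κ (gp N x)) * (Complex.exp (Xi κ (gp N y) (gp N z) * Complex.I) * Complex.exp (Xi κ (gp N x) (gp N y) * Complex.I)) := by ring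
        _ = _ := by rw [hE, div_mul_div_cancel₀ l2]; ring
    have := arg_alg r1 r2 r3 hc alg
    rw [eterm_eq, if_neg (by simp [hab])]
    simp only [d1]
    rw [this]
    simp [cc]

/-- the abstract lower bound -/
theorem contra (V0 V1 : Fin B → Set X) (ho0 : ∀ i, IsOpen (V0 i)) (ho1 : ∀ i, IsOpen (V1 i))
    (hn0 : ∀ i, NullOn (V0 i)) (hn1 : ∀ i, NullOn (V1 i)) (heq : ∀ i, D.ab i = false → V1 i = V0 i)
    (hcov : ∀ x, ∃ i, x ∈ V0 i ∨ x ∈ V1 i)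
    (P : ∀ i l, S l → Prop)
    (hf : ∀ i l k, D.ab i = true → ¬ P i l k → ∀ x y, D.f i l k x = D.f i l k y)
    (hh : ∀ i l k, D.ab i = true → ¬ P i l k → ∀ x y, D.h i l k x = D.h i l k y)
    (hP : ∀ i i' l k, D.ab i = true → D.ab i' = true → P i l k → P i' l k → i = i') 
    (hJ : ∀ N > 0, ∀ i l, 0 ≤ Jterm N D.ε (D.fN N) (D.hN N) i l)
    (hJ' : ∀ N > 0, ∀ i, 0 < Jterm N D.ε (D.fN N) (D.hN N) i i) : False := by
  classical
  -- Lebesgue number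
  have hleb : ∀ κ, ∃ δ > 0, ∀ x ∈ cubeSet B, ∃ ib : Fin B × Bool, Metric.ball x δ ⊆ D.q κ ⁻¹' (if ib.2 then V1 ib.1 else V0 ib.1) := by
    intro κ
    apply lebesgue_number_lemma_of_metric (cubeSet_compact B)
    · rintro ⟨i, b⟩
      cases b
      · exact (ho0 i).preimage (D.q_cont κ)
      · exact (ho1 i).preimage (D.q_cont κ)
    · intro x _
      obtain ⟨i, h | h⟩ := hcov (D.q κ x)
      · exact Set.mem_iUnion.2 ⟨(i, false), h⟩
      · exact Set.mem_iUnion.2 ⟨(i, true), h⟩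
  choose δ hδ hleb using hleb
  obtain ⟨η, hη, hη'⟩ := exists_pos_le δ hδ
  have slots : ∀ i, ∃ N0 : ℕ, ∀ N ≥ N0, 0 < N → ∃ b : (∀ l, S l) → (Fin (B*2) → ℕ) → (Fin (B*2) → ℕ) → ℝ, Inv1 (D.glu N) b ∧
      ∀ κ v x y z, (∀ c, v c + 1 ≤ N) → (∀ c, v c ≤ x c ∧ x c ≤ v c + 1) → (∀ c, v c ≤ y c ∧ y c ≤ v c + 1) → (∀ c, v c ≤ z c ∧ z c ≤ v c + 1) →
      (Metric.ball (gp N v) η ⊆ D.q κ ⁻¹' V0 i ∨ Metric.ball (gp N v) η ⊆ D.q κ ⁻¹' V1 i) →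
      eterm D.ab (D.fN N) (D.hN N) i κ x y z - d1 (b κ) x y z = 0 := by
    intro i
    cases hab : D.ab i
    · obtain ⟨N0, h⟩ := D.slot_eta i hab (hn0 i) hη
      refine ⟨N0, fun N hN hN' => ?_⟩
      obtain ⟨b, hb, hb'⟩ := h N hN hN'
      refine ⟨b, hb, fun κ v x y z hv hx hy hz hB => ?_⟩
      apply hb' κ v x y z hv hx hy hz
      rw [heq i hab, or_self] at hB
      exact hB
    · exact D.slot_ab i hab (hn0 i) (hn1 i) hη
  choose N0 hN0 using slots
  set N := ∑ i, N0 i + 1 with hN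
  have hNpos : 0 < N := by omega
  have hNN : ∀ i, N ≥ N0 i := fun i => by
    have := Finset.single_le_sum (f := N0) (fun _ _ => Nat.zero_le _) (Finset.mem_univ i)
    omega
  choose b hb hb' using fun i => hN0 i N (hNN i) hNpos
  let e : ℕ → (∀ l, S l) → (Fin (B*2) → ℕ) → (Fin (B*2) → ℕ) → (Fin (B*2) → ℕ) → ℝ := fun i => 
    if h : i < B then eterm D.ab (D.fN N) (D.hN N) ⟨i, h⟩ else fun _ _ _ _ => 0
  let bb : ℕ → (∀ l, S l) → (Fin (B*2) → ℕ) → (Fin (B*2) → ℕ) → ℝ := fun i => 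
    if h : i < B then b ⟨i, h⟩ else fun _ _ _ => 0
  have he : ∀ i : Fin B, e i = eterm D.ab (D.fN N) (D.hN N) i := fun i => by simp [e, i.2]
  have hbb : ∀ i : Fin B, bb i = b i := fun i => by simp [bb, i.2]
  have ht := telescope (mul_comm B 2) (D.glu N) (e := e) (b := bb) ?_ ?_ ?_
  rotate_left
  · intro i κ
    by_cases h : i < B
    · rw [he ⟨i, h⟩]; exact D.eterm_closed N _ κ
    · simp only [e, h, dif_neg, not_false_eq_true]; intro _ _ _ _; simp
  · intro i
    by_cases h : i < B
    · rw [he ⟨i, h⟩]; exact D.eterm_inv hNpos _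
    · simp only [e, h, dif_neg, not_false_eq_true]; intro m s κ x y z _ _ _ _ _ _; rfl
  · intro i
    by_cases h : i < B
    · rw [hbb ⟨i, h⟩]; exact hb _
    · simp only [bb, h, dif_neg, not_false_eq_true]; intro m s κ x y _ _ _ _; rfl
  have hev := evaluate N D.ε D.ab (D.fN N) (D.hN N) P (fun i l k h1 h2 x y => hf i l k h1 h2 _ _)
    (fun i l k h1 h2 x y => hh i l k h1 h2 _ _) hP e he
  have hzero : gint N (fun κ : ∀ l, S l => ∏ l, D.ε l (κ l)) (fun κ x => PR (fun i x y z => e i κ x y z - d1 (bb i κ) x y z) B x) = 0 := by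
    unfold gint
    apply Finset.sum_eq_zero
    intro κ _
    apply mul_eq_zero_of_right
    apply Finset.sum_eq_zero
    intro v hv
    apply Finset.sum_eq_zero
    intro ς _
    apply mul_eq_zero_of_right
    have hv' : ∀ c, v c + 1 ≤ N := by
      intro c
      have := Fintype.mem_piFinset.1 hv c
      rw [Finset.mem_range] at this
      omega
    obtain ⟨⟨i, bo⟩, hib⟩ := hleb κ (gp N v) (gp_cube v (fun c => by have := hv' c; omega))
    have hb2 := (Metric.ball_subset_ball (hη' κ)).trans hib
    refine Finset.prod_eq_zero (Finset.mem_range.2 i.2) ?_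
    have near : ∀ k c, v c ≤ gpath v ς k c ∧ gpath v ς k c ≤ v c + 1 := by
      intro k c; unfold gpath; split_ifs <;> omega
    beta_reduce
    rw [he i, hbb i]
    apply hb' i κ v _ _ _ hv' (near _) (near _) (near _)
    cases bo
    · left; exact hb2
    · right; exact hb2
  rw [hev, hzero] at ht
  have hpos : 0 < ∑ π : Equiv.Perm (Fin B), ∏ i, Jterm N D.ε (D.fN N) (D.hN N) i (π i) := by
    apply Finset.sum_pos'
    · intro π _
      exact Finset.prod_nonneg fun i _ => hJ N hNpos i _
    · exact ⟨1, Finset.mem_univ _, Finset.prod_pos fun i _ => hJ' N hNpos i⟩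
  linarith

end LB
end LSP

namespace LSP
set_option linter.all false
set_option autoImplicit false
open Topology

/-! ### local geometry of one block -/

def GG : ℕ → ℕ
  | 0 => 1
  | (g+1) => g+1

lemma GG_pos (g : ℕ) : 0 < GG g := by cases g <;> simp [GG]

instance (g : ℕ) : NeZero (4 * GG g) := ⟨by have := GG_pos g; omega⟩

abbrev SS (g : ℕ) : Type := Fin (4 * GG g) × Bool

def sg (b : Bool) : ℝ := if b then 1 else -1

def uu (b : Bool) (t : ℝ) : ℝ := 1/2 + sg b * cl t / 2

lemma uu_cont (b : Bool) : Continuous (uu b) := by unfold uu; fun_prop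

lemma uu_mem (b : Bool) (t : ℝ) : uu b t ∈ Set.Icc (0:ℝ) 1 := by
  have := cl_mem t
  cases b <;> simp only [uu, sg, if_true, Bool.false_eq_true, if_false] <;> constructor <;> linarith [this.1, this.2]

lemma uu_not (b : Bool) (t : ℝ) : uu (!b) t = 1 - uu b t := by
  cases b <;> simp only [uu, sg, if_true, Bool.false_eq_true, if_false, Bool.not_true, Bool.not_false] <;> ring

lemma uu_zero (b : Bool) : uu b 0 = 1/2 := by simp [uu]
lemma uu_true_one : uu true 1 = 1 := by norm_num [uu, sg]
lemma uu_false_one : uu false 1 = 0 := by norm_num [uu, sg]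

/-- the angle -/
def ang (k : ℕ × Bool) (t : ℝ) : ℝ := k.1 + uu k.2 t

abbrev kn {g : ℕ} (k : SS g) : ℕ × Bool := (k.1, k.2)

def lz (g : ℕ) (k : SS g) (w : Fin 2 → ℝ) : Disc := dpt (GG g) (w 0) (ang (kn k) (w 1))

lemma lz_cont (g : ℕ) (k : SS g) : Continuous (lz g k) := by
  refine (dpt_cont (GG g)).comp (f := fun w : Fin 2 → ℝ => (w 0, ang (kn k) (w 1))) ?_
  have := uu_cont k.2
  unfold ang; fun_prop

def pairk (g : ℕ) (k : Fin (4 * GG g)) : Fin (4 * GG g) :=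
  ⟨4 * (k.1 / 4) + (k.1 % 4 + 2) % 4, by have := k.2; omega⟩

def linv (g : ℕ) (a : Fin 2) (s : Bool) (k : SS g) : SS g :=
  if a = 0 then (if s then (pairk g k.1, !k.2) else (k.1, !k.2))
  else (if s then (if k.2 then (k.1 + 1, false) else (k.1 - 1, true)) else (k.1, !k.2))

lemma pairk_pairk (g : ℕ) (k : Fin (4 * GG g)) : pairk g (pairk g k) = k := by
  apply Fin.ext; simp only [pairk]; omega

lemma linv_invol (g : ℕ) (a : Fin 2) (s : Bool) (k : SS g) : linv g a s (linv g a s k) = k := by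
  obtain ⟨k, b⟩ := k
  fin_cases a <;> cases s <;> cases b <;> simp [linv, pairk_pairk]

lemma linv_sgn (g : ℕ) (a : Fin 2) (s : Bool) (k : SS g) : sg (linv g a s k).2 = - sg k.2 := by
  obtain ⟨k, b⟩ := k
  fin_cases a <;> cases s <;> cases b <;> simp [linv, sg]

/-- successor mod 4G -/
lemma fin_succ_val (g : ℕ) (k : Fin (4 * GG g)) : ((k + 1 : Fin (4 * GG g)) : ℕ) = k + 1 ∨
    ((k:ℕ) = 4 * GG g - 1 ∧ ((k + 1 : Fin (4 * GG g)) : ℕ) = 0) := by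
  have := GG_pos g
  have hk := k.2
  have h1 : ((1 : Fin (4 * GG g)) : ℕ) = 1 := by
    rw [Fin.val_one']; exact Nat.mod_eq_of_lt (by omega)
  rw [Fin.val_add, h1]
  by_cases h : (k:ℕ) + 1 < 4 * GG g
  · left; exact Nat.mod_eq_of_lt h
  · right
    have : (k:ℕ) + 1 = 4 * GG g := by omega
    rw [this]; simp; omega

lemma lz_inv_succ (g : ℕ) (k : Fin (4 * GG g)) (w : Fin 2 → ℝ) (h : w 1 = 1) :
    lz g (k + 1, false) w = lz g (k, true) w := by
  apply Subtype.ext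
  simp only [lz, dpt_val, ang, kn, h, uu_true_one, uu_false_one, add_zero]
  congr 1
  have hG := GG_pos g
  rcases fin_succ_val g k with h1 | ⟨h1, h2⟩
  · rw [h1]; push_cast; rfl
  · rw [h2, h1]
    have : (((4 * GG g - 1 : ℕ) : ℝ) + 1) = 0 + 4 * GG g := by
      rw [Nat.cast_sub (by omega)]; push_cast; ring
    rw [this, EE_period hG]; simp

/-- the disc point is invariant except on the outer boundary -/
lemma lz_inv (g : ℕ) (a : Fin 2) (s : Bool) (k : SS g) (w : Fin 2 → ℝ) (h : w a = sv s) (hne : ¬ (a = 0 ∧ s = true)) :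
    lz g (linv g a s k) w = lz g k w := by
  obtain ⟨k, b⟩ := k
  fin_cases a
  · cases s
    · apply Subtype.ext
      have h : w 0 = 0 := by simpa [sv] using h
      simp [lz, dpt_val, h]
    · simp at hne
  · cases s
    · have h : w 1 = 0 := by simpa [sv] using h
      simp [lz, linv, ang, h, uu_zero]
    · have h : w 1 = 1 := by simpa [sv] using h
      cases b
      · have := lz_inv_succ g (k - 1) w h
        rw [sub_add_cancel] at this
        simpa [linv] using this.symm
      · simpa [linv] using lz_inv_succ g k w h

def dq : (g : ℕ) → Disc → Mg g
  | 0 => fun z => (⟨WithLp.toLp 2 ![2 * (z:ℂ).re * √(1 - ‖(z:ℂ)‖^2), 2 * (z:ℂ).im * √(1 - ‖(z:ℂ)‖^2), 2 * ‖(z:ℂ)‖^2 - 1], by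
      rw [mem_sphere_zero_iff_norm, EuclideanSpace.norm_eq, Real.sqrt_eq_one]
      have h0 : ‖(z:ℂ)‖^2 ≤ 1 := by have := z.2; have := norm_nonneg (z:ℂ); nlinarith
      have h1 := Real.sq_sqrt (show 0 ≤ 1 - ‖(z:ℂ)‖^2 by linarith)
      have h2 : (z:ℂ).re^2 + (z:ℂ).im^2 = ‖(z:ℂ)‖^2 := by rw [Complex.sq_norm, Complex.normSq_apply]; ring
      simp only [Fin.sum_univ_three, Real.norm_eq_abs, sq_abs, Matrix.cons_val_zero, Matrix.cons_val_one, Matrix.cons_val]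
      set a := √(1 - ‖(z:ℂ)‖^2)
      have : (2 * (z:ℂ).re * a)^2 + (2 * (z:ℂ).im * a)^2 = 4 * ((z:ℂ).re^2 + (z:ℂ).im^2) * a^2 := by ring
      rw [this, h2, h1]; ring⟩ : Metric.sphere (0 : EuclideanSpace ℝ (Fin 3)) 1)
  | (g+1) => mq g

lemma dq_cont (g : ℕ) : Continuous (dq g) := by
  cases g with
  | zero =>
    refine Continuous.subtype_mk (f := fun z : Disc => WithLp.toLp 2 ![2 * (z:ℂ).re * √(1 - ‖(z:ℂ)‖^2), 2 * (z:ℂ).im * √(1 - ‖(z:ℂ)‖^2), 2 * ‖(z:ℂ)‖^2 - 1]) ?_ _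
    refine (PiLp.continuous_toLp 2 _).comp ?_
    refine continuous_pi fun i => ?_
    fin_cases i <;> simp <;> fun_prop
  | succ g => exact mq_cont g

lemma dq_surj (g : ℕ) : Function.Surjective (dq g) := by
  cases g with
  | zero =>
    rintro ⟨x, hx⟩
    rw [mem_sphere_zero_iff_norm, EuclideanSpace.norm_eq, Real.sqrt_eq_one] at hx
    simp only [Fin.sum_univ_three, Real.norm_eq_abs, sq_abs] at hx
    have key : ∀ z : Disc, 2 * (z:ℂ).re * √(1 - ‖(z:ℂ)‖^2) = x 0 → 2 * (z:ℂ).im * √(1 - ‖(z:ℂ)‖^2) = x 1 → 2 * ‖(z:ℂ)‖^2 - 1 = x 2 →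
        ∃ z, dq 0 z = (⟨x, by rw [mem_sphere_zero_iff_norm, EuclideanSpace.norm_eq, Real.sqrt_eq_one]; simpa only [Fin.sum_univ_three, Real.norm_eq_abs, sq_abs] using hx⟩ : Metric.sphere (0 : EuclideanSpace ℝ (Fin 3)) 1) := by
      intro z h0 h1 h2
      refine ⟨z, Subtype.ext ?_⟩
      ext i
      fin_cases i
      · exact h0
      · exact h1
      · exact h2
    by_cases h : x 2 = 1
    · have : x 0 = 0 ∧ x 1 = 0 := by
        rw [h] at hx
        constructor <;> nlinarith [sq_nonneg (x 0), sq_nonneg (x 1)]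
      exact key ⟨1, by simp⟩ (by simp [this.1]) (by simp [this.2]) (by simp [h]; norm_num)
    · have h1 : x 2 < 1 := by
        refine lt_of_le_of_ne ?_ h
        nlinarith [sq_nonneg (x 0), sq_nonneg (x 1)]
      have h1' : -1 ≤ x 2 := by nlinarith [sq_nonneg (x 0), sq_nonneg (x 1)]
      set β := √((1 - x 2)/2) with hβ
      have hb : β^2 = (1 - x 2)/2 := Real.sq_sqrt (by linarith)
      have hb0 : 0 < β := Real.sqrt_pos.2 (by linarith)
      set z : ℂ := ⟨x 0 / (2*β), x 1 / (2*β)⟩ with hz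
      have hn : ‖z‖^2 = (1 + x 2)/2 := by
        rw [Complex.sq_norm, Complex.normSq_apply]
        simp only [hz]
        have : x 0 / (2 * β) * (x 0 / (2 * β)) + x 1 / (2 * β) * (x 1 / (2 * β)) = (x 0^2 + x 1^2) / (4 * β^2) := by field_simp; ring
        rw [this, hb, div_eq_iff (by linarith)]
        linear_combination hx
      have hs : √(1 - ‖z‖^2) = β := by rw [hn, hβ]; congr 1; ring
      refine key ⟨z, ?_⟩ ?_ ?_ ?_
      · rw [← sq_le_one_iff₀ (norm_nonneg _), hn]; linarith
      · show 2 * z.re * √(1 - ‖z‖^2) = _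
        rw [hs]; simp only [hz]; field_simp
      · show 2 * z.im * √(1 - ‖z‖^2) = _
        rw [hs]; simp only [hz]; field_simp
      · simp only [hn]; ring
  | succ g => exact mq_surj g

/-- boundary invariance -/
lemma dq_inv (g : ℕ) (a : Fin 2) (s : Bool) (k : SS g) (w : Fin 2 → ℝ) (h : w a = sv s) (hw : ∀ a, w a ∈ Set.Icc (0:ℝ) 1) :
    dq g (lz g (linv g a s k) w) = dq g (lz g k w) := by
  by_cases hne : a = 0 ∧ s = true
  swap
  · rw [lz_inv g a s k w h hne]
  obtain ⟨rfl, rfl⟩ := hne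
  have h : w 0 = 1 := by simpa [sv] using h
  cases g with
  | zero =>
    apply Subtype.ext
    ext i
    have e : ∀ k, ‖(lz 0 k w : ℂ)‖ = 1 := fun k => by rw [lz, dpt_norm, h, cl_one]
    fin_cases i <;> simp [dq, e]
  | succ g =>
    have key : ∀ (k k' : Fin (4*(g+1))) (b : Bool) (j : Fin (g+1)) (r : Fin 2), (k:ℕ) = 4 * j + r → (k':ℕ) = 4 * j + r + 2 →
        mq g (lz (g+1) (k, b) w) = mq g (lz (g+1) (k', !b) w) := by
      intro k k' b j r hk hk'
      apply Quot.sound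
      refine ⟨j, r, uu b (w 1), (uu_mem _ _).1, (uu_mem _ _).2, ?_, ?_⟩
      · rw [polyBP_eq, lz, dpt_val, h, cl_one, ang]
        simp only [kn, hk, GG]; push_cast; ring_nf
      · rw [polyBP_eq, lz, dpt_val, h, cl_one, ang, ← uu_not]
        simp only [kn, hk', GG]; push_cast; ring_nf
    obtain ⟨k, b⟩ := k
    have hk : (k:ℕ) < 4 * (g+1) := k.2
    have hl : linv (g+1) 0 true (k, b) = (pairk (g+1) k, !b) := by simp [linv]
    rw [hl]
    show mq g _ = mq g _
    by_cases hr : (k:ℕ) % 4 < 2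
    · refine (key k _ b ⟨k/4, by omega⟩ ⟨k % 4, hr⟩ ?_ ?_).symm
      · simp; omega
      · simp [pairk]; omega
    · have := key (pairk (g+1) k) k (!b) ⟨k/4, by omega⟩ ⟨k % 4 - 2, by omega⟩ ?_ ?_
      · simpa using this
      · simp [pairk]; omega
      · simp; omega

end LSP

namespace LSP
set_option linter.all false
set_option autoImplicit false
open Topology

/-! ### local degree one classes; `c = false` : a, `c = true` : b -/

def rr (c : Bool) (r : ℕ) (u : ℝ) : ℝ :=
  if c then (if r = 0 then 0 else if r = 1 then u else if r = 2 then 1 else 1 - u)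
  else (if r = 0 then u else if r = 1 then 1 else if r = 2 then 1 - u else 0)

/-- real valued form on sector group `m` -/
def psi (m : ℕ) (c : Bool) (k : ℕ × Bool) (w : Fin 2 → ℝ) : ℝ :=
  if k.1 / 4 = m then cl (w 0) * rr c (k.1 % 4) (uu k.2 (w 1)) else 0

lemma psi_cont (m : ℕ) (c : Bool) (k : ℕ × Bool) : Continuous (psi m c k) := by
  unfold psi
  split_ifs
  · have := uu_cont k.2
    unfold rr
    split_ifs <;> fun_prop
  · exact continuous_const

lemma psi_inv (g m : ℕ) (c : Bool) (a : Fin 2) (s : Bool) (k : SS g) (w w' : Fin 2 → ℝ) (h : w a = sv s) (h' : w' a = sv s) :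
    psi m c (kn (linv g a s k)) w' - psi m c (kn (linv g a s k)) w = psi m c (kn k) w' - psi m c (kn k) w := by
  obtain ⟨k, b⟩ := k
  fin_cases a
  · cases s
    · have h : w 0 = 0 := by simpa [sv] using h
      have h' : w' 0 = 0 := by simpa [sv] using h'
      simp [psi, h, h']
    · have h : w 0 = 1 := by simpa [sv] using h
      have h' : w' 0 = 1 := by simpa [sv] using h'
      have hd : ((pairk g k : Fin _) : ℕ) / 4 = (k:ℕ) / 4 := by simp only [pairk]; omega
      have hm : ((pairk g k : Fin _) : ℕ) % 4 = ((k:ℕ) % 4 + 2) % 4 := by simp only [pairk]; omega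
      have hlt : (k:ℕ) % 4 < 4 := Nat.mod_lt _ (by norm_num)
      simp only [linv, psi, kn, h, h', cl_one, if_true, hd, hm, uu_not, one_mul, Fin.zero_eta]
      split_ifs
      · generalize (k:ℕ) % 4 = r at hlt
        interval_cases r <;> cases c <;> simp [rr]
      · rfl
  · cases s
    · have h : w 1 = 0 := by simpa [sv] using h
      have h' : w' 1 = 0 := by simpa [sv] using h'
      simp [psi, h, h', uu_zero, linv]
    · have h : w 1 = 1 := by simpa [sv] using h
      have h' : w' 1 = 1 := by simpa [sv] using h'
      have key : ∀ (k : Fin (4 * GG g)) (w : Fin 2 → ℝ), w 1 = 1 → psi m c ((k + 1 : Fin (4 * GG g)), false) w = psi m c (k, true) w := by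
        intro k w h
        simp only [psi, h, uu_true_one, uu_false_one]
        have hG := GG_pos g
        rcases fin_succ_val g k with h1 | ⟨h1, h2⟩
        · rw [h1]
          by_cases h3 : (k:ℕ) % 4 = 3
          · have e1 : ((k:ℕ) + 1) % 4 = 0 := by omega
            rw [e1, h3]
            cases c <;> simp [rr]
          · have e1 : ((k:ℕ) + 1) % 4 = (k:ℕ) % 4 + 1 := by omega
            have e2 : ((k:ℕ) + 1) / 4 = (k:ℕ) / 4 := by omega
            have hlt : (k:ℕ) % 4 < 3 := by omega
            rw [e1, e2]
            congr 2
            generalize (k:ℕ) % 4 = r at hlt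
            interval_cases r <;> cases c <;> simp [rr]
        · have e1 : (k:ℕ) % 4 = 3 := by omega
          rw [h2, e1]
          cases c <;> simp [rr]
      have : ∀ w : Fin 2 → ℝ, w 1 = 1 → psi m c (kn (linv g 1 true (k, b))) w = psi m c (kn (k, b)) w := by
        intro w h
        cases b
        · have := key (k - 1) w h
          rw [sub_add_cancel] at this
          simpa [linv] using this.symm
        · simpa [linv] using key k w h
      exact congrArg₂ _ (this w' h') (this w h)

lemma exists_phi (g m : ℕ) (c : Bool) : ∃ φ : Mg g → UnitAddCircle, Continuous φ ∧
    (m < g → ∀ (k : SS g) w, ((psi m c (kn k) w : ℝ) : UnitAddCircle) = φ (dq g (lz g k w))) := by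
  cases g with
  | zero => exact ⟨fun _ => 0, continuous_const, fun h => by omega⟩
  | succ g =>
    let ff : ℝ → ℝ := fun θ => if c then cl (θ - 1) - cl (θ - 3) else cl θ - cl (θ - 2)
    have hff : Continuous ff := by
      simp only [ff]; cases c <;> simp <;> fun_prop
    let Φ : Fin (g+1) → ℝ → ℝ → UnitAddCircle := fun j s θ => if (j:ℕ) = m then ((cl s * ff θ : ℝ) : UnitAddCircle) else 0
    have h4 : ff 4 = 0 := by
      simp only [ff]
      rw [cl_of_one_le (by norm_num), cl_of_one_le (by norm_num), cl_of_one_le (by norm_num), cl_of_one_le (by norm_num)]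
      simp
    have h0 : ff 0 = 0 := by
      simp only [ff]
      rw [cl_of_nonpos (by norm_num), cl_of_nonpos (by norm_num), cl_of_nonpos (by norm_num), cl_of_nonpos (by norm_num)]
      simp
    have hr : ∀ r : ℕ, r < 4 → ∀ u ∈ Set.Icc (0:ℝ) 1, ff (r + u) = rr c r u := by
      intro r hr u hu
      obtain ⟨hu0, hu1⟩ := hu
      simp only [ff]
      interval_cases r <;> cases c <;> simp only [rr, if_true, Bool.false_eq_true, if_false, Nat.cast_zero, Nat.cast_one, zero_add, Nat.cast_ofNat] <;> norm_num
      · rw [cl_of_mem ⟨hu0, hu1⟩, cl_of_nonpos (by linarith)]; ring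
      · rw [cl_of_nonpos (by linarith), cl_of_nonpos (by linarith)]; ring
      · rw [cl_of_one_le (by linarith), cl_of_nonpos (by linarith)]; ring
      · rw [cl_of_mem ⟨by linarith, by linarith⟩, cl_of_nonpos (by linarith)]; ring
      · rw [cl_of_one_le (by linarith), cl_of_mem ⟨by linarith, by linarith⟩]; 
      · rw [cl_of_one_le (by linarith), cl_of_nonpos (by linarith)]; ring
      · rw [cl_of_one_le (by linarith), cl_of_one_le (by linarith)]; ring
      · rw [cl_of_one_le (by linarith), cl_of_mem ⟨by linarith, by linarith⟩]; 
    obtain ⟨φ, hφ⟩ := Mlift g Φ 0 (by intro j θ _; simp [Φ]) (by intro j s _; simp [Φ, h4, h0])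
      (by
        intro j t ht
        simp only [Φ, cl_one, one_mul]
        have e1 : ff t = rr c 0 t := by simpa using hr 0 (by norm_num) t ht
        have e2 : ff (3 - t) = rr c 2 (1 - t) := by
          rw [← hr 2 (by norm_num) (1-t) ⟨by linarith [ht.2], by linarith [ht.1]⟩]; congr 1; push_cast; ring
        rw [e1, e2]
        split_ifs
        · cases c
          · simp [rr]
          · simp only [rr]; simp; exact (AddCircle.coe_period (1:ℝ)).symm
        · rfl)
      (by
        intro j t ht
        simp only [Φ, cl_one, one_mul]
        have e1 : ff (1+t) = rr c 1 t := by simpa using hr 1 (by norm_num) t ht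
        have e2 : ff (4 - t) = rr c 3 (1 - t) := by
          rw [← hr 3 (by norm_num) (1-t) ⟨by linarith [ht.2], by linarith [ht.1]⟩]; congr 1; push_cast; ring
        rw [e1, e2]
        split_ifs
        · cases c <;> simp [rr]
        · rfl)
    refine ⟨φ, Mlift_cont g φ Φ hφ ?_, ?_⟩
    · intro j
      simp only [Φ]
      split_ifs
      · exact (AddCircle.continuous_mk' 1).comp (by fun_prop)
      · exact continuous_const
    · rintro hm ⟨k, b⟩ w
      have hk : (k:ℕ) < 4 * (g+1) := k.2
      have hu := uu_mem b (w 1)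
      have hlt : (k:ℕ) % 4 < 4 := Nat.mod_lt _ (by norm_num)
      have := hφ ⟨k/4, by omega⟩ (cl (w 0)) (cl_mem _) (((k:ℕ) % 4 : ℕ) + uu b (w 1)) ⟨by have := hu.1; positivity, by
        have : (((k:ℕ)%4 : ℕ) : ℝ) ≤ 3 := by exact_mod_cast (by omega : (k:ℕ)%4 ≤ 3)
        linarith [hu.2]⟩
      have hpt : mpt g (cl (w 0)) (4 * ((⟨k/4, by omega⟩ : Fin (g+1)) : ℕ) + (((k:ℕ) % 4 : ℕ) + uu b (w 1))) = dq (g+1) (lz (g+1) (k, b) w) := by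
        show mq g _ = mq g _
        congr 1
        apply Subtype.ext
        simp only [lz, dpt_val, ang, kn, GG]
        rw [cl_of_mem (cl_mem _), ← add_assoc]
        congr 3
        have : 4 * ((k:ℕ)/4) + (k:ℕ) % 4 = k := by omega
        exact_mod_cast this
      rw [hpt] at this
      rw [this]
      simp only [Φ, psi, kn]
      rw [cl_of_mem (cl_mem _), hr _ hlt _ hu]
      split_ifs <;> simp

/-! ### local degree two class -/

def wz (z : Disc) (m : ℕ) : ℂ := (z:ℂ) + (√(1 - ‖(z:ℂ)‖^2) : ℝ) * (m:ℂ)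

lemma wz_cont (m : ℕ) : Continuous (fun z => wz z m) := by unfold wz; fun_prop

lemma wz_bdry {z : Disc} (h : ‖(z:ℂ)‖ = 1) (m : ℕ) : wz z m = z := by simp [wz, h]

lemma wz_inj {z : Disc} {m m' : ℕ} (h : wz z m = 0) (h' : wz z m' = 0) : m = m' := by
  have e : ((√(1 - ‖(z:ℂ)‖^2) : ℝ) : ℂ) * ((m:ℂ) - m') = 0 := by
    unfold wz at h h'; linear_combination h - h'
  rcases mul_eq_zero.1 e with e | e
  · have e1 : √(1 - ‖(z:ℂ)‖^2) = 0 := by exact_mod_cast e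
    have h0 : ‖(z:ℂ)‖^2 ≤ 1 := by have := z.2; have := norm_nonneg (z:ℂ); nlinarith
    rw [Real.sqrt_eq_zero (by linarith)] at e1
    have : ‖(z:ℂ)‖ = 1 := by nlinarith [norm_nonneg (z:ℂ)]
    rw [wz_bdry this] at h
    rw [h] at this; simp at this
  · have : (m:ℂ) = m' := by linear_combination e
    exact_mod_cast this

lemma exists_Q (g : ℕ) (m m' : ℕ) : ∃ Q : Mg g → ℂ, Continuous Q ∧ ∀ z, Q (dq g z) = wz z m * star (wz z m') := by
  cases g with
  | zero =>
    refine ⟨fun x : Metric.sphere (0 : EuclideanSpace ℝ (Fin 3)) 1 => 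
      (1 + (x.1 2 : ℂ))/2 + ((x.1 0 : ℂ) + (x.1 1 : ℂ) * Complex.I)/2 * m' + ((x.1 0 : ℂ) - (x.1 1 : ℂ) * Complex.I)/2 * m + (1 - (x.1 2 : ℂ))/2 * m * m', ?_, ?_⟩
    · have : ∀ i, Continuous (fun x : Metric.sphere (0 : EuclideanSpace ℝ (Fin 3)) 1 => (x.1 i : ℂ)) := by
        intro i; fun_prop
      have h0 := this 0
      have h1 := this 1
      have h2 := this 2
      show Continuous (fun x : Metric.sphere (0 : EuclideanSpace ℝ (Fin 3)) 1 => _)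
      fun_prop
    · intro z
      have h0 : ‖(z:ℂ)‖^2 ≤ 1 := by have := z.2; have := norm_nonneg (z:ℂ); nlinarith
      have h1 := Real.sq_sqrt (show 0 ≤ 1 - ‖(z:ℂ)‖^2 by linarith)
      have h2 : ‖(z:ℂ)‖^2 = (z:ℂ).re^2 + (z:ℂ).im^2 := by rw [Complex.sq_norm, Complex.normSq_apply]; ring
      simp only [dq, wz, Matrix.cons_val_zero, Matrix.cons_val_one, Matrix.cons_val]
      set β := √(1 - ‖(z:ℂ)‖^2)
      rw [h2] at h1 ⊢
      set x := (z:ℂ).re with hx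
      set y := (z:ℂ).im with hy
      have hz : (z:ℂ) = x + y * Complex.I := (Complex.re_add_im _).symm
      rw [hz]
      have h1c : (β:ℂ)^2 = 1 - (x^2 + y^2) := by exact_mod_cast h1
      simp only [star_add, star_mul', RCLike.star_def, Complex.conj_ofReal, Complex.conj_I, map_natCast]
      push_cast
      linear_combination (-(m:ℂ)*m') * h1c + ((y:ℂ)^2) * Complex.I_sq
  | succ g =>
    refine ⟨Quot.lift (fun z => wz z m * star (wz z m')) ?_, ?_, fun z => rfl⟩
    · rintro z w ⟨j, r, t, _, _, hz, hw⟩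
      rw [polyBP_eq] at hz hw
      have e1 : ‖(z:ℂ)‖ = 1 := by rw [hz, EE_norm]
      have e2 : ‖(w:ℂ)‖ = 1 := by rw [hw, EE_norm]
      simp only [wz_bdry e1, wz_bdry e2, RCLike.star_def, Complex.mul_conj, Complex.normSq_eq_norm_sq, e1, e2]
    · refine continuous_quot_lift _ ?_
      exact (wz_cont m).mul (wz_cont m').star

/-- the phase on the outer face -/
lemma wz_inv (g : ℕ) (k : SS g) (w : Fin 2 → ℝ) (h : w 0 = 1) (k' : SS g) (m : ℕ) :
    wz (lz g k' w) m = Complex.exp ((2 * Real.pi * ((ang (kn k') (w 1) - ang (kn k) (w 1)) / (4 * GG g)) : ℝ) * Complex.I) * wz (lz g k w) m := by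
  have e : ∀ k, ‖(lz g k w : ℂ)‖ = 1 := fun k => by rw [lz, dpt_norm, h, cl_one]
  rw [wz_bdry (e k), wz_bdry (e k'), lz, lz, dpt_val, dpt_val, h, cl_one]
  simp only [EE, Complex.ofReal_one, one_mul]
  rw [← Complex.exp_add]
  congr 1
  push_cast; ring

end LSP

namespace LSP
set_option linter.all false
set_option autoImplicit false
open Topology

/-! ### local evaluation -/

def tm (F H : (Fin 2 → ℝ) → ℝ) (s s' t t' : ℝ) : ℝ :=
  (F ![s', t] - F ![s, t]) * (H ![s', t'] - H ![s', t]) - (F ![s, t'] - F ![s, t]) * (H ![s', t'] - H ![s, t'])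

lemma perm_sum (N : ℕ) (F H : (Fin 2 → ℝ) → ℝ) (w : Fin 2 → ℕ) :
    ∑ ω : Equiv.Perm (Fin 2), ((Equiv.Perm.sign ω : ℤ) : ℝ) *
     ((F (fun a => ((w + Pi.single (ω 0) 1 : Fin 2 → ℕ) a : ℝ) / N) - F (fun a => (w a : ℝ)/N)) *
      (H (fun a => ((w + 1 : Fin 2 → ℕ) a : ℝ) / N) - H (fun a => ((w + Pi.single (ω 0) 1 : Fin 2 → ℕ) a : ℝ) / N))) =
    tm F H ((w 0 : ℝ)/N) ((w 0 + 1 : ℝ)/N) ((w 1 : ℝ)/N) ((w 1 + 1 : ℝ)/N) := by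
  have hu : (Finset.univ : Finset (Equiv.Perm (Fin 2))) = {1, Equiv.swap 0 1} := by decide
  rw [hu, Finset.sum_pair (by decide)]
  have e0 : (fun a => (w a : ℝ)/N) = ![(w 0 : ℝ)/N, (w 1 : ℝ)/N] := by ext a; fin_cases a <;> simp
  have e1 : (fun a => ((w + 1 : Fin 2 → ℕ) a : ℝ) / N) = ![(w 0 + 1 : ℝ)/N, (w 1 + 1 : ℝ)/N] := by ext a; fin_cases a <;> simp
  have e2 : (fun a => ((w + Pi.single ((1 : Equiv.Perm (Fin 2)) 0) 1 : Fin 2 → ℕ) a : ℝ) / N) = ![(w 0 + 1 : ℝ)/N, (w 1 : ℝ)/N] := by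
    ext a; fin_cases a <;> simp
  have e3 : (fun a => ((w + Pi.single ((Equiv.swap 0 1 : Equiv.Perm (Fin 2)) 0) 1 : Fin 2 → ℕ) a : ℝ) / N) = ![(w 0 : ℝ)/N, (w 1 + 1 : ℝ)/N] := by
    ext a; fin_cases a <;> simp
  rw [e0, e1, e2, e3]
  simp [tm, Equiv.Perm.sign_swap]
  ring

lemma sg_uu (b : Bool) {t t' : ℝ} (ht : t ∈ Set.Icc (0:ℝ) 1) (ht' : t' ∈ Set.Icc (0:ℝ) 1) : sg b * (uu b t' - uu b t) = (t' - t)/2 := by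
  simp only [uu, cl_of_mem ht, cl_of_mem ht']
  cases b <;> simp [sg] <;> ring

lemma tm_psi (m : ℕ) (k : ℕ × Bool) {s s' t t' : ℝ} (hs : 0 ≤ s) (hss : s ≤ s') (hs' : s' ≤ 1) (ht : 0 ≤ t) (htt : t ≤ t') (ht' : t' ≤ 1) :
    0 ≤ sg k.2 * tm (psi m false k) (psi m true k) s s' t t' := by
  have c1 : cl s = s := cl_of_mem ⟨hs, by linarith⟩
  have c2 : cl s' = s' := cl_of_mem ⟨by linarith, hs'⟩
  have key := sg_uu k.2 (t := t) (t' := t') ⟨ht, by linarith⟩ ⟨by linarith, ht'⟩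
  unfold tm psi
  simp only [Matrix.cons_val_zero, Matrix.cons_val_one, c1, c2]
  split_ifs with hm
  · have hlt : k.1 % 4 < 4 := Nat.mod_lt _ (by norm_num)
    generalize k.1 % 4 = r at hlt
    set u := uu k.2 t
    set u' := uu k.2 t'
    interval_cases r <;> simp only [rr, if_true, Bool.false_eq_true, if_false] <;> norm_num
    · have : sg k.2 * ((s' - s) * (s' * u' - s' * u)) = (s' - s) * s' * (sg k.2 * (u' - u)) := by ring
      rw [this, key]
      exact mul_nonneg (mul_nonneg (by linarith) (by linarith)) (by linarith)
    · have : sg k.2 * ((s * (1 - u') - s * (1 - u)) * (s' - s)) = - ((s' - s) * s * (sg k.2 * (u' - u))) := by ring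
      rw [this, key]
      have := mul_nonneg (mul_nonneg (show 0 ≤ s' - s by linarith) hs) (show 0 ≤ (t'-t)/2 by linarith)
      linarith
  · simp

lemma tm_psi_pos (m : ℕ) {s s' t t' : ℝ} (hs : 0 ≤ s) (hss : s < s') (hs' : s' ≤ 1) (ht : 0 ≤ t) (htt : t < t') (ht' : t' ≤ 1) :
    0 < sg true * tm (psi m false (4*m+1, true)) (psi m true (4*m+1, true)) s s' t t' := by
  have c1 : cl s = s := cl_of_mem ⟨hs, by linarith⟩
  have c2 : cl s' = s' := cl_of_mem ⟨by linarith, hs'⟩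
  have key := sg_uu true (t := t) (t' := t') ⟨ht, by linarith⟩ ⟨by linarith, ht'⟩
  have e1 : (4*m+1)/4 = m := by omega
  have e2 : (4*m+1)%4 = 1 := by omega
  unfold tm psi
  simp only [Matrix.cons_val_zero, Matrix.cons_val_one, c1, c2, e1, e2, if_true]
  set u := uu true t
  set u' := uu true t'
  simp only [rr, if_true, Bool.false_eq_true, if_false]
  norm_num
  have : sg true * ((s' - s) * (s' * u' - s' * u)) = (s' - s) * s' * (sg true * (u' - u)) := by ring
  rw [this, key]
  exact mul_pos (mul_pos (by linarith) (by linarith)) (by linarith)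

lemma tm_eta (G : ℕ) (hG : 0 < G) (k : ℕ × Bool) {s s' t t' : ℝ} (hs : 0 ≤ s) (hss : s < s') (hs' : s' ≤ 1) (ht : 0 ≤ t) (htt : t < t') (ht' : t' ≤ 1) :
    0 < sg k.2 * tm (fun w => cl (w 0)) (fun w => 2 * Real.pi * (ang k (w 1) / (4 * G))) s s' t t' := by
  have c1 : cl s = s := cl_of_mem ⟨hs, by linarith⟩
  have c2 : cl s' = s' := cl_of_mem ⟨by linarith, hs'⟩
  have key := sg_uu k.2 (t := t) (t' := t') ⟨ht, by linarith⟩ ⟨by linarith, ht'⟩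
  have h0 : (0:ℝ) < G := by exact_mod_cast hG
  unfold tm ang
  simp only [Matrix.cons_val_zero, Matrix.cons_val_one, c1, c2]
  set u := uu k.2 t
  set u' := uu k.2 t'
  have : sg k.2 * ((s' - s) * (2 * Real.pi * ((k.1 + u') / (4 * G)) - 2 * Real.pi * ((k.1 + u) / (4 * G))) - (s - s) * (2 * Real.pi * ((k.1 + u') / (4 * G)) - 2 * Real.pi * ((k.1 + u') / (4 * G)))) =
    (s' - s) * (2 * Real.pi / (4 * G)) * (sg k.2 * (u' - u)) := by ring
  rw [this, key]
  have := Real.pi_pos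
  exact mul_pos (mul_pos (by linarith) (by positivity)) (by linarith)

/-! ### symmetric products of functions -/

def spProd {n : ℕ} {X : Type*} [TopologicalSpace X] {A : Type*} [CommMonoid A] (f : X → A) : SP n X → A :=
  Quot.lift (fun s => ∏ l, f (s l)) (by
    rintro s t ⟨e, rfl⟩
    exact (Equiv.prod_comp e (fun l => f (s l))).symm)

@[simp] lemma spProd_mk {n : ℕ} {X : Type*} [TopologicalSpace X] {A : Type*} [CommMonoid A] (f : X → A) (s : Fin n → X) :
    spProd f (spMk s : SP n X) = ∏ l, f (s l) := rfl

lemma spProd_cont {n : ℕ} {X : Type*} [TopologicalSpace X] {A : Type*} [CommMonoid A] [TopologicalSpace A] [ContinuousMul A] {f : X → A}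
    (hf : Continuous f) : Continuous (spProd f : SP n X → A) := by
  refine continuous_quot_lift _ ?_
  exact continuous_finsetProd _ fun l _ => hf.comp (continuous_apply l)

/-! ### the global data -/

def phi (g m : ℕ) (c : Bool) : Mg g → UnitAddCircle := (exists_phi g m c).choose
lemma phi_cont (g m : ℕ) (c : Bool) : Continuous (phi g m c) := (exists_phi g m c).choose_spec.1
lemma phi_spec (g m : ℕ) (c : Bool) (h : m < g) (k : SS g) (w) : ((psi m c (kn k) w : ℝ) : UnitAddCircle) = phi g m c (dq g (lz g k w)) :=
  (exists_phi g m c).choose_spec.2 h k w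

def QQ (g m m' : ℕ) : Mg g → ℂ := (exists_Q g m m').choose
lemma QQ_cont (g m m' : ℕ) : Continuous (QQ g m m') := (exists_Q g m m').choose_spec.1
lemma QQ_spec (g m m' : ℕ) (z : Disc) : QQ g m m' (dq g z) = wz z m * star (wz z m') := (exists_Q g m m').choose_spec.2 z

section glob
variable {K B : ℕ} (n g : Fin K → ℕ) (fac : Fin B → Fin K) (pos : Fin B → ℕ) (en : ∀ j, Fin (n j) ≃ {l // fac l = j})

def tp {fac : Fin B → Fin K} {j : Fin K} {l : Fin B} (h : fac l = j) (x : Mg (g (fac l))) : Mg (g j) := h ▸ x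

lemma tp_fun {fac : Fin B → Fin K} {Z : Type*} (F : ∀ g, Mg g → Z) {j : Fin K} {l : Fin B} (h : fac l = j) (x : Mg (g (fac l))) :
    F (g j) (tp g h x) = F (g (fac l)) x := by subst h; rfl

lemma tp_cont {fac : Fin B → Fin K} {j : Fin K} {l : Fin B} (h : fac l = j) : Continuous (tp g h) := by subst h; exact continuous_id

def gq (κ : ∀ l, SS (g (fac l))) (y : Fin B → Fin 2 → ℝ) (j : Fin K) : SP (n j) (Mg (g j)) :=
  spMk (fun m => tp g (en j m).2 (dq _ (lz _ (κ (en j m).1) (y (en j m).1))))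

lemma sum_en {A : Type*} [AddCommMonoid A] (j : Fin K) (F : Fin B → A) : ∑ l, (if fac l = j then F l else 0) = ∑ m, F (en j m).1 := by
  classical
  rw [← Finset.sum_filter, Equiv.sum_comp (en j) (fun l : {l // fac l = j} => F l.1)]
  exact Finset.sum_subtype (p := fun l => fac l = j) _ (by simp) F

lemma prod_en {A : Type*} [CommMonoid A] (j : Fin K) (F : Fin B → A) : ∏ l, (if fac l = j then F l else 1) = ∏ m, F (en j m).1 := by
  classical
  rw [← Finset.prod_filter, Equiv.prod_comp (en j) (fun l : {l // fac l = j} => F l.1)]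
  exact Finset.prod_subtype (p := fun l => fac l = j) _ (by simp) F

def gab (i : Fin B) : Bool := decide (pos i < g (fac i))

lemma gab_true {i : Fin B} (h : gab g fac pos i = true) : pos i < g (fac i) := by simpa [gab] using h

def gf (c : Bool) (i l : Fin B) (k : SS (g (fac l))) (w : Fin 2 → ℝ) : ℝ :=
  if fac l = fac i then (if gab g fac pos i = true then psi (pos i) c (kn k) w else 
    (if c then 2 * Real.pi * (ang (kn k) (w 1) / (4 * GG (g (fac l)))) else cl (w 0))) else 0

lemma gf_cont (c : Bool) (i l : Fin B) (k) : Continuous (gf g fac pos c i l k) := by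
  unfold gf
  split_ifs
  · exact psi_cont _ _ _
  · have := uu_cont k.2
    unfold ang; fun_prop
  · fun_prop
  · fun_prop

lemma gf_lift (c : Bool) (i : Fin B) (h : gab g fac pos i = true) (κ : ∀ l, SS (g (fac l))) (y : Fin B → Fin 2 → ℝ) :
    ((∑ l, gf g fac pos c i l (κ l) (y l) : ℝ) : UnitAddCircle) = spSum (phi (g (fac i)) (pos i) c) (gq n g fac en κ y (fac i)) := by
  simp only [gf, h, if_true, gq, spSum_mk]
  rw [sum_en n fac en (fac i) (fun l => psi (pos i) c (kn (κ l)) (y l))]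
  rw [← QuotientAddGroup.mk'_apply, map_sum]
  refine Finset.sum_congr rfl fun m _ => ?_
  rw [tp_fun g (fun g => phi g (pos i) c), ← phi_spec]
  · rfl
  · rw [(en (fac i) m).2]; exact gab_true g fac pos h

def gp' (i : Fin B) (κ : ∀ l, SS (g (fac l))) (y : Fin B → Fin 2 → ℝ) (m : Fin (n (fac i) + 1)) : ℂ :=
  ∏ l, if fac l = fac i then wz (lz _ (κ l) (y l)) m else 1

def gP (i : Fin B) (x : ∀ j, SP (n j) (Mg (g j))) : Matrix (Fin (n (fac i) + 1)) (Fin (n (fac i) + 1)) ℂ :=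
  fun m m' => spProd (QQ (g (fac i)) m m') (x (fac i))

lemma gP_rank (i : Fin B) (x : ∀ j, SP (n j) (Mg (g j))) : ∃ p : Fin (n (fac i) + 1) → ℂ, p ≠ 0 ∧ gP n g fac i x = Matrix.vecMulVec p (star p) := by
  obtain ⟨s, hs⟩ := spMk_surj (x (fac i))
  choose z hz using fun l => dq_surj _ (s l)
  refine ⟨fun m => ∏ l, wz (z l) m, ?_, ?_⟩
  · intro h0
    have : ∀ m : Fin (n (fac i) + 1), ∃ l, wz (z l) m = 0 := by
      intro m
      obtain ⟨l, _, hl⟩ := Finset.prod_eq_zero_iff.1 (congrFun h0 m)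
      exact ⟨l, hl⟩
    choose lf hlf using this
    obtain ⟨m, m', hne, he⟩ := Fintype.exists_ne_map_eq_of_card_lt lf (by simp)
    apply hne
    apply Fin.ext
    exact wz_inj (hlf m) (by rw [he]; exact hlf m')
  · ext m m'
    simp only [gP, ← hs, spProd_mk, Matrix.vecMulVec_apply, Pi.star_apply, star_prod, ← Finset.prod_mul_distrib]
    refine Finset.prod_congr rfl fun l _ => ?_
    rw [← hz, QQ_spec]

lemma gP_q (i : Fin B) (κ : ∀ l, SS (g (fac l))) (y : Fin B → Fin 2 → ℝ) :
    gP n g fac i (gq n g fac en κ y) = Matrix.vecMulVec (gp' n g fac i κ y) (star (gp' n g fac i κ y)) := by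
  ext m m'
  simp only [gP, gq, spProd_mk, Matrix.vecMulVec_apply, Pi.star_apply, gp']
  rw [prod_en n fac en (fac i) (fun l => wz (lz _ (κ l) (y l)) m), prod_en n fac en (fac i) (fun l => wz (lz _ (κ l) (y l)) m'),
    star_prod, ← Finset.prod_mul_distrib]
  refine Finset.prod_congr rfl fun l _ => ?_
  rw [tp_fun g (fun g => QQ g m m'), QQ_spec]

lemma gf_eta_inv (i l : Fin B) (h : gab g fac pos i = false) (k : SS (g (fac l))) (a : Fin 2) (s : Bool) (w w' w'' : Fin 2 → ℝ)
    (e : w a = sv s) (e' : w' a = sv s) (e'' : w'' a = sv s) (k') :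
    (gf g fac pos false i l k' w' - gf g fac pos false i l k' w) * (gf g fac pos true i l k' w'' - gf g fac pos true i l k' w') =
    (gf g fac pos false i l k w' - gf g fac pos false i l k w) * (gf g fac pos true i l k w'' - gf g fac pos true i l k w') := by
  simp only [gf, h, Bool.false_eq_true, if_false, if_true]
  split_ifs
  · fin_cases a
    · have : w' 0 = w 0 := e'.trans e.symm
      rw [this]; ring
    · have : w'' 1 = w' 1 := e''.trans e'.symm
      rw [this]; ring
  · rfl

lemma sum_upd {S : Fin B → Type} (κ : ∀ l, S l) (l : Fin B) (k : S l) (T : ∀ l, S l → ℝ) :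
    ∑ l', T l' (Function.update κ l k l') = ∑ l', T l' (κ l') + (T l k - T l (κ l)) := by
  classical
  rw [← Finset.add_sum_erase _ _ (Finset.mem_univ l), ← Finset.add_sum_erase (s := Finset.univ) (a := l) (f := fun l' => T l' (κ l')) (Finset.mem_univ l)]
  rw [Function.update_self, Finset.sum_congr rfl (g := fun l' => T l' (κ l'))]
  · ring
  · intro l' hl'
    rw [Function.update_of_ne (Finset.ne_of_mem_erase hl')]

lemma gp'_upd (i : Fin B) (κ : ∀ l, SS (g (fac l))) (y : Fin B → Fin 2 → ℝ) (l : Fin B) (k) (c : ℂ)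
    (h : ∀ m : ℕ, (if fac l = fac i then wz (lz _ k (y l)) m else 1) = c * (if fac l = fac i then wz (lz _ (κ l) (y l)) m else 1)) :
    gp' n g fac i (Function.update κ l k) y = c • gp' n g fac i κ y := by
  classical
  funext m
  simp only [gp', Pi.smul_apply, smul_eq_mul]
  rw [← Finset.mul_prod_erase _ _ (Finset.mem_univ l), ← Finset.mul_prod_erase (s := Finset.univ) (a := l) (f := fun l' => if fac l' = fac i then wz (lz _ (κ l') (y l')) m else 1) (Finset.mem_univ l)]
  rw [Function.update_self, h, mul_assoc]
  congr 2
  refine Finset.prod_congr rfl fun l' hl' => ?_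
  rw [Function.update_of_ne (Finset.ne_of_mem_erase hl')]

lemma gp'_inv (i : Fin B) (h : gab g fac pos i = false) (κ : ∀ l, SS (g (fac l))) (l : Fin B) (a : Fin 2) (s : Bool) :
    ∃ ζ : (Fin B → Fin 2 → ℝ) → ℂ,
    (∀ y, InCube y → y l a = sv s → ‖ζ y‖ = 1 ∧ gp' n g fac i (Function.update κ l (linv _ a s (κ l))) y = ζ y • gp' n g fac i κ y) ∧
    (∀ x y, InCube x → InCube y → x l a = sv s → y l a = sv s →
      ζ x * Complex.exp ((∑ l', gf g fac pos false i l' (Function.update κ l (linv _ a s (κ l)) l') (x l') *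
        (gf g fac pos true i l' (Function.update κ l (linv _ a s (κ l)) l') (y l') - gf g fac pos true i l' (Function.update κ l (linv _ a s (κ l)) l') (x l')) : ℝ) * Complex.I)
      = ζ y * Complex.exp ((∑ l', gf g fac pos false i l' (κ l') (x l') * (gf g fac pos true i l' (κ l') (y l') - gf g fac pos true i l' (κ l') (x l')) : ℝ) * Complex.I)) := by
  by_cases hc : fac l = fac i ∧ a = 0 ∧ s = true
  · obtain ⟨hf, rfl, rfl⟩ := hc
    set k' := linv _ 0 true (κ l)
    refine ⟨fun y => Complex.exp ((2 * Real.pi * ((ang (kn k') (y l 1) - ang (kn (κ l)) (y l 1)) / (4 * GG (g (fac l)))) : ℝ) * Complex.I), ?_, ?_⟩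
    · intro y _ e
      refine ⟨Complex.norm_exp_ofReal_mul_I _, ?_⟩
      apply gp'_upd
      intro m
      rw [if_pos hf, if_pos hf]
      exact wz_inv _ (κ l) (y l) (by simpa [sv] using e) k' m
    · intro x y _ _ ex ey
      have ex : x l 0 = 1 := by simpa [sv] using ex
      rw [sum_upd κ l k' (fun l' k => gf g fac pos false i l' k (x l') * (gf g fac pos true i l' k (y l') - gf g fac pos true i l' k (x l')))]
      rw [← Complex.exp_add, ← Complex.exp_add]
      congr 1
      rw [← add_mul, ← add_mul]
      congr 1
      rw [← Complex.ofReal_add, ← Complex.ofReal_add]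
      congr 1
      have ef : ∀ k, gf g fac pos false i l k (x l) = 1 := by
        intro k; simp [gf, hf, h, ex]
      have eh : ∀ k z, gf g fac pos true i l k z = 2 * Real.pi * (ang (kn k) (z 1) / (4 * GG (g (fac l)))) := by
        intro k z; simp [gf, hf, h]
      simp only [ef, eh]
      ring
  · refine ⟨fun _ => 1, ?_, ?_⟩
    · intro y _ e
      refine ⟨by simp, ?_⟩
      apply gp'_upd
      intro m
      by_cases hf : fac l = fac i
      · rw [lz_inv _ a s (κ l) (y l) e (fun h => hc ⟨hf, h⟩), one_mul]
      · simp [hf]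
    · intro x y _ _ ex ey
      rw [sum_upd κ l _ (fun l' k => gf g fac pos false i l' k (x l') * (gf g fac pos true i l' k (y l') - gf g fac pos true i l' k (x l')))]
      congr 4
      rw [add_eq_left, sub_eq_zero]
      by_cases hf : fac l = fac i
      · simp only [gf, h, hf, if_true, Bool.false_eq_true, if_false]
        fin_cases a
        · cases s
          · have : x l 0 = 0 := by simpa [sv] using ex
            simp [this]
          · simp [hf] at hc
        · have : y l 1 = x l 1 := ey.trans ex.symm
          rw [this]; ring
      · simp [gf, hf]

def gLB : LB (∀ j, SP (n j) (Mg (g j))) B (fun l => SS (g (fac l))) where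
  ε l k := sg k.2
  inv l := linv (g (fac l))
  invol l := linv_invol _
  sgn l := linv_sgn _
  q := gq n g fac en
  q_cont κ := by
    refine continuous_pi fun j => spMk_cont.comp (continuous_pi fun m => ?_)
    exact (tp_cont g _).comp ((dq_cont _).comp ((lz_cont _ _).comp (continuous_apply _)))
  q_inv κ l a s y hy h := by
    funext j
    unfold gq
    congr 1
    funext m
    congr 1
    by_cases hl : (en j m).1 = l
    · generalize (en j m).1 = l' at hl
      subst hl
      rw [Function.update_self]
      exact dq_inv _ a s _ _ h (hy _)
    · rw [Function.update_of_ne hl]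
  ab := gab g fac pos
  f := gf g fac pos false
  h := gf g fac pos true
  f_cont := gf_cont g fac pos false
  h_cont := gf_cont g fac pos true
  φ i x := spSum (phi (g (fac i)) (pos i) false) (x (fac i))
  ψ i x := spSum (phi (g (fac i)) (pos i) true) (x (fac i))
  φ_cont i := (spSum_cont (phi_cont _ _ _)).comp (continuous_apply _)
  ψ_cont i := (spSum_cont (phi_cont _ _ _)).comp (continuous_apply _)
  f_lift i h κ y := gf_lift n g fac pos en false i h κ y
  h_lift i h κ y := gf_lift n g fac pos en true i h κ y
  f_inv i h l k a s w w' hw hw' e e' := by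
    simp only [gf, h, if_true]
    split_ifs
    · exact psi_inv _ _ _ a s k w w' e e'
    · rfl
  h_inv i h l k a s w w' hw hw' e e' := by
    simp only [gf, h, if_true]
    split_ifs
    · exact psi_inv _ _ _ a s k w w' e e'
    · rfl
  M i := n (fac i) + 1
  p := gp' n g fac
  p_cont i κ := by
    refine continuous_pi fun m => continuous_finsetProd _ fun l _ => ?_
    split_ifs
    · exact (wz_cont m).comp ((lz_cont _ _).comp (continuous_apply _))
    · exact continuous_const
  P := gP n g fac
  P_cont i := by
    refine continuous_pi fun m => continuous_pi fun m' => ?_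
    exact (spProd_cont (QQ_cont _ _ _)).comp (continuous_apply _)
  P_rank i _ := gP_rank n g fac i
  P_q i _ := gP_q n g fac en i
  p_inv i h κ l a s := gp'_inv n g fac pos i h κ l a s
  e_inv i h l k a s w w' w'' _ _ _ e e' e'' := gf_eta_inv g fac pos i l h k a s w w' w'' e e' e'' _


lemma gJ (i l : Fin B) (N : ℕ) (hN : 0 < N) :
    0 ≤ Jterm N (gLB n g fac pos en).ε ((gLB n g fac pos en).fN N) ((gLB n g fac pos en).hN N) i l ∧
    ((fac l = fac i) → 0 < Jterm N (gLB n g fac pos en).ε ((gLB n g fac pos en).fN N) ((gLB n g fac pos en).hN N) i l) := by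
  have hJ : Jterm N (gLB n g fac pos en).ε ((gLB n g fac pos en).fN N) ((gLB n g fac pos en).hN N) i l = 
    ∑ k : SS (g (fac l)), ∑ w ∈ box 2 N, sg k.2 * tm (gf g fac pos false i l k) (gf g fac pos true i l k) 
      ((w 0 : ℝ)/N) ((w 0 + 1 : ℝ)/N) ((w 1 : ℝ)/N) ((w 1 + 1 : ℝ)/N) := by
    unfold Jterm
    refine Finset.sum_congr rfl fun k _ => ?_
    rw [Finset.mul_sum]
    refine Finset.sum_congr rfl fun w _ => ?_
    rw [← perm_sum N]
    rfl
  rw [hJ]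
  have hN' : (0:ℝ) < N := by exact_mod_cast hN
  have hb : ∀ w ∈ box 2 N, ∀ a, 0 ≤ (w a : ℝ)/N ∧ (w a : ℝ)/N < (w a + 1 : ℝ)/N ∧ (w a + 1 : ℝ)/N ≤ 1 := by
    intro w hw a
    have := Fintype.mem_piFinset.1 hw a
    rw [Finset.mem_range] at this
    refine ⟨by positivity, by gcongr; linarith, ?_⟩
    rw [div_le_one hN']
    exact_mod_cast this
  have hnn : ∀ k : SS (g (fac l)), ∀ w ∈ box 2 N, 0 ≤ sg k.2 * tm (gf g fac pos false i l k) (gf g fac pos true i l k) 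
      ((w 0 : ℝ)/N) ((w 0 + 1 : ℝ)/N) ((w 1 : ℝ)/N) ((w 1 + 1 : ℝ)/N) := by
    intro k w hw
    have h0 := hb w hw 0
    have h1 := hb w hw 1
    by_cases hf : fac l = fac i
    · by_cases h : gab g fac pos i = true
      · have e : ∀ c, gf g fac pos c i l k = psi (pos i) c (kn k) := by intro c; funext z; simp [gf, hf, h]
        rw [e, e]
        exact tm_psi _ (kn k) h0.1 h0.2.1.le h0.2.2 h1.1 h1.2.1.le h1.2.2
      · have e : gf g fac pos false i l k = (fun w => cl (w 0)) := by funext z; simp [gf, hf, h]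
        have e' : gf g fac pos true i l k = (fun w => 2 * Real.pi * (ang (kn k) (w 1) / (4 * GG (g (fac l))))) := by funext z; simp [gf, hf, h]
        rw [e, e']
        exact (tm_eta _ (GG_pos _) (kn k) h0.1 h0.2.1 h0.2.2 h1.1 h1.2.1 h1.2.2).le
    · simp [tm, gf, hf]
  refine ⟨Finset.sum_nonneg fun k _ => Finset.sum_nonneg fun w hw => hnn k w hw, fun hf => ?_⟩
  have hbox : (0 : Fin 2 → ℕ) ∈ box 2 N := Fintype.mem_piFinset.2 fun a => Finset.mem_range.2 hN
  have h0 := hb 0 hbox 0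
  have h1 := hb 0 hbox 1
  suffices hx : ∃ k : SS (g (fac l)), 0 < sg k.2 * tm (gf g fac pos false i l k) (gf g fac pos true i l k) 
      (((0 : Fin 2 → ℕ) 0 : ℝ)/N) (((0 : Fin 2 → ℕ) 0 + 1 : ℝ)/N) (((0 : Fin 2 → ℕ) 1 : ℝ)/N) (((0 : Fin 2 → ℕ) 1 + 1 : ℝ)/N) by
    obtain ⟨k, hk⟩ := hx
    refine Finset.sum_pos' (fun k _ => Finset.sum_nonneg fun w hw => hnn k w hw) ⟨k, Finset.mem_univ _, ?_⟩
    exact Finset.sum_pos' (fun w hw => hnn k w hw) ⟨0, hbox, hk⟩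
  by_cases h : gab g fac pos i = true
  · have hlt := gab_true g fac pos h
    have hG : g (fac l) ≤ GG (g (fac l)) := by cases g (fac l) <;> simp [GG]
    refine ⟨(⟨4 * pos i + 1, by rw [← hf] at hlt; omega⟩, true), ?_⟩
    have e : ∀ c, gf g fac pos c i l (⟨4 * pos i + 1, by rw [← hf] at hlt; omega⟩, true) = psi (pos i) c (4 * pos i + 1, true) := by intro c; funext z; simp [gf, hf, h]
    rw [e, e]
    exact tm_psi_pos _ h0.1 h0.2.1 h0.2.2 h1.1 h1.2.1 h1.2.2
  · refine ⟨(0, true), ?_⟩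
    generalize ((0, true) : SS (g (fac l))) = k
    have e : gf g fac pos false i l k = (fun w => cl (w 0)) := by funext z; simp [gf, hf, h]
    have e' : gf g fac pos true i l k = (fun w => 2 * Real.pi * (ang (kn k) (w 1) / (4 * GG (g (fac l))))) := by funext z; simp [gf, hf, h]
    rw [e, e']
    exact tm_eta _ (GG_pos _) (kn k) h0.1 h0.2.1 h0.2.2 h1.1 h1.2.1 h1.2.2

theorem gcontra (en : ∀ j, Fin (n j) ≃ {l // fac l = j}) (hinj : ∀ i i', fac i = fac i' → pos i = pos i' → i = i')
    (V0 V1 : Fin B → Set (∀ j, SP (n j) (Mg (g j)))) (ho0 : ∀ i, IsOpen (V0 i)) (ho1 : ∀ i, IsOpen (V1 i))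
    (hn0 : ∀ i, NullOn (V0 i)) (hn1 : ∀ i, NullOn (V1 i)) (heq : ∀ i, gab g fac pos i = false → V1 i = V0 i)
    (hcov : ∀ x, ∃ i, x ∈ V0 i ∨ x ∈ V1 i) : False := by
  refine (gLB n g fac pos en).contra V0 V1 ho0 ho1 hn0 hn1 heq hcov (fun i l k => fac l = fac i ∧ (k.1:ℕ)/4 = pos i) ?_ ?_ ?_
    (fun N hN i l => (gJ n g fac pos en i l N hN).1) (fun N hN i => (gJ n g fac pos en i i N hN).2 rfl)
  · intro i l k h hP x y
    show gf g fac pos false i l k x = gf g fac pos false i l k y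
    have h : gab g fac pos i = true := h
    by_cases hf : fac l = fac i
    · have : ¬ (k.1:ℕ)/4 = pos i := fun h' => hP ⟨hf, h'⟩
      simp [gf, h, psi, this]
    · simp [gf, hf]
  · intro i l k h hP x y
    show gf g fac pos true i l k x = gf g fac pos true i l k y
    have h : gab g fac pos i = true := h
    by_cases hf : fac l = fac i
    · have : ¬ (k.1:ℕ)/4 = pos i := fun h' => hP ⟨hf, h'⟩
      simp [gf, h, psi, this]
    · simp [gf, hf]
  · rintro i i' l k _ _ ⟨h1, h2⟩ ⟨h3, h4⟩
    exact hinj i i' (h1.symm.trans h3) (h2.symm.trans h4)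

end glob

/-- the lower bound -/
theorem lower_bound {K : ℕ} (n g : Fin K → ℕ) (r : ℕ) (h : catLE (∀ j, SP (n j) (Mg (g j))) r) : ∑ j, (n j + min (n j) (g j)) ≤ r := by
  classical
  by_contra hlt
  push Not at hlt
  obtain ⟨U, hU, hcov, hnull⟩ := h
  let fac : Fin (∑ j, n j) → Fin K := fun l => (finSigmaFinEquiv.symm l).1
  let pos : Fin (∑ j, n j) → ℕ := fun l => (finSigmaFinEquiv.symm l).2
  let en : ∀ j, Fin (n j) ≃ {l // fac l = j} := fun j =>
    { toFun := fun m => ⟨finSigmaFinEquiv ⟨j, m⟩, by simp [fac]⟩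
      invFun := fun l => l.2 ▸ (finSigmaFinEquiv.symm l.1).2
      left_inv := by
        intro m
        have : ∀ (a : Σ j, Fin (n j)) (h : a.1 = j), a = ⟨j, m⟩ → (h ▸ a.2 : Fin (n j)) = m := by
          rintro a h rfl; rfl
        exact this _ _ (by simp)
      right_inv := by
        rintro ⟨l, rfl⟩
        apply Subtype.ext
        simp [fac] }
  -- class type
  let C : Type := Fin (∑ j, n j) ⊕ {i : Fin (∑ j, n j) // gab g fac pos i = true}
  have hcard : Fintype.card C = ∑ j, (n j + min (n j) (g j)) := by
    rw [Fintype.card_sum, Fintype.card_fin, Finset.sum_add_distrib]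
    congr 1
    rw [Fintype.card_subtype, Finset.card_filter, ← Equiv.sum_comp finSigmaFinEquiv]
    rw [Fintype.sum_sigma]
    refine Finset.sum_congr rfl fun j _ => ?_
    have : ∀ m : Fin (n j), (gab g fac pos (finSigmaFinEquiv ⟨j, m⟩) = true) ↔ (m:ℕ) < g j := by
      intro m
      simp only [gab, fac, pos, decide_eq_true_eq]
      rw [Equiv.symm_apply_apply]
    simp only [this]
    rw [← Finset.card_filter, Fin.card_filter_val_lt]
  have hemb : Nonempty (Fin (r+1) ↪ C) := by
    rw [Function.Embedding.nonempty_iff_card_le, hcard]; simpa using hlt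
  obtain ⟨emb⟩ := hemb
  let W : C → Set (∀ j, SP (n j) (Mg (g j))) := fun c => U (Function.invFun emb c)
  have hWo : ∀ c, IsOpen (W c) := fun c => hU _
  have hWn : ∀ c, NullOn (W c) := fun c => nullOn_iff.2 (hnull _)
  have hWc : ∀ x, ∃ c, x ∈ W c := by
    intro x
    have := hcov.ge (Set.mem_univ x)
    rw [Set.mem_iUnion] at this
    obtain ⟨i, hi⟩ := this
    exact ⟨emb i, by simp only [W]; rwa [Function.leftInverse_invFun emb.injective]⟩
  refine gcontra n g fac pos en ?_ (fun i => W (Sum.inl i)) (fun i => if h : gab g fac pos i = true then W (Sum.inr ⟨i, h⟩) else W (Sum.inl i))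
    (fun i => hWo _) ?_ (fun i => hWn _) ?_ ?_ ?_
  · intro i i' h1 h2
    apply finSigmaFinEquiv.symm.injective
    have : ∀ A A' : (Σ j, Fin (n j)), A.1 = A'.1 → (A.2:ℕ) = A'.2 → A = A' := by
      rintro ⟨a, b⟩ ⟨a', b'⟩ h1 h2
      simp only at h1
      subst h1
      congr 1
      exact Fin.ext h2
    exact this _ _ h1 h2
  · intro i; split_ifs <;> exact hWo _
  · intro i; split_ifs <;> exact hWn _
  · intro i h; simp [h]
  · intro x
    obtain ⟨c, hc⟩ := hWc x
    rcases c with i | ⟨i, h⟩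
    · exact ⟨i, Or.inl hc⟩
    · exact ⟨i, Or.inr (by simp only [h, dif_pos]; exact hc)⟩

end LSP

namespace LSP
set_option linter.all false
set_option autoImplicit false
open Topology

/-! ### Upper bound, genus zero -/

/-- piecewise continuity when the threshold value is avoided -/
lemma contOn_ite_gap {X Z : Type*} [TopologicalSpace X] [TopologicalSpace Z] {S : Set X} {u : X → ℝ} {c : ℝ}
    (hu : ContinuousOn u S) (hne : ∀ x ∈ S, u x ≠ c) {f1 f2 : X → Z} (h1 : ContinuousOn f1 S) (h2 : ContinuousOn f2 S) :
    ContinuousOn (fun x => if u x < c then f1 x else f2 x) S := by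
  intro x hx
  rcases lt_or_gt_of_ne (hne x hx) with h | h
  · have hev : ∀ᶠ y in 𝓝[S] x, u y < c := (hu x hx).eventually_lt continuousWithinAt_const h
    refine (h1 x hx).congr_of_eventuallyEq ?_ (if_pos h)
    filter_upwards [hev] with y hy
    exact if_pos hy
  · have hev : ∀ᶠ y in 𝓝[S] x, c < u y := continuousWithinAt_const.eventually_lt (hu x hx) h
    refine (h2 x hx).congr_of_eventuallyEq ?_ (if_neg (not_lt.2 h.le))
    filter_upwards [hev] with y hy
    exact if_neg (not_lt.2 (le_of_lt hy))

abbrev Sph := Metric.sphere (0 : EuclideanSpace ℝ (Fin 3)) 1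

lemma sph_norm (x : Sph) : ‖(x : EuclideanSpace ℝ (Fin 3))‖ = 1 := by
  have := x.2; simpa using this

lemma sph_hom {X : Type*} [TopologicalSpace X] {S : Set X} {f g : X → Sph} (hf : ContinuousOn f S) (hg : ContinuousOn g S)
    (hne : ∀ x ∈ S, (f x : EuclideanSpace ℝ (Fin 3)) ≠ -(g x)) : HomOn S f g := by
  set L : I × X → EuclideanSpace ℝ (Fin 3) := fun p => (1 - (p.1:ℝ)) • (f p.2 : EuclideanSpace ℝ (Fin 3)) + (p.1:ℝ) • (g p.2 : EuclideanSpace ℝ (Fin 3)) with hL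
  have hL0 : ∀ p ∈ (Set.univ ×ˢ S : Set (I × X)), L p ≠ 0 := by
    rintro ⟨τ, x⟩ ⟨-, hx⟩ h0
    have e1 : (1 - (τ:ℝ)) • (f x : EuclideanSpace ℝ (Fin 3)) = -((τ:ℝ) • (g x : EuclideanSpace ℝ (Fin 3))) := eq_neg_of_add_eq_zero_left h0
    have e2 := congrArg norm e1
    rw [norm_neg, norm_smul, norm_smul, sph_norm, sph_norm, Real.norm_of_nonneg (by linarith [τ.2.2]), Real.norm_of_nonneg τ.2.1] at e2
    have e3 : (τ:ℝ) = 1/2 := by linarith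
    rw [e3] at e1
    apply hne x hx
    have e4 : (2:ℝ) • ((1 - 1/2 : ℝ) • (f x : EuclideanSpace ℝ (Fin 3))) = (2:ℝ) • (-((1/2:ℝ) • (g x : EuclideanSpace ℝ (Fin 3)))) := by rw [e1]
    rw [smul_neg, smul_smul, smul_smul] at e4
    norm_num at e4
    exact e4
  have hLc : ContinuousOn L (Set.univ ×ˢ S) := by
    have a1 : ContinuousOn (fun p : I × X => (f p.2 : EuclideanSpace ℝ (Fin 3))) (Set.univ ×ˢ S) :=
      continuous_subtype_val.comp_continuousOn (hf.comp continuousOn_snd (fun p hp => hp.2))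
    have a2 : ContinuousOn (fun p : I × X => (g p.2 : EuclideanSpace ℝ (Fin 3))) (Set.univ ×ˢ S) :=
      continuous_subtype_val.comp_continuousOn (hg.comp continuousOn_snd (fun p hp => hp.2))
    have a3 : ContinuousOn (fun p : I × X => (p.1:ℝ)) (Set.univ ×ˢ S) := by fun_prop
    exact ((continuousOn_const.sub a3).smul a1).add (a3.smul a2)
  have hN : ∀ v : EuclideanSpace ℝ (Fin 3), v ≠ 0 → (‖v‖⁻¹ • v) ∈ Metric.sphere (0 : EuclideanSpace ℝ (Fin 3)) 1 := by
    intro v hv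
    rw [mem_sphere_zero_iff_norm, norm_smul, norm_inv, norm_norm, inv_mul_cancel₀ (norm_ne_zero_iff.2 hv)]
  classical
  refine ⟨fun p => if h : L p ≠ 0 then ⟨‖L p‖⁻¹ • L p, hN _ h⟩ else f p.2, ?_, ?_⟩
  · rw [continuousOn_iff_continuous_domRestrict]
    have : Continuous (fun p : (Set.univ ×ˢ S : Set (I × X)) => (⟨‖L p‖⁻¹ • L p, hN _ (hL0 p p.2)⟩ : Sph)) := by
      refine Continuous.subtype_mk ?_ _
      rw [continuousOn_iff_continuous_domRestrict] at hLc
      exact (hLc.norm.inv₀ (fun p => norm_ne_zero_iff.2 (hL0 p p.2))).smul hLc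
    refine this.congr ?_
    intro p
    simp only [Set.domRestrict]
    rw [dif_pos (hL0 p p.2)]
  · intro x hx
    constructor
    · simp only
      rw [dif_pos (hL0 _ ⟨trivial, hx⟩)]
      apply Subtype.ext
      simp [hL, sph_norm]
    · simp only
      rw [dif_pos (hL0 _ ⟨trivial, hx⟩)]
      apply Subtype.ext
      simp [hL, sph_norm]

def sN : Sph := ⟨EuclideanSpace.single 2 1, by simp⟩
def sE : Sph := ⟨EuclideanSpace.single 0 1, by simp⟩

lemma sph_null {a b : ℝ} (ha : 0 < a) (hab : a < b) (hb : b < 1/4) :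
    NullOn {x : Sph | ((x : EuclideanSpace ℝ (Fin 3)) 2 + 1)/2 ∉ Set.Icc a b} := by
  set S := {x : Sph | ((x : EuclideanSpace ℝ (Fin 3)) 2 + 1)/2 ∉ Set.Icc a b}
  have hcont : Continuous (fun x : Sph => ((x : EuclideanSpace ℝ (Fin 3)) 2 + 1)/2) := by fun_prop
  have hS : ∀ x ∈ S, ((x : EuclideanSpace ℝ (Fin 3)) 2 + 1)/2 < a ∨ b < ((x : EuclideanSpace ℝ (Fin 3)) 2 + 1)/2 := by
    intro x hx
    by_contra hc
    push Not at hc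
    exact hx ⟨hc.1, hc.2⟩
  set f1 : Sph → Sph := fun x => if ((x : EuclideanSpace ℝ (Fin 3)) 2 + 1)/2 < a then sE else sN with hf1
  have hf1c : ContinuousOn f1 S := by
    refine contOn_ite_gap hcont.continuousOn ?_ continuousOn_const continuousOn_const
    intro x hx he
    rcases hS x hx with h | h <;> linarith
  refine ⟨sN, (sph_hom (g := f1) continuousOn_id hf1c ?_).trans (sph_hom hf1c continuousOn_const ?_)⟩
  · intro x hx he
    have h2 := congrFun (congrArg (fun v : EuclideanSpace ℝ (Fin 3) => (fun i => v i)) he) 2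
    simp only [id, hf1] at h2
    split_ifs at h2 with hc
    · simp [sE] at h2
      rw [h2] at hc; linarith
    · simp [sN] at h2
      rcases hS x hx with h | h
      · exact hc h
      · rw [h2] at h; linarith
  · intro x hx he
    have h2 := congrFun (congrArg (fun v : EuclideanSpace ℝ (Fin 3) => (fun i => v i)) he) 2
    simp only [hf1] at h2
    split_ifs at h2 with hc
    · simp [sE, sN] at h2
    · simp [sN] at h2
      norm_num at h2

lemma NullOn.sp {X : Type*} [TopologicalSpace X] {n : ℕ} {S : Set X} (hS : IsOpen S) (h : NullOn S) : NullOn (spSet n S) := by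
  obtain ⟨y, h⟩ := h
  refine ⟨spMk fun _ => y, (h.sp (n := n) hS).congr ?_ ?_⟩
  · intro x _
    obtain ⟨s, rfl⟩ := spMk_surj x
    rfl
  · intro x _
    obtain ⟨s, rfl⟩ := spMk_surj x
    rfl

lemma hasFeat_zero (n : ℕ) : HasFeat (SP n (Mg 0)) n := by
  refine ⟨fun a b => spSet n (X := Sph) {x : Sph | ((x : EuclideanSpace ℝ (Fin 3)) 2 + 1)/2 ∉ Set.Icc a b}, ?_, ?_⟩
  · intro a b ha hab hb
    have hcont : Continuous (fun x : Sph => ((x : EuclideanSpace ℝ (Fin 3)) 2 + 1)/2) := by fun_prop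
    have ho : IsOpen {x : Sph | ((x : EuclideanSpace ℝ (Fin 3)) 2 + 1)/2 ∉ Set.Icc a b} := 
      (isClosed_Icc.preimage hcont).isOpen_compl
    exact ⟨isOpen_spSet ho, (sph_null ha hab hb).sp ho⟩
  · intro x
    obtain ⟨s, rfl⟩ := spMk_surj (X := Sph) x
    classical
    refine ⟨Finset.univ.image (fun l => ((s l : EuclideanSpace ℝ (Fin 3)) 2 + 1)/2), ?_, ?_⟩
    · exact Finset.card_image_le.trans (by simp)
    · intro a b ha hab hb h l
      exact h _ (Finset.mem_image_of_mem _ (Finset.mem_univ l))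

end LSP

namespace LSP
set_option linter.all false
set_option autoImplicit false
open Topology

/-! ### Bouquets of circles -/

lemma uac_eq {t r : ℝ} : ((t : ℝ) : UnitAddCircle) = (r : ℝ) ↔ ∃ n : ℤ, t = r + n := by
  rw [← sub_eq_zero, ← AddCircle.coe_sub, AddCircle.coe_eq_zero_iff]
  constructor
  · rintro ⟨n, hn⟩; exact ⟨n, by simp at hn; linarith⟩
  · rintro ⟨n, hn⟩; exact ⟨n, by simp; linarith⟩

lemma uac_eq_interior {t r : ℝ} (ht0 : 0 < t) (ht1 : t < 1) (hr0 : 0 ≤ r) (hr1 : r ≤ 1)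
    (h : ((t : ℝ) : UnitAddCircle) = (r : ℝ)) : r = t := by
  obtain ⟨n, hn⟩ := uac_eq.1 h
  have h1 : (n:ℝ) < 1 := by linarith
  have h2 : (-1:ℝ) < n := by linarith
  have h3 : n < 1 := by exact_mod_cast h1
  have h4 : -1 < n := by exact_mod_cast h2
  have : n = 0 := by omega
  rw [this] at hn; push_cast at hn; linarith

lemma uac_nat (k : ℕ) : (((k:ℕ):ℝ) : UnitAddCircle) = 0 := by
  have : ((k:ℝ) : UnitAddCircle) = ((0:ℝ) : UnitAddCircle) := uac_eq.2 ⟨k, by push_cast; ring⟩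
  simpa using this

/-- parametrisation of the bouquet of circles by the real line -/
def piG (y : ℝ) : ℕ → UnitAddCircle := fun i => ((cl (y - i) : ℝ) : UnitAddCircle)

lemma piG_cont : Continuous piG := by
  refine continuous_pi fun i => ?_
  exact (AddCircle.continuous_mk' _).comp (by fun_prop)

lemma cl_sub_nat {i k : ℕ} {t : ℝ} (ht : t ∈ Set.Icc (0:ℝ) 1) : 
    cl ((i:ℝ) + t - k) = if k < i then 1 else if k = i then t else 0 := by
  split_ifs with h1 h2
  · apply cl_of_one_le
    have : (k:ℝ) + 1 ≤ i := by exact_mod_cast h1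
    linarith [ht.1]
  · rw [h2]; rw [show (i:ℝ) + t - i = t by ring]; exact cl_of_mem ht
  · apply cl_of_nonpos
    have : (i:ℝ) + 1 ≤ k := by exact_mod_cast (by omega : i + 1 ≤ k)
    linarith [ht.2]

lemma piG_add (i : ℕ) {t : ℝ} (ht : t ∈ Set.Icc (0:ℝ) 1) : piG (i + t) = Pi.single i ((t:ℝ) : UnitAddCircle) := by
  funext k
  unfold piG
  rw [cl_sub_nat ht]
  by_cases h1 : k < i
  · rw [if_pos h1, Pi.single_eq_of_ne (by omega)]
    simpa using uac_nat 1
  · rw [if_neg h1]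
    by_cases h2 : k = i
    · subst h2; simp
    · rw [if_neg h2, Pi.single_eq_of_ne h2]; simp

lemma piG_nat (k : ℕ) : piG k = 0 := by
  have := piG_add k (t := 0) (by simp)
  simpa using this

lemma piG_eq_of_not_nat {y y' : ℝ} (hy : 0 ≤ y) (hy' : ∀ k : ℕ, y ≠ k) (h : piG y = piG y') : y' = y := by
  set i := ⌊y⌋₊
  have h1 : (i:ℝ) < y := lt_of_le_of_ne (Nat.floor_le hy) (hy' i).symm
  have h2 : y < i + 1 := Nat.lt_floor_add_one y
  have h3 := congrFun h i
  unfold piG at h3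
  rw [cl_of_mem (x := y - i) ⟨by linarith, by linarith⟩] at h3
  have h4 := uac_eq_interior (by linarith) (by linarith) (cl_nonneg _) (cl_le_one _) h3
  have h5 : cl (y' - i) = y' - i := by
    by_cases c1 : y' - i ≤ 0
    · rw [cl_of_nonpos c1] at h4; linarith
    · by_cases c2 : 1 ≤ y' - i
      · rw [cl_of_one_le c2] at h4; linarith
      · exact cl_of_mem ⟨by linarith, by linarith⟩
  linarith

/-- the bouquet of `m` circles -/
def Gr (m : ℕ) : Set (ℕ → UnitAddCircle) := piG '' Set.Icc 0 (m:ℝ)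

lemma Gr_cases {m : ℕ} {x : ℕ → UnitAddCircle} (hx : x ∈ Gr m) : x = 0 ∨ ∃ i < m, ∃ t ∈ Set.Ioo (0:ℝ) 1, x = piG (i + t) := by
  obtain ⟨y, hy, rfl⟩ := hx
  by_cases h : ∃ k : ℕ, y = k
  · obtain ⟨k, rfl⟩ := h; left; exact piG_nat k
  · push Not at h
    right
    refine ⟨⌊y⌋₊, ?_, y - ⌊y⌋₊, ⟨?_, ?_⟩, ?_⟩
    · rw [Nat.floor_lt hy.1]; exact lt_of_le_of_ne hy.2 (h m)
    · have := lt_of_le_of_ne (Nat.floor_le hy.1) (h ⌊y⌋₊).symm; linarith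
    · linarith [Nat.lt_floor_add_one y]
    · congr 1; ring

lemma loopsMap {X : Type*} [TopologicalSpace X] (P : X) (ℓ : ℕ → ℝ → X) (m : ℕ) (hc : ∀ i < m, Continuous (ℓ i))
    (h0 : ∀ i < m, ℓ i 0 = P) (h1 : ∀ i < m, ℓ i 1 = P) :
    ∃ hh : ℝ → X, Continuous hh ∧ (∀ i < m, ∀ t ∈ Set.Icc (0:ℝ) 1, hh (i + t) = ℓ i t) ∧ (∀ y : ℝ, m ≤ y → hh y = P) ∧ hh 0 = P := by
  induction m with
  | zero => exact ⟨fun _ => P, continuous_const, by simp, by simp, rfl⟩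
  | succ m ih =>
    obtain ⟨hh, k1, k2, k3, k4⟩ := ih (fun i hi => hc i (by omega)) (fun i hi => h0 i (by omega)) (fun i hi => h1 i (by omega))
    refine ⟨fun y => if y ≤ m then hh y else ℓ m (cl (y - m)), ?_, ?_, ?_, ?_⟩
    · refine Continuous.if_le k1 ((hc m (by omega)).comp (by fun_prop)) continuous_id continuous_const ?_
      intro y hy
      have hy : y = m := hy
      rw [hy, k3 _ le_rfl]; simp [h0 m (by omega)]
    · intro i hi t ht
      by_cases him : i < m
      · have : (i:ℝ) + 1 ≤ m := by exact_mod_cast him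
        simp only
        rw [if_pos (by linarith [ht.2]), k2 i him t ht]
      · have : i = m := by omega
        subst this
        simp only
        by_cases h : (i:ℝ) + t ≤ i
        · have : t = 0 := by linarith [ht.1]
          subst this
          rw [if_pos h, k3 _ (by simp), h0 i (by omega)]
        · rw [if_neg h]; congr 1; rw [show (i:ℝ) + t - i = t by ring]; exact cl_of_mem ht
    · intro y hy
      push_cast at hy
      simp only
      rw [if_neg (by linarith), cl_of_one_le (by linarith), h1 m (by omega)]
    · simp only
      rw [if_pos (by positivity), k4]

lemma loopsMap_nat {X : Type*} {P : X} {ℓ : ℕ → ℝ → X} {m : ℕ} {hh : ℝ → X} (h0 : ∀ i < m, ℓ i 0 = P)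
    (k2 : ∀ i < m, ∀ t ∈ Set.Icc (0:ℝ) 1, hh (i + t) = ℓ i t) (k3 : ∀ y : ℝ, m ≤ y → hh y = P) (k : ℕ) : hh k = P := by
  by_cases h : k < m
  · have := k2 k h 0 (by simp)
    rw [add_zero] at this; rw [this, h0 k h]
  · exact k3 _ (by exact_mod_cast not_lt.1 h)

/-- maps on the bouquet -/
lemma graphMap {X : Type*} [TopologicalSpace X] (P : X) (m : ℕ) (hh : ℝ → X) (hc : Continuous hh) (hP : ∀ k : ℕ, hh k = P) :
    ∃ hG : (ℕ → UnitAddCircle) → X, ContinuousOn hG (Gr m) ∧ ∀ y ∈ Set.Icc (0:ℝ) m, hG (piG y) = hh y := by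
  have hwd : ∀ y ∈ Set.Icc (0:ℝ) m, ∀ y' ∈ Set.Icc (0:ℝ) m, piG y = piG y' → hh y = hh y' := by
    intro y hy y' hy' h
    by_cases h1 : ∀ k : ℕ, y ≠ k
    · rw [piG_eq_of_not_nat hy.1 h1 h]
    · by_cases h2 : ∀ k : ℕ, y' ≠ k
      · rw [piG_eq_of_not_nat hy'.1 h2 h.symm]
      · push Not at h1 h2
        obtain ⟨k, rfl⟩ := h1
        obtain ⟨k', rfl⟩ := h2
        rw [hP, hP]
  classical
  have hex : ∀ x : ℕ → UnitAddCircle, ∃ z : X, ∀ y ∈ Set.Icc (0:ℝ) m, piG y = x → hh y = z := by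
    intro x
    by_cases h : x ∈ Gr m
    · obtain ⟨y, hy, rfl⟩ := h
      exact ⟨hh y, fun y' hy' h' => hwd y' hy' y hy h'⟩
    · exact ⟨P, fun y hy h' => absurd ⟨y, hy, h'⟩ h⟩
  choose hG hhG using hex
  have key : ∀ y ∈ Set.Icc (0:ℝ) m, hG (piG y) = hh y := fun y hy => (hhG _ y hy rfl).symm
  refine ⟨hG, ?_, key⟩
  rw [continuousOn_iff_continuous_domRestrict]
  set q : Set.Icc (0:ℝ) m → Gr m := fun y => ⟨piG y, y, y.2, rfl⟩
  have qc : Continuous q := (piG_cont.comp continuous_subtype_val).subtype_mk _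
  have qs : Function.Surjective q := by
    rintro ⟨x, y, hy, rfl⟩
    exact ⟨⟨y, hy⟩, rfl⟩
  have qq := qc.isClosedMap.isQuotientMap qc qs
  rw [qq.continuous_iff]
  refine (hc.comp continuous_subtype_val).congr fun y => ?_
  exact (key y y.2).symm

end LSP

namespace LSP
set_option linter.all false
set_option autoImplicit false
open Topology

/-! ### Pushing pieces of the surface onto a bouquet -/

lemma glue2 (g : ℕ) (j : Fin (g+1)) {t : ℝ} (ht : t ∈ Set.Icc (0:ℝ) 1) :
    mpt g 1 (4 * (j:ℕ) + t) = mpt g 1 (4 * (j:ℕ) + (3 - t)) := by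
  refine Quot.sound ⟨j, 0, t, ht.1, ht.2, ?_, ?_⟩
  · rw [polyBP_eq, dpt_val]; simp
  · rw [polyBP_eq, dpt_val]; simp; congr 1; ring

lemma glue3 (g : ℕ) (j : Fin (g+1)) {t : ℝ} (ht : t ∈ Set.Icc (0:ℝ) 1) :
    mpt g 1 (4 * (j:ℕ) + (1 + t)) = mpt g 1 (4 * (j:ℕ) + (4 - t)) := by
  refine Quot.sound ⟨j, 1, t, ht.1, ht.2, ?_, ?_⟩
  · rw [polyBP_eq, dpt_val]; simp; congr 1; ring
  · rw [polyBP_eq, dpt_val]; simp; congr 1; ring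

/-- base point -/
def Pb (g : ℕ) : Mg (g+1) := mpt g 1 0

lemma corner_step (g : ℕ) (j : Fin (g+1)) : 
    mpt g 1 (4 * (j:ℕ) + 1) = mpt g 1 (4 * (j:ℕ)) ∧ mpt g 1 (4 * (j:ℕ) + 2) = mpt g 1 (4 * (j:ℕ)) ∧ 
    mpt g 1 (4 * (j:ℕ) + 3) = mpt g 1 (4 * (j:ℕ)) ∧ mpt g 1 (4 * (j:ℕ) + 4) = mpt g 1 (4 * (j:ℕ)) := by
  have a1 := glue2 g j (t := 0) (by simp)
  have a2 := glue2 g j (t := 1) (by simp)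
  have a3 := glue3 g j (t := 0) (by simp)
  have a4 := glue3 g j (t := 1) (by simp)
  norm_num at a1 a2 a3 a4
  refine ⟨?_, ?_, ?_, ?_⟩
  · rw [a2, a4, a1]
  · rw [a4, a1]
  · rw [a1]
  · rw [← a3, a2, a4, a1]

lemma corner0 (g : ℕ) (j : ℕ) (hj : j ≤ g + 1) : mpt g 1 (4 * (j:ℝ)) = Pb g := by
  induction j with
  | zero => simp [Pb]
  | succ j ih =>
    have := (corner_step g ⟨j, by omega⟩).2.2.2
    simp only at this
    rw [← ih (by omega), ← this]
    congr 1; push_cast; ring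

lemma corner (g : ℕ) (j : Fin (g+1)) (r : ℕ) (hr : r ≤ 4) : mpt g 1 (4 * (j:ℕ) + (r:ℝ)) = Pb g := by
  rw [← corner0 g j (by omega)]
  obtain ⟨h1, h2, h3, h4⟩ := corner_step g j
  interval_cases r
  · simp
  · simpa using h1
  · simpa using h2
  · simpa using h3
  · simpa using h4

/-- retraction to the disc -/
def toD (z : ℂ) : Disc := ⟨z / ((max 1 ‖z‖ : ℝ) : ℂ), by
  rw [norm_div, Complex.norm_real, Real.norm_of_nonneg (by positivity), div_le_one (by positivity)]
  exact le_max_right _ _⟩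

lemma toD_cont : Continuous toD := by
  refine Continuous.subtype_mk ?_ _
  refine continuous_id.div (by fun_prop) ?_
  intro z
  have : (0:ℝ) < max 1 ‖z‖ := by positivity
  exact_mod_cast this.ne'

lemma toD_of_le {z : ℂ} (h : ‖z‖ ≤ 1) : (toD z : ℂ) = z := by
  simp [toD, max_eq_left h]

lemma toD_dpt (G : ℕ) {s : ℝ} (hs : s ∈ Set.Icc (0:ℝ) 1) (θ : ℝ) : toD ((s:ℂ) * EE G θ) = dpt G s θ := by
  apply Subtype.ext
  rw [toD_of_le, dpt_val, cl_of_mem hs]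
  rw [norm_mul, EE_norm, mul_one, Complex.norm_real, Real.norm_of_nonneg hs.1]; exact hs.2

/-- the path from the first corner to the corner `z` through the centre -/
def ct (G : ℕ) (z : ℂ) (r : ℝ) : ℂ := ((max 0 (1 - 2 * r) : ℝ) : ℂ) * EE G 0 + ((max 0 (2 * r - 1) : ℝ) : ℂ) * z

lemma ct_zero (G : ℕ) (z : ℂ) : ct G z 0 = EE G 0 := by simp [ct]
lemma ct_one (G : ℕ) (z : ℂ) : ct G z 1 = z := by norm_num [ct]

def wf (θ : ℝ) : ℝ := cl (2 * θ) - cl (2 * θ - 5)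
def uf (s θ : ℝ) : ℝ := 1 - s * wf θ
def Vf (θ : ℝ) : ℝ := cl (θ - 1) - cl (θ - 3)
def vf (s θ : ℝ) : ℝ := Vf θ * cl (4 * s - 2)
def Af (s θ : ℝ) : ℝ := cl (2 * s) * cl (3 - 4 * θ)
def Bf (s θ : ℝ) : ℝ := cl (2 * s) * cl (4 * θ - 3)
def betR (θ : ℝ) : ℝ := 3 * cl ((θ - 1/2)/2) + cl (θ - 3)
def betC (θ : ℝ) : ℝ := 1 + cl (θ - 1)
def fR (G : ℕ) (j : ℕ) (s θ : ℝ) : ℂ := ct G (EE G (4 * j)) (Af s θ) + ct G (EE G (4 * j + 4)) (Bf s θ)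
  + EE G (4 * j + 4 - vf s θ) - EE G 0 - EE G (4 * j + 4)

lemma tri {s θ : ℝ} (hs : s ∈ Set.Icc (0:ℝ) 1) (hθ : θ ∈ Set.Icc (0:ℝ) 4) :
    (Bf s θ = 0 ∧ vf s θ = 0) ∨ (Af s θ = 0 ∧ vf s θ = 0) ∨ (Af s θ = 0 ∧ Bf s θ = 1) := by
  obtain ⟨s0, s1⟩ := hs
  obtain ⟨t0, t1⟩ := hθ
  unfold Bf vf Af Vf
  by_cases h1 : θ ≤ 3/4
  · left
    rw [cl_of_nonpos (x := 4 * θ - 3) (by linarith), cl_of_nonpos (x := θ - 1) (by linarith), cl_of_nonpos (x := θ - 3) (by linarith)]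
    simp
  · push Not at h1
    right
    rw [cl_of_nonpos (x := 3 - 4 * θ) (by linarith)]
    by_cases h2 : θ ≤ 1
    · left
      rw [cl_of_nonpos (x := θ - 1) (by linarith), cl_of_nonpos (x := θ - 3) (by linarith)]
      simp
    · push Not at h2
      by_cases h3 : s ≤ 1/2
      · left; rw [cl_of_nonpos (x := 4 * s - 2) (by linarith)]; simp
      · push Not at h3
        right; rw [cl_of_one_le (x := 4 * θ - 3) (by linarith), cl_of_one_le (x := 2 * s) (by linarith)]; simp

lemma Vf_mem {θ : ℝ} (hθ : θ ∈ Set.Icc (0:ℝ) 4) : Vf θ ∈ Set.Icc (0:ℝ) 1 := by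
  unfold Vf
  by_cases h : θ ≤ 3
  · rw [cl_of_nonpos (x := θ - 3) (by linarith)]; simpa using cl_mem (θ - 1)
  · push Not at h
    rw [cl_of_one_le (x := θ - 1) (by linarith)]
    have := cl_mem (θ - 3)
    constructor <;> linarith [this.1, this.2]

lemma vf_mem {s θ : ℝ} (hθ : θ ∈ Set.Icc (0:ℝ) 4) : vf s θ ∈ Set.Icc (0:ℝ) 1 := by
  have h1 := Vf_mem hθ
  have h2 := cl_mem (4 * s - 2)
  unfold vf
  exact ⟨mul_nonneg h1.1 h2.1, mul_le_one₀ h1.2 h2.1 h2.2⟩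
lemma Af_mem (s θ : ℝ) : Af s θ ∈ Set.Icc (0:ℝ) 1 := by
  have h1 := cl_mem (2 * s)
  have h2 := cl_mem (3 - 4 * θ)
  unfold Af
  exact ⟨mul_nonneg h1.1 h2.1, mul_le_one₀ h1.2 h2.1 h2.2⟩
lemma Bf_mem (s θ : ℝ) : Bf s θ ∈ Set.Icc (0:ℝ) 1 := by
  have h1 := cl_mem (2 * s)
  have h2 := cl_mem (4 * θ - 3)
  unfold Bf
  exact ⟨mul_nonneg h1.1 h2.1, mul_le_one₀ h1.2 h2.1 h2.2⟩

lemma wf_mem {θ : ℝ} (hθ : θ ∈ Set.Icc (0:ℝ) 4) : wf θ ∈ Set.Icc (0:ℝ) 1 := by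
  unfold wf
  by_cases h : θ ≤ 5/2
  · rw [cl_of_nonpos (x := 2 * θ - 5) (by linarith)]; simpa using cl_mem (2 * θ)
  · push Not at h
    rw [cl_of_one_le (x := 2 * θ) (by linarith)]
    have := cl_mem (2 * θ - 5)
    constructor <;> linarith [this.1, this.2]

/-- consequences of being in the cap -/
lemma cap_facts {s θ c : ℝ} (hs : s ∈ Set.Icc (0:ℝ) 1) (hθ : θ ∈ Set.Icc (0:ℝ) 4) (hc : c < 1/4) (h : uf s θ < c) :
    3/4 < s ∧ θ < 3 ∧ vf s θ = cl (θ - 1) := by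
  have hw := wf_mem hθ
  unfold uf at h
  have h1 : 3/4 < s := by nlinarith [hs.1, hs.2, hw.1, hw.2]
  have h2 : θ < 3 := by
    by_contra hc'
    push Not at hc'
    have : wf θ = 0 := by
      unfold wf; rw [cl_of_one_le (by linarith), cl_of_one_le (by linarith)]; simp
    rw [this] at h; linarith
  refine ⟨h1, h2, ?_⟩
  unfold vf Vf
  rw [cl_of_one_le (x := 4 * s - 2) (by linarith), cl_of_nonpos (x := θ - 3) (by linarith)]
  simp

/-- boundary values, first pair of edges -/
lemma bdry2 {t : ℝ} (ht : t ∈ Set.Icc (0:ℝ) 1) : uf 1 t = uf 1 (3 - t) ∧ vf 1 t = 0 ∧ vf 1 (3 - t) = 1 ∧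
    betC t = 1 ∧ betC (3 - t) = 2 := by
  obtain ⟨t0, t1⟩ := ht
  refine ⟨?_, ?_, ?_, ?_, ?_⟩
  · unfold uf wf
    rw [cl_of_nonpos (x := 2 * t - 5) (by linarith), cl_of_one_le (x := 2 * (3 - t)) (by linarith)]
    by_cases h : t ≤ 1/2
    · rw [cl_of_mem (x := 2 * t) ⟨by linarith, by linarith⟩, cl_of_mem (x := 2 * (3 - t) - 5) ⟨by linarith, by linarith⟩]; ring
    · push Not at h
      rw [cl_of_one_le (x := 2 * t) (by linarith), cl_of_nonpos (x := 2 * (3 - t) - 5) (by linarith)]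
  · unfold vf Vf; rw [cl_of_nonpos (x := t - 1) (by linarith), cl_of_nonpos (x := t - 3) (by linarith)]; simp
  · unfold vf Vf; rw [cl_of_one_le (x := 3 - t - 1) (by linarith), cl_of_nonpos (x := 3 - t - 3) (by linarith), cl_of_one_le (by norm_num)]; simp
  · unfold betC; rw [cl_of_nonpos (x := t - 1) (by linarith)]; simp
  · unfold betC; rw [cl_of_one_le (x := 3 - t - 1) (by linarith)]; norm_num

lemma bdry2R {t c : ℝ} (ht : t ∈ Set.Icc (0:ℝ) 1) (hc0 : 0 < c) (h : ¬ uf 1 t < c) : t < 1/2 ∧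
    Af 1 t = 1 ∧ Bf 1 t = 0 ∧ Af 1 (3 - t) = 0 ∧ Bf 1 (3 - t) = 1 ∧ betR t = 0 ∧ betR (3 - t) = 3 := by
  obtain ⟨t0, t1⟩ := ht
  have h1 : t < 1/2 := by
    by_contra h2
    push Not at h2
    apply h
    unfold uf wf
    rw [cl_of_nonpos (x := 2 * t - 5) (by linarith), cl_of_one_le (x := 2 * t) (by linarith)]
    linarith
  have e0 : cl (2 * 1) = 1 := cl_of_one_le (by norm_num)
  refine ⟨h1, ?_, ?_, ?_, ?_, ?_, ?_⟩
  · unfold Af; rw [e0, cl_of_one_le (x := 3 - 4 * t) (by linarith)]; simp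
  · unfold Bf; rw [e0, cl_of_nonpos (x := 4 * t - 3) (by linarith)]; simp
  · unfold Af; rw [e0, cl_of_nonpos (x := 3 - 4 * (3 - t)) (by linarith)]; simp
  · unfold Bf; rw [e0, cl_of_one_le (x := 4 * (3 - t) - 3) (by linarith)]; simp
  · unfold betR; rw [cl_of_nonpos (x := (t - 1/2)/2) (by linarith), cl_of_nonpos (x := t - 3) (by linarith)]; simp
  · unfold betR; rw [cl_of_one_le (x := (3 - t - 1/2)/2) (by linarith), cl_of_nonpos (x := 3 - t - 3) (by linarith)]; simp

lemma bdry3 {t : ℝ} (ht : t ∈ Set.Icc (0:ℝ) 1) : uf 1 (1 + t) = 0 ∧ uf 1 (4 - t) = 1 ∧ vf 1 (1 + t) = t ∧ vf 1 (4 - t) = t ∧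
    betC (1 + t) = 1 + t ∧ betR (4 - t) = 4 - t ∧ Af 1 (4 - t) = 0 ∧ Bf 1 (4 - t) = 1 := by
  obtain ⟨t0, t1⟩ := ht
  have e0 : cl (2 * 1) = 1 := cl_of_one_le (by norm_num)
  have e1 : cl (4 * 1 - 2) = 1 := cl_of_one_le (by norm_num)
  refine ⟨?_, ?_, ?_, ?_, ?_, ?_, ?_, ?_⟩
  · unfold uf wf; rw [cl_of_one_le (x := 2 * (1 + t)) (by linarith), cl_of_nonpos (x := 2 * (1 + t) - 5) (by linarith)]; norm_num
  · unfold uf wf; rw [cl_of_one_le (x := 2 * (4 - t)) (by linarith), cl_of_one_le (x := 2 * (4 - t) - 5) (by linarith)]; norm_num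
  · unfold vf Vf; rw [e1, cl_of_mem (x := 1 + t - 1) ⟨by linarith, by linarith⟩, cl_of_nonpos (x := 1 + t - 3) (by linarith)]; ring
  · unfold vf Vf; rw [e1, cl_of_one_le (x := 4 - t - 1) (by linarith), cl_of_mem (x := 4 - t - 3) ⟨by linarith, by linarith⟩]; ring
  · unfold betC; rw [cl_of_mem (x := 1 + t - 1) ⟨by linarith, by linarith⟩]; ring
  · unfold betR; rw [cl_of_one_le (x := (4 - t - 1/2)/2) (by linarith), cl_of_mem (x := 4 - t - 3) ⟨by linarith, by linarith⟩]; ring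
  · unfold Af; rw [cl_of_nonpos (x := 3 - 4 * (4 - t)) (by linarith)]; simp
  · unfold Bf; rw [e0, cl_of_one_le (x := 4 * (4 - t) - 3) (by linarith)]; simp

/-- values on the sides of a sector -/
lemma side0 (s : ℝ) : uf s 0 = 1 ∧ vf s 0 = 0 ∧ betR 0 = 0 ∧ Af s 0 = cl (2 * s) ∧ Bf s 0 = 0 := by
  unfold uf wf vf Vf betR Af Bf
  rw [cl_of_nonpos (x := 2 * 0) (by norm_num), cl_of_nonpos (x := 2 * 0 - 5) (by norm_num), cl_of_nonpos (x := 0 - 1) (by norm_num),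
    cl_of_nonpos (x := 0 - 3) (by norm_num), cl_of_nonpos (x := (0 - 1/2)/2) (by norm_num), cl_of_one_le (x := 3 - 4 * 0) (by norm_num),
    cl_of_nonpos (x := 4 * 0 - 3) (by norm_num)]
  simp

lemma side4 (s : ℝ) : uf s 4 = 1 ∧ vf s 4 = 0 ∧ betR 4 = 4 ∧ Af s 4 = 0 ∧ Bf s 4 = cl (2 * s) := by
  unfold uf wf vf Vf betR Af Bf
  rw [cl_of_one_le (x := 2 * 4) (by norm_num), cl_of_one_le (x := 2 * 4 - 5) (by norm_num), cl_of_one_le (x := 4 - 1) (by norm_num),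
    cl_of_one_le (x := 4 - 3) (by norm_num), cl_of_one_le (x := (4 - 1/2)/2) (by norm_num), cl_of_nonpos (x := 3 - 4 * 4) (by norm_num),
    cl_of_one_le (x := 4 * 4 - 3) (by norm_num)]
  norm_num

lemma centre0 (θ : ℝ) : uf 0 θ = 1 ∧ vf 0 θ = 0 ∧ Af 0 θ = 0 ∧ Bf 0 θ = 0 := by
  unfold uf vf Af Bf
  rw [cl_of_nonpos (x := 4 * 0 - 2) (by norm_num), cl_of_nonpos (x := 2 * 0) (by norm_num)]
  simp

lemma EE_succ (g : ℕ) (j : Fin (g+1)) : EE (g+1) (4 * ((j + 1 : Fin (g+1)) : ℕ)) = EE (g+1) (4 * (j:ℕ) + 4) := by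
  by_cases h : (j:ℕ) < g
  · rw [Fin.val_add_one_of_lt (by rw [Fin.lt_def]; simpa using h)]
    congr 1; push_cast; ring
  · have : j = Fin.last g := Fin.ext (by simp; omega)
    rw [this, Fin.last_add_one]
    have h2 := EE_period (G := g+1) (by omega) 0
    simp only [Fin.val_zero, Fin.val_last]
    push_cast at h2 ⊢
    rw [show (4:ℝ) * g + 4 = 0 + 4 * (g + 1) by ring, h2]; simp

end LSP

namespace LSP
set_option linter.all false
set_option autoImplicit false
open Topology

@[fun_prop] lemma wf_cont : Continuous wf := by unfold wf; fun_prop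
@[fun_prop] lemma Vf_cont : Continuous Vf := by unfold Vf; fun_prop
@[fun_prop] lemma betR_cont : Continuous betR := by unfold betR; fun_prop
@[fun_prop] lemma betC_cont : Continuous betC := by unfold betC; fun_prop
lemma uf_cont : Continuous (fun p : ℝ × ℝ => uf p.1 p.2) := by unfold uf; fun_prop
lemma vf_cont : Continuous (fun p : ℝ × ℝ => vf p.1 p.2) := by unfold vf; fun_prop
lemma Af_cont : Continuous (fun p : ℝ × ℝ => Af p.1 p.2) := by unfold Af; fun_prop
lemma Bf_cont : Continuous (fun p : ℝ × ℝ => Bf p.1 p.2) := by unfold Bf; fun_prop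
lemma ct_cont (G : ℕ) (z : ℂ) : Continuous (ct G z) := by unfold ct; fun_prop
lemma fR_cont (G j : ℕ) : Continuous (fun p : ℝ × ℝ => fR G j p.1 p.2) := by
  unfold fR
  have h1 := (ct_cont G (EE G (4 * j))).comp Af_cont
  have h2 := (ct_cont G (EE G (4 * j + 4))).comp Bf_cont
  have h3 := (EE_cont G).comp ((continuous_const (y := (4 * j + 4 : ℝ))).sub vf_cont)
  exact ((((h1.add h2).add h3).sub continuous_const).sub continuous_const)

lemma uac_coe_cont : Continuous (fun t : ℝ => (t : UnitAddCircle)) := AddCircle.continuous_mk' _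

/-- the cutting function -/
lemma exists_dG (g : ℕ) : ∃ d : Mg (g+1) → ℝ, Continuous d ∧ ∀ j : Fin (g+1), ∀ s ∈ Set.Icc (0:ℝ) 1, ∀ θ ∈ Set.Icc (0:ℝ) 4,
    d (mpt g s (4 * (j:ℕ) + θ)) = min (uf s θ) (1 - uf s θ) := by
  obtain ⟨d, hd⟩ := Mlift g (fun _ s θ => min (uf s θ) (1 - uf s θ)) 0
    (fun j θ hθ => by show _ = _; rw [(centre0 θ).1]; simp)
    (fun j s hs => by show _ = _; rw [(side0 s).1, (side4 s).1])
    (fun j t ht => by show _ = _; rw [(bdry2 ht).1])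
    (fun j t ht => by show _ = _; rw [(bdry3 ht).1, (bdry3 ht).2.1]; simp)
  refine ⟨d, Mlift_cont g d _ hd (fun j => ?_), hd⟩
  exact uf_cont.min (continuous_const.sub uf_cont)

def dG (g : ℕ) : Mg (g+1) → ℝ := (exists_dG g).choose
lemma dG_cont (g : ℕ) : Continuous (dG g) := (exists_dG g).choose_spec.1
lemma dG_eq (g : ℕ) (j : Fin (g+1)) {s θ : ℝ} (hs : s ∈ Set.Icc (0:ℝ) 1) (hθ : θ ∈ Set.Icc (0:ℝ) 4) :
    dG g (mpt g s (4 * (j:ℕ) + θ)) = min (uf s θ) (1 - uf s θ) := (exists_dG g).choose_spec.2 j s hs θ hθ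

lemma exists_vG (g : ℕ) (i : Fin (g+1)) : ∃ d : Mg (g+1) → UnitAddCircle, Continuous d ∧ ∀ j : Fin (g+1), ∀ s ∈ Set.Icc (0:ℝ) 1, 
    ∀ θ ∈ Set.Icc (0:ℝ) 4, d (mpt g s (4 * (j:ℕ) + θ)) = if j = i then ((vf s θ : ℝ) : UnitAddCircle) else 0 := by
  obtain ⟨d, hd⟩ := Mlift g (fun j s θ => if j = i then ((vf s θ : ℝ) : UnitAddCircle) else 0) 0
    (fun j θ hθ => by show _ = _; rw [(centre0 θ).2.1]; simp)
    (fun j s hs => by show _ = _; rw [(side0 s).2.1, (side4 s).2.1]; simp)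
    (fun j t ht => by show _ = _; rw [(bdry2 ht).2.1, (bdry2 ht).2.2.1]; have := uac_nat 1; rw [Nat.cast_one] at this; rw [this]; simp)
    (fun j t ht => by show _ = _; rw [(bdry3 ht).2.2.1, (bdry3 ht).2.2.2.1])
  refine ⟨d, Mlift_cont g d _ hd (fun j => ?_), hd⟩
  by_cases h : j = i
  · simp only [h, if_true]; exact uac_coe_cont.comp vf_cont
  · simp only [h, if_false]; exact continuous_const

def vG (g : ℕ) (i : Fin (g+1)) : Mg (g+1) → UnitAddCircle := (exists_vG g i).choose
lemma vG_cont (g : ℕ) (i : Fin (g+1)) : Continuous (vG g i) := (exists_vG g i).choose_spec.1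
lemma vG_eq (g : ℕ) (i j : Fin (g+1)) {s θ : ℝ} (hs : s ∈ Set.Icc (0:ℝ) 1) (hθ : θ ∈ Set.Icc (0:ℝ) 4) :
    vG g i (mpt g s (4 * (j:ℕ) + θ)) = if j = i then ((vf s θ : ℝ) : UnitAddCircle) else 0 := (exists_vG g i).choose_spec.2 j s hs θ hθ

/-- the complement of the cut -/
def MI (g : ℕ) (a b : ℝ) : Set (Mg (g+1)) := {x | dG g x ∉ Set.Icc a b}

lemma MI_open (g : ℕ) (a b : ℝ) : IsOpen (MI g a b) := (isClosed_Icc.preimage (dG_cont g)).isOpen_compl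

lemma MI_ne {g : ℕ} {a b : ℝ} (ha : 0 < a) (hab : a < b) (hb : b < 1/4) (j : Fin (g+1)) {s θ : ℝ} (hs : s ∈ Set.Icc (0:ℝ) 1) 
    (hθ : θ ∈ Set.Icc (0:ℝ) 4) (h : mpt g s (4 * (j:ℕ) + θ) ∈ MI g a b) : uf s θ ≠ (a + b)/2 := by
  intro he
  apply h
  rw [dG_eq g j hs hθ, he, min_eq_left (by linarith)]
  constructor <;> linarith

/-- loops of the bouquet -/
def lpG (g : ℕ) (i : ℕ) (t : ℝ) : Mg (g+1) := if i % 2 = 0 then mpt g 1 (4 * (i/2 : ℕ) + (1 + t)) else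
  mq g (toD (ct (g+1) (EE (g+1) (4 * (i/2 : ℕ))) t))

lemma lpG_even (g : ℕ) (j : ℕ) (t : ℝ) : lpG g (2 * j) t = mpt g 1 (4 * j + (1 + t)) := by
  unfold lpG; rw [if_pos (by omega)]; congr 3; simp
lemma lpG_odd (g : ℕ) (j : ℕ) (t : ℝ) : lpG g (2 * j + 1) t = mq g (toD (ct (g+1) (EE (g+1) (4 * j)) t)) := by
  unfold lpG; rw [if_neg (by omega)]; congr 5; norm_num; omega

lemma toD_EE (G : ℕ) (θ : ℝ) : toD (EE G θ) = dpt G 1 θ := by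
  have := toD_dpt G (s := 1) (by simp) θ
  simpa using this

lemma mpt_eq_toD (g : ℕ) {s : ℝ} (hs : s ∈ Set.Icc (0:ℝ) 1) (θ : ℝ) : mpt g s θ = mq g (toD ((s:ℂ) * EE (g+1) θ)) := by
  rw [toD_dpt _ hs]; rfl

lemma mpt_one (g : ℕ) (θ : ℝ) : mpt g 1 θ = mq g (toD (EE (g+1) θ)) := by
  rw [toD_EE]; rfl

lemma lpG_cont (g i : ℕ) : Continuous (lpG g i) := by
  by_cases h : i % 2 = 0
  · have : lpG g i = fun t => mpt g 1 (4 * (i/2 : ℕ) + (1 + t)) := by funext t; simp [lpG, h]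
    rw [this]
    exact (mpt_cont g).comp (f := fun t : ℝ => ((1:ℝ), (4 * ((i/2 : ℕ):ℝ) + (1 + t)))) (by fun_prop)
  · have : lpG g i = fun t => mq g (toD (ct (g+1) (EE (g+1) (4 * (i/2 : ℕ))) t)) := by funext t; simp [lpG, h]
    rw [this]
    exact (mq_cont g).comp (toD_cont.comp (ct_cont _ _))

lemma lpG_zero (g i : ℕ) (hi : i < 2 * (g+1)) : lpG g i 0 = Pb g := by
  by_cases h : i % 2 = 0
  · have e : i = 2 * (i/2) := by omega
    rw [e, lpG_even]
    have := corner g ⟨i/2, by omega⟩ 1 (by norm_num)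
    simpa using this
  · have e : i = 2 * (i/2) + 1 := by omega
    rw [e, lpG_odd, ct_zero, ← mpt_one]; rfl

lemma lpG_one (g i : ℕ) (hi : i < 2 * (g+1)) : lpG g i 1 = Pb g := by
  by_cases h : i % 2 = 0
  · have e : i = 2 * (i/2) := by omega
    rw [e, lpG_even]
    have := corner g ⟨i/2, by omega⟩ 2 (by norm_num)
    norm_num at this ⊢
    exact this
  · have e : i = 2 * (i/2) + 1 := by omega
    rw [e, lpG_odd, ct_one, ← mpt_one]
    exact corner0 g _ (by omega)

lemma exists_hhG (g : ℕ) : ∃ hh : ℝ → Mg (g+1), Continuous hh ∧ (∀ i < 2 * (g+1), ∀ t ∈ Set.Icc (0:ℝ) 1, hh (i + t) = lpG g i t) ∧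
    (∀ y, ((2 * (g+1) : ℕ):ℝ) ≤ y → hh y = Pb g) ∧ hh 0 = Pb g := loopsMap (Pb g) (lpG g) (2 * (g+1)) (fun i _ => lpG_cont g i) (lpG_zero g) (lpG_one g)
def hhG (g : ℕ) : ℝ → Mg (g+1) := (exists_hhG g).choose
lemma hhG_cont (g : ℕ) : Continuous (hhG g) := (exists_hhG g).choose_spec.1
lemma hhG_add (g : ℕ) : ∀ i < 2 * (g+1), ∀ t ∈ Set.Icc (0:ℝ) 1, hhG g (i + t) = lpG g i t := (exists_hhG g).choose_spec.2.1
lemma hhG_nat (g : ℕ) (k : ℕ) : hhG g k = Pb g := loopsMap_nat (lpG_zero g) (hhG_add g) (exists_hhG g).choose_spec.2.2.1 k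

lemma exists_hG (g : ℕ) : ∃ h : (ℕ → UnitAddCircle) → Mg (g+1), ContinuousOn h (Gr (2 * (g+1))) ∧
    ∀ y ∈ Set.Icc (0:ℝ) (2 * (g+1) : ℕ), h (piG y) = hhG g y := graphMap (Pb g) (2 * (g+1)) (hhG g) (hhG_cont g) (hhG_nat g)
def hG (g : ℕ) : (ℕ → UnitAddCircle) → Mg (g+1) := (exists_hG g).choose
lemma hG_cont (g : ℕ) : ContinuousOn (hG g) (Gr (2 * (g+1))) := (exists_hG g).choose_spec.1
lemma hG_eq (g : ℕ) : ∀ y ∈ Set.Icc (0:ℝ) (2 * (g+1) : ℕ), hG g (piG y) = hhG g y := (exists_hG g).choose_spec.2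

lemma Gr_single {m i : ℕ} (hi : i < m) {t : ℝ} (ht : t ∈ Set.Icc (0:ℝ) 1) : (i:ℝ) + t ∈ Set.Icc (0:ℝ) m := by
  have : (i:ℝ) + 1 ≤ m := by exact_mod_cast hi
  constructor
  · have := ht.1; positivity
  · linarith [ht.2]

lemma hG_single (g : ℕ) {i : ℕ} (hi : i < 2 * (g+1)) {t : ℝ} (ht : t ∈ Set.Icc (0:ℝ) 1) :
    hG g (Pi.single i ((t:ℝ) : UnitAddCircle)) = lpG g i t := by
  rw [← piG_add i ht, hG_eq g _ (Gr_single hi ht), hhG_add g i hi t ht]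

lemma single_mem_Gr {m i : ℕ} (hi : i < m) {t : ℝ} (ht : t ∈ Set.Icc (0:ℝ) 1) : Pi.single i ((t:ℝ) : UnitAddCircle) ∈ Gr m :=
  ⟨i + t, Gr_single hi ht, piG_add i ht⟩

/-- the push in charts -/
def puΦ (g : ℕ) (c : ℝ) (j : Fin (g+1)) (s θ : ℝ) : ℕ → UnitAddCircle :=
  if uf s θ < c then Pi.single (2 * (j:ℕ)) ((vf s θ : ℝ) : UnitAddCircle) else
    Pi.single (2 * (j:ℕ)) ((vf s θ : ℝ) : UnitAddCircle) + Pi.single (2 * (j:ℕ) + 1) ((Af s θ : ℝ) : UnitAddCircle) +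
      Pi.single (2 * ((j+1 : Fin (g+1)):ℕ) + 1) ((Bf s θ : ℝ) : UnitAddCircle)

lemma uac_one : ((1:ℝ) : UnitAddCircle) = 0 := by simpa using uac_nat 1

lemma exists_pu (g : ℕ) {c : ℝ} (hc0 : 0 < c) (hc : c < 1/4) : ∃ pu : Mg (g+1) → ℕ → UnitAddCircle, 
    ∀ j : Fin (g+1), ∀ s ∈ Set.Icc (0:ℝ) 1, ∀ θ ∈ Set.Icc (0:ℝ) 4, pu (mpt g s (4 * (j:ℕ) + θ)) = puΦ g c j s θ := by
  refine Mlift g (puΦ g c) 0 ?_ ?_ ?_ ?_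
  · intro j θ hθ
    unfold puΦ
    obtain ⟨h1, h2, h3, h4⟩ := centre0 θ
    rw [h1, h2, h3, h4, if_neg (by linarith)]; simp
  · intro j s hs
    unfold puΦ
    obtain ⟨h1, h2, h3, h4, h5⟩ := side0 s
    obtain ⟨k1, k2, k3, k4, k5⟩ := side4 s
    rw [h1, h2, h4, h5, k1, k2, k4, k5, if_neg (by linarith), if_neg (by linarith)]; simp
  · intro j t ht
    unfold puΦ
    obtain ⟨h1, h2, h3, h4, h5⟩ := bdry2 ht
    rw [← h1, h2, h3]
    by_cases h : uf 1 t < c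
    · rw [if_pos h, if_pos h]; simp [uac_one]
    · rw [if_neg h, if_neg h]
      obtain ⟨k1, k2, k3, k4, k5, k6, k7⟩ := bdry2R ht hc0 h
      rw [k2, k3, k4, k5]; simp [uac_one]
  · intro j t ht
    unfold puΦ
    obtain ⟨h1, h2, h3, h4, h5, h6, h7, h8⟩ := bdry3 ht
    rw [h1, h2, h3, h4, h7, h8, if_pos hc0, if_neg (by linarith)]; simp [uac_one]

/-- in each chart the push is a single coordinate -/
lemma puΦ_cases (g : ℕ) (c : ℝ) (j : Fin (g+1)) {s θ : ℝ} (hs : s ∈ Set.Icc (0:ℝ) 1) (hθ : θ ∈ Set.Icc (0:ℝ) 4) :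
    (uf s θ < c ∧ puΦ g c j s θ = Pi.single (2 * (j:ℕ)) ((vf s θ : ℝ) : UnitAddCircle)) ∨ 
    (¬ uf s θ < c ∧ Bf s θ = 0 ∧ vf s θ = 0 ∧ puΦ g c j s θ = Pi.single (2 * (j:ℕ) + 1) ((Af s θ : ℝ) : UnitAddCircle)) ∨
    (¬ uf s θ < c ∧ Af s θ = 0 ∧ vf s θ = 0 ∧ puΦ g c j s θ = Pi.single (2 * ((j+1 : Fin (g+1)):ℕ) + 1) ((Bf s θ : ℝ) : UnitAddCircle)) ∨
    (¬ uf s θ < c ∧ Af s θ = 0 ∧ Bf s θ = 1 ∧ puΦ g c j s θ = Pi.single (2 * (j:ℕ)) ((vf s θ : ℝ) : UnitAddCircle)) := by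
  unfold puΦ
  by_cases h : uf s θ < c
  · left; exact ⟨h, if_pos h⟩
  · right
    rw [if_neg h]
    rcases tri hs hθ with ⟨h1, h2⟩ | ⟨h1, h2⟩ | ⟨h1, h2⟩
    · left; exact ⟨h, h1, h2, by simp [h1, h2]⟩
    · right; left; exact ⟨h, h1, h2, by simp [h1, h2]⟩
    · right; right; exact ⟨h, h1, h2, by simp [h1, h2, uac_one]⟩

lemma idx_lt1 {g : ℕ} (j : Fin (g+1)) : 2 * (j:ℕ) < 2 * (g+1) := by omega
lemma idx_lt2 {g : ℕ} (j : Fin (g+1)) : 2 * (j:ℕ) + 1 < 2 * (g+1) := by omega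

lemma puΦ_mem (g : ℕ) (c : ℝ) (j : Fin (g+1)) {s θ : ℝ} (hs : s ∈ Set.Icc (0:ℝ) 1) (hθ : θ ∈ Set.Icc (0:ℝ) 4) :
    puΦ g c j s θ ∈ Gr (2 * (g+1)) := by
  rcases puΦ_cases g c j hs hθ with ⟨-, h⟩ | ⟨-, -, -, h⟩ | ⟨-, -, -, h⟩ | ⟨-, -, -, h⟩ <;> rw [h]
  · exact single_mem_Gr (idx_lt1 j) (vf_mem hθ)
  · exact single_mem_Gr (idx_lt2 j) (Af_mem _ _)
  · exact single_mem_Gr (idx_lt2 (j+1)) (Bf_mem _ _)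
  · exact single_mem_Gr (idx_lt1 j) (vf_mem hθ)

/-- second stage of the deformation, in charts -/
def st2 (g : ℕ) (c : ℝ) (j : Fin (g+1)) (τ : I) (s θ : ℝ) : Mg (g+1) :=
  if uf s θ < c then mpt g (s + τ * (1 - s)) (4 * (j:ℕ) + betC θ) else
    mq g (toD (((1 - τ : ℝ) : ℂ) * ((s : ℂ) * EE (g+1) (4 * (j:ℕ) + betR θ)) + ((τ : ℝ) : ℂ) * fR (g+1) j s θ))

lemma fR_A {G j : ℕ} {s θ : ℝ} (hB : Bf s θ = 0) (hv : vf s θ = 0) : fR G j s θ = ct G (EE G (4 * j)) (Af s θ) := by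
  unfold fR; rw [hB, hv, ct_zero]; simp; try ring
lemma fR_B {G j : ℕ} {s θ : ℝ} (hA : Af s θ = 0) (hv : vf s θ = 0) : fR G j s θ = ct G (EE G (4 * j + 4)) (Bf s θ) := by
  unfold fR; rw [hA, hv, ct_zero]; simp; try ring
lemma fR_v {G j : ℕ} {s θ : ℝ} (hA : Af s θ = 0) (hB : Bf s θ = 1) : fR G j s θ = EE G (4 * j + 4 - vf s θ) := by
  unfold fR; rw [hA, hB, ct_zero, ct_one]; ring

lemma st2_one (g : ℕ) {c : ℝ} (hc : c < 1/4) (j : Fin (g+1)) {s θ : ℝ} (hs : s ∈ Set.Icc (0:ℝ) 1) (hθ : θ ∈ Set.Icc (0:ℝ) 4) :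
    hG g (puΦ g c j s θ) = st2 g c j 1 s θ := by
  unfold st2
  rcases puΦ_cases g c j hs hθ with ⟨hu, h⟩ | ⟨hu, h1, h2, h⟩ | ⟨hu, h1, h2, h⟩ | ⟨hu, h1, h2, h⟩ <;> rw [h]
  · rw [if_pos hu, hG_single g (idx_lt1 j) (vf_mem hθ), lpG_even, (cap_facts hs hθ hc hu).2.2]
    simp [betC]
  · rw [if_neg hu, hG_single g (idx_lt2 j) (Af_mem _ _), lpG_odd, fR_A h1 h2]; simp
  · rw [if_neg hu, hG_single g (idx_lt2 (j+1)) (Bf_mem _ _), lpG_odd, fR_B h1 h2, EE_succ]; simp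
  · rw [if_neg hu, hG_single g (idx_lt1 j) (vf_mem hθ), lpG_even, fR_v h1 h2, glue3 g j (vf_mem hθ), mpt_one]
    simp
    congr 3; ring

lemma MI_hom (g : ℕ) {a b : ℝ} (ha : 0 < a) (hab : a < b) (hb : b < 1/4) (pu : Mg (g+1) → ℕ → UnitAddCircle)
    (hpu : ∀ j : Fin (g+1), ∀ s ∈ Set.Icc (0:ℝ) 1, ∀ θ ∈ Set.Icc (0:ℝ) 4, pu (mpt g s (4 * (j:ℕ) + θ)) = puΦ g ((a+b)/2) j s θ) :
    HomOn (MI g a b) id (fun x => hG g (pu x)) := by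
  set c := (a + b)/2 with hcdef
  have hc0 : 0 < c := by rw [hcdef]; linarith
  have hc : c < 1/4 := by rw [hcdef]; linarith
  have hne : ∀ j : Fin (g+1), ∀ p ∈ {p : I × ℝ × ℝ | p.2.1 ∈ Set.Icc (0:ℝ) 1 ∧ p.2.2 ∈ Set.Icc (0:ℝ) 4 ∧ mpt g p.2.1 (4 * (j:ℕ) + p.2.2) ∈ MI g a b},
      uf p.2.1 p.2.2 ≠ c := fun j p hp => MI_ne ha hab hb j hp.1 hp.2.1 hp.2.2
  have huc : Continuous (fun p : I × ℝ × ℝ => uf p.2.1 p.2.2) := uf_cont.comp continuous_snd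
  set bet : ℝ → ℝ → ℝ := fun s θ => if uf s θ < c then betC θ else betR θ with hbet
  set st1 : Fin (g+1) → I → ℝ → ℝ → Mg (g+1) := fun j τ s θ => mpt g s (4 * (j:ℕ) + ((1 - τ) * θ + τ * bet s θ)) with hst1
  -- consistency of the first stage
  have c0 : ∀ j τ, ∀ θ ∈ Set.Icc (0:ℝ) 4, st1 j τ 0 θ = mpt g 0 0 := by
    intro j τ θ hθ
    simp only [hst1]
    unfold mpt; congr 1; apply Subtype.ext; simp [dpt_val]
  have c1 : ∀ j τ, ∀ s ∈ Set.Icc (0:ℝ) 1, st1 j τ s 4 = st1 (j+1) τ s 0 := by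
    intro j τ s hs
    simp only [hst1, hbet]
    rw [(side0 s).1, (side4 s).1, if_neg (by linarith), if_neg (by linarith), (side0 s).2.2.1, (side4 s).2.2.1]
    rw [mpt_eq_toD g hs, mpt_eq_toD g hs]
    have e1 : 4 * (j:ℕ) + ((1 - (τ:ℝ)) * 4 + τ * 4) = 4 * (j:ℕ) + 4 := by ring
    have e2 : 4 * ((j+1 : Fin (g+1)):ℕ) + ((1 - (τ:ℝ)) * 0 + τ * 0) = 4 * ((j+1 : Fin (g+1)):ℕ) := by ring
    rw [e1, e2, EE_succ]
  have c2 : ∀ j τ, ∀ t ∈ Set.Icc (0:ℝ) 1, st1 j τ 1 t = st1 j τ 1 (3 - t) := by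
    intro j τ t ht
    simp only [hst1, hbet]
    have hτ := τ.2
    obtain ⟨h1, h2, h3, h4, h5⟩ := bdry2 ht
    rw [← h1]
    by_cases h : uf 1 t < c
    · rw [if_pos h, if_pos h, h4, h5, glue2]
      · congr 2; ring
      · constructor <;> nlinarith [hτ.1, hτ.2, ht.1, ht.2]
    · obtain ⟨k1, k2, k3, k4, k5, k6, k7⟩ := bdry2R ht hc0 h
      rw [if_neg h, if_neg h, k6, k7, glue2]
      · congr 2; ring
      · constructor <;> nlinarith [hτ.1, hτ.2, ht.1, ht.2]
  have c3 : ∀ j τ, ∀ t ∈ Set.Icc (0:ℝ) 1, st1 j τ 1 (1 + t) = st1 j τ 1 (4 - t) := by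
    intro j τ t ht
    simp only [hst1, hbet]
    obtain ⟨h1, h2, h3, h4, h5, h6, h7, h8⟩ := bdry3 ht
    rw [h1, h2, if_pos hc0, if_neg (by linarith), h5, h6]
    have e1 : (1 - (τ:ℝ)) * (1 + t) + τ * (1 + t) = 1 + t := by ring
    have e2 : (1 - (τ:ℝ)) * (4 - t) + τ * (4 - t) = 4 - t := by ring
    rw [e1, e2, glue3 g j ht]
  obtain ⟨f1, hf1⟩ := Mlift g (fun j s θ => st1 j 1 s θ) (mpt g 0 0) (fun j => c0 j 1) (fun j => c1 j 1) (fun j => c2 j 1) (fun j => c3 j 1)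
  have H1 : HomOn (MI g a b) id f1 := by
    refine Mlift_hom g (MI_open g a b) st1 (fun _ => mpt g 0 0) c0 c1 c2 c3 ?_ _ _ ?_ ?_
    · intro j
      have hb : ContinuousOn (fun p : I × ℝ × ℝ => bet p.2.1 p.2.2) {p : I × ℝ × ℝ | p.2.1 ∈ Set.Icc (0:ℝ) 1 ∧ p.2.2 ∈ Set.Icc (0:ℝ) 4 ∧ mpt g p.2.1 (4 * (j:ℕ) + p.2.2) ∈ MI g a b} :=
        contOn_ite_gap huc.continuousOn (hne j) (by fun_prop) (by fun_prop)
      refine (mpt_cont g).comp_continuousOn (f := fun p : I × ℝ × ℝ => (p.2.1, 4 * ((j:ℕ):ℝ) + ((1 - (p.1:ℝ)) * p.2.2 + (p.1:ℝ) * bet p.2.1 p.2.2))) ?_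
      refine ContinuousOn.prodMk (by fun_prop) (continuousOn_const.add (ContinuousOn.add (by fun_prop) (ContinuousOn.mul (by fun_prop) hb)))
    · intro j s hs θ hθ _
      simp [hst1]
    · intro j s hs θ hθ _
      exact hf1 j s hs θ hθ
  refine H1.trans ?_
  refine Mlift_hom g (MI_open g a b) (st2 g c) 
    (fun τ => mq g (toD (((τ : ℝ) : ℂ) * EE (g+1) 0))) ?_ ?_ ?_ ?_ ?_ _ _ ?_ ?_
  · intro j τ θ hθ
    unfold st2
    obtain ⟨h1, h2, h3, h4⟩ := centre0 θ
    rw [h1, if_neg (by linarith), fR_A h4 h2, h3, ct_zero]; simp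
  · intro j τ s hs
    unfold st2
    obtain ⟨h1, h2, h3, h4, h5⟩ := side0 s
    obtain ⟨k1, k2, k3, k4, k5⟩ := side4 s
    rw [h1, k1, if_neg (by linarith), if_neg (by linarith), fR_B k4 k2, fR_A h5 h2, h3, k3, h4, k5, EE_succ]
    simp [EE_succ]
  · intro j τ t ht
    unfold st2
    obtain ⟨h1, h2, h3, h4, h5⟩ := bdry2 ht
    rw [← h1]
    by_cases h : uf 1 t < c
    · rw [if_pos h, if_pos h, h4, h5]
      have a1 := corner g j 1 (by norm_num)
      have a2 := corner g j 2 (by norm_num)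
      simp only [Nat.cast_one, Nat.cast_ofNat] at a1 a2
      simp [a1, a2]
    · obtain ⟨k1, k2, k3, k4, k5, k6, k7⟩ := bdry2R ht hc0 h
      rw [if_neg h, if_neg h, k6, k7, fR_A k3 h2, k2, fR_v k4 k5, ct_one, h3]
      have a1 := corner g j 0 (by norm_num)
      have a2 := corner g j 3 (by norm_num)
      rw [mpt_one] at a1 a2
      simp only [Nat.cast_zero, Nat.cast_ofNat] at a1 a2
      have e1 : (4 * ((j:ℕ):ℝ) + 4 - 1) = 4 * (j:ℕ) + 3 := by ring
      rw [e1]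
      have e2 : ∀ z : ℂ, ((1 - (τ:ℝ) : ℝ) : ℂ) * (((1:ℝ):ℂ) * z) + ((τ:ℝ):ℂ) * z = z := by intro z; push_cast; ring
      rw [add_zero] at a1 ⊢
      rw [e2, e2, a1, a2]
  · intro j τ t ht
    unfold st2
    obtain ⟨h1, h2, h3, h4, h5, h6, h7, h8⟩ := bdry3 ht
    rw [h1, h2, if_pos hc0, if_neg (by linarith), h5, h6, fR_v h7 h8, h4]
    have e1 : (4 * ((j:ℕ):ℝ) + (4 - t)) = 4 * (j:ℕ) + 4 - t := by ring
    have e2 : ∀ z : ℂ, ((1 - (τ:ℝ) : ℝ) : ℂ) * (((1:ℝ):ℂ) * z) + ((τ:ℝ):ℂ) * z = z := by intro z; push_cast; ring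
    have := glue3 g j ht
    rw [e1] at this
    rw [e1, e2, ← mpt_one, ← this]
    simp
  · intro j
    refine contOn_ite_gap (f1 := fun p : I × ℝ × ℝ => mpt g (p.2.1 + p.1 * (1 - p.2.1)) (4 * (j:ℕ) + betC p.2.2)) huc.continuousOn (hne j) ?_ ?_
    · refine Continuous.continuousOn ?_
      exact (mpt_cont g).comp (f := fun p : I × ℝ × ℝ => (p.2.1 + (p.1:ℝ) * (1 - p.2.1), 4 * ((j:ℕ):ℝ) + betC p.2.2)) (by fun_prop)
    · refine Continuous.continuousOn ?_
      refine (mq_cont g).comp (toD_cont.comp ?_)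
      have h1 : Continuous (fun p : I × ℝ × ℝ => fR (g+1) j p.2.1 p.2.2) := (fR_cont (g+1) j).comp continuous_snd
      fun_prop
  · intro j s hs θ hθ _
    rw [hf1 j s hs θ hθ]
    simp only [hst1, hbet, st2]
    split_ifs with h
    · simp
    · rw [mpt_eq_toD g hs]; simp
  · intro j s hs θ hθ _
    show hG g (pu _) = _
    rw [hpu j s hs θ hθ, st2_one g hc j hs hθ]

end LSP

namespace LSP
set_option linter.all false
set_option autoImplicit false
open Topology

def IsPu (g : ℕ) (a b : ℝ) (pu : Mg (g+1) → ℕ → UnitAddCircle) : Prop :=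
  ∀ j : Fin (g+1), ∀ s ∈ Set.Icc (0:ℝ) 1, ∀ θ ∈ Set.Icc (0:ℝ) 4, pu (mpt g s (4 * (j:ℕ) + θ)) = puΦ g ((a+b)/2) j s θ

lemma single_cont (i : ℕ) : Continuous (fun t : UnitAddCircle => (Pi.single i t : ℕ → UnitAddCircle)) := by
  refine continuous_pi (fun k => ?_)
  by_cases h : k = i
  · subst h; simp only [Pi.single_eq_same]; exact continuous_id
  · simp only [Pi.single_eq_of_ne h]; exact continuous_const

lemma IsPu.cont {g : ℕ} {a b : ℝ} (ha : 0 < a) (hab : a < b) (hb : b < 1/4) {pu} (h : IsPu g a b pu) : ContinuousOn pu (MI g a b) := by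
  refine Mlift_contOn g (MI_open g a b) pu (puΦ g ((a+b)/2)) (fun j s hs θ hθ _ => h j s hs θ hθ) (fun j => ?_)
  have hv := fun i : ℕ => ((single_cont i).comp (uac_coe_cont.comp vf_cont))
  have hA := fun i : ℕ => ((single_cont i).comp (uac_coe_cont.comp Af_cont))
  have hB := fun i : ℕ => ((single_cont i).comp (uac_coe_cont.comp Bf_cont))
  refine contOn_ite_gap (c := (a+b)/2) (u := fun p : ℝ × ℝ => uf p.1 p.2) 
    (f1 := fun p : ℝ × ℝ => (Pi.single (2 * (j:ℕ)) ((vf p.1 p.2 : ℝ) : UnitAddCircle) : ℕ → UnitAddCircle))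
    (f2 := fun p : ℝ × ℝ => (Pi.single (2 * (j:ℕ)) ((vf p.1 p.2 : ℝ) : UnitAddCircle) + Pi.single (2 * (j:ℕ) + 1) ((Af p.1 p.2 : ℝ) : UnitAddCircle) +
      Pi.single (2 * ((j+1 : Fin (g+1)):ℕ) + 1) ((Bf p.1 p.2 : ℝ) : UnitAddCircle) : ℕ → UnitAddCircle))
    uf_cont.continuousOn (fun (p : ℝ × ℝ) (hp : p.1 ∈ Set.Icc (0:ℝ) 1 ∧ p.2 ∈ Set.Icc (0:ℝ) 4 ∧ mpt g p.1 (4 * (j:ℕ) + p.2) ∈ MI g a b) => MI_ne ha hab hb j hp.1 hp.2.1 hp.2.2) 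
    (hv _).continuousOn ?_
  exact (((hv _).add (hA _)).add (hB _)).continuousOn

lemma IsPu.mem {g : ℕ} {a b : ℝ} {pu} (h : IsPu g a b pu) (x : Mg (g+1)) : pu x ∈ Gr (2 * (g+1)) := by
  obtain ⟨j, s, θ, hs, hθ, rfl⟩ := mpt_surj g x
  rw [h j s hs θ hθ]; exact puΦ_mem g _ j hs hθ

lemma IsPu.even {g : ℕ} {a b : ℝ} {pu} (h : IsPu g a b pu) (x : Mg (g+1)) (i : Fin (g+1)) : pu x (2 * (i:ℕ)) = vG g i x := by
  obtain ⟨j, s, θ, hs, hθ, rfl⟩ := mpt_surj g x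
  rw [h j s hs θ hθ, vG_eq g i j hs hθ]
  unfold puΦ
  have e1 : ∀ k : ℕ, ∀ z : UnitAddCircle, (Pi.single (2 * k + 1) z : ℕ → UnitAddCircle) (2 * (i:ℕ)) = 0 := by
    intro k z
    exact Pi.single_eq_of_ne (by omega) _
  have e2 : ∀ z : UnitAddCircle, (Pi.single (2 * (j:ℕ)) z : ℕ → UnitAddCircle) (2 * (i:ℕ)) = if j = i then z else 0 := by
    intro z
    split_ifs with hh
    · rw [hh]; simp
    · exact Pi.single_eq_of_ne (by intro h; apply hh; apply Fin.ext; omega) _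
  by_cases hu : uf s θ < (a+b)/2
  · rw [if_pos hu, e2]
  · rw [if_neg hu, Pi.add_apply, Pi.add_apply, e1, e1, e2]; simp

lemma pu_feat (g : ℕ) (x : Mg (g+1)) : ∃ r : ℝ, ∀ a b, 0 < a → ∀ pu, IsPu g a b pu → r ∉ Set.Icc a b → ∀ i, ‖pu x i‖ ∉ Set.Icc a b := by
  obtain ⟨j, s, θ, hs, hθ, rfl⟩ := mpt_surj g x
  refine ⟨‖((vf s θ : ℝ) : UnitAddCircle)‖ + ‖((Af s θ : ℝ) : UnitAddCircle)‖ + ‖((Bf s θ : ℝ) : UnitAddCircle)‖, ?_⟩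
  intro a b ha pu hpu hr i
  rw [hpu j s hs θ hθ]
  have key : ∀ (k : ℕ) (z : UnitAddCircle), (z = 0 ∨ ‖z‖ = ‖((vf s θ : ℝ) : UnitAddCircle)‖ + ‖((Af s θ : ℝ) : UnitAddCircle)‖ + ‖((Bf s θ : ℝ) : UnitAddCircle)‖) → 
      ‖(Pi.single k z : ℕ → UnitAddCircle) i‖ ∉ Set.Icc a b := by
    intro k z hz
    have h0 : (0:ℝ) ∉ Set.Icc a b := fun h => by linarith [h.1]
    by_cases hk : i = k
    · subst hk
      rw [Pi.single_eq_same]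
      rcases hz with rfl | hz
      · simpa using h0
      · rw [hz]; exact hr
    · rw [Pi.single_eq_of_ne hk]; simpa using h0
  rcases puΦ_cases g ((a+b)/2) j hs hθ with ⟨hu, h⟩ | ⟨hu, h1, h2, h⟩ | ⟨hu, h1, h2, h⟩ | ⟨hu, h1, h2, h⟩ <;> rw [h]
  · apply key
    rcases tri hs hθ with ⟨h1, h2⟩ | ⟨h1, h2⟩ | ⟨h1, h2⟩
    · left; simp [h2]
    · left; simp [h2]
    · right; simp [h1, h2, uac_one]
  · apply key; right; simp [h1, h2]
  · apply key; right; simp [h1, h2]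
  · apply key; right; simp [h1, h2, uac_one]

lemma exists_isPu (g : ℕ) {a b : ℝ} (ha : 0 < a) (hab : a < b) (hb : b < 1/4) : ∃ pu, IsPu g a b pu :=
  exists_pu g (by linarith) (by linarith)

lemma IsPu.hom {g : ℕ} {a b : ℝ} (ha : 0 < a) (hab : a < b) (hb : b < 1/4) {pu} (h : IsPu g a b pu) :
    HomOn (MI g a b) id (fun x => hG g (pu x)) := MI_hom g ha hab hb pu h

end LSP

namespace LSP
set_option linter.all false
set_option autoImplicit false
open Topology

/-! ### The merging homotopy on symmetric products of bouquets -/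

lemma spMk_partial {n : ℕ} {X : Type*} [TopologicalSpace X] {P : X} {s t : Fin n → X} {A B : Fin n → Prop} 
    (φ : {l // A l} ≃ {l // B l}) (h : ∀ a, t (φ a) = s a) (hs : ∀ l, ¬ A l → s l = P) (ht : ∀ l, ¬ B l → t l = P) :
    (spMk s : SP n X) = spMk t := by
  classical
  refine (spMk_eq.2 ⟨φ.extendSubtype, ?_⟩).symm
  funext l
  by_cases hl : A l
  · rw [Function.comp_apply, Equiv.extendSubtype_apply_of_mem _ _ hl, h]
  · rw [Function.comp_apply, ht _ (Equiv.extendSubtype_not_mem _ _ hl), hs l hl]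

lemma sum_cl (m : ℕ) {y : ℝ} (hy : 0 ≤ y) : ∑ i ∈ Finset.range m, cl (y - i) = min y m := by
  induction m with
  | zero => simp [hy]
  | succ m ih =>
    rw [Finset.sum_range_succ, ih]
    push_cast
    rcases le_total y m with h | h
    · rw [cl_of_nonpos (by linarith), min_eq_left h, min_eq_left (by linarith)]; ring
    · rw [min_eq_right h]
      rcases le_total y (m+1) with h' | h'
      · rw [cl_of_mem ⟨by linarith, by linarith⟩, min_eq_left h']; ring
      · rw [cl_of_one_le (by linarith), min_eq_right h']

/-- partial sums of the `i`-th coordinates -/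
def Tf {n : ℕ} (y : Fin n → ℝ) (i : ℕ) (l : Fin n) : ℝ := ∑ l', if l' ≤ l then cl (y l' - i) else cl (y l' - i) - 1

lemma Tf_low {n : ℕ} {y : Fin n → ℝ} (hy : Monotone y) {i : ℕ} {l : Fin n} (h : y l ≤ i) : Tf y i l ≤ 0 := by
  unfold Tf
  refine Finset.sum_nonpos fun l' _ => ?_
  split_ifs with h'
  · rw [cl_of_nonpos]; linarith [hy h']
  · linarith [cl_le_one (y l' - i)]

lemma Tf_high {n : ℕ} {y : Fin n → ℝ} (hy : Monotone y) {i : ℕ} {l : Fin n} (h : (i:ℝ) + 1 ≤ y l) : 1 ≤ Tf y i l := by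
  unfold Tf
  have h1 : (1:ℝ) = if l ≤ l then cl (y l - i) else cl (y l - i) - 1 := by
    rw [if_pos le_rfl, cl_of_one_le (by linarith)]
  refine h1.le.trans ?_
  refine Finset.single_le_sum (f := fun l' => if l' ≤ l then cl (y l' - i) else cl (y l' - i) - 1) (fun l' _ => ?_) (Finset.mem_univ l)
  show 0 ≤ if l' ≤ l then cl (y l' - i) else cl (y l' - i) - 1
  split_ifs with h'
  · exact cl_nonneg _
  · rw [cl_of_one_le]; · norm_num
    linarith [hy (not_le.1 h').le]

lemma Tf_eq {n : ℕ} (y : Fin n → ℝ) (i : ℕ) (l : Fin n) : Tf y i l = (∑ l', cl (y l' - i)) - ((n - 1 - (l:ℕ) : ℕ) : ℝ) := by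
  unfold Tf
  have : ∀ l' : Fin n, (if l' ≤ l then cl (y l' - i) else cl (y l' - i) - 1) = cl (y l' - i) - if l < l' then 1 else 0 := by
    intro l'
    by_cases h : l' ≤ l
    · rw [if_pos h, if_neg (not_lt.2 h)]; ring
    · rw [if_neg h, if_pos (not_le.1 h)]
  simp only [this]
  rw [Finset.sum_sub_distrib]
  congr 1
  rw [Finset.sum_boole]
  congr 1
  have : (Finset.univ.filter (fun l' => l < l')) = Finset.Ioi l := by ext; simp
  rw [this, Fin.card_Ioi]

lemma Tf_cont {n : ℕ} (i : ℕ) (l : Fin n) : Continuous (fun y : Fin n → ℝ => Tf y i l) := by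
  simp only [Tf_eq]
  fun_prop

structure ROk (r : ℕ → ℝ → ℝ) : Prop where
  cont : ∀ i, Continuous (r i)
  low : ∀ i, ∀ T ≤ 0, r i T = 0
  high : ∀ i T, 1 ≤ T → r i T = 1

/-- moving tuples -/
def zf {n : ℕ} (m : ℕ) (r : ℕ → ℝ → ℝ) (lam : ℝ) (y : Fin n → ℝ) (l : Fin n) : ℝ := 
  y l + lam * ∑ i ∈ Finset.range m, (r i (Tf y i l) - cl (y l - i))

lemma zf_cont {n : ℕ} (m : ℕ) {r : ℕ → ℝ → ℝ} (hr : ROk r) (l : Fin n) : Continuous (fun p : ℝ × (Fin n → ℝ) => zf m r p.1 p.2 l) := by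
  unfold zf
  refine Continuous.add (by fun_prop) (Continuous.mul (by fun_prop) ?_)
  refine continuous_finsetSum _ fun i _ => ?_
  refine Continuous.sub ?_ (by fun_prop)
  exact (hr.cont i).comp ((Tf_cont i l).comp continuous_snd)

lemma zf_nat {n m : ℕ} {r : ℕ → ℝ → ℝ} (hr : ROk r) (lam : ℝ) {y : Fin n → ℝ} (hy : Monotone y) {l : Fin n} {k : ℕ} (h : y l = k) : 
    zf m r lam y l = k := by
  unfold zf
  rw [Finset.sum_eq_zero, h]; · simp
  intro i _
  rcases Nat.lt_or_ge i k with hk | hk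
  · have : (i:ℝ) + 1 ≤ y l := by rw [h]; exact_mod_cast hk
    rw [hr.high i _ (Tf_high hy this), cl_of_one_le (by linarith)]; ring
  · have : y l ≤ i := by rw [h]; exact_mod_cast hk
    rw [hr.low i _ (Tf_low hy this), cl_of_nonpos (by linarith)]; ring

lemma zf_int {n m : ℕ} {r : ℕ → ℝ → ℝ} (hr : ROk r) (lam : ℝ) {y : Fin n → ℝ} (hy : Monotone y) {l : Fin n} {k : ℕ} (hkm : k < m)
    (h1 : (k:ℝ) ≤ y l) (h2 : y l ≤ k + 1) : 
    zf m r lam y l = y l + lam * (r k (Tf y k l) - (y l - k)) := by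
  unfold zf
  rw [Finset.sum_eq_single k]
  · rw [cl_of_mem (x := y l - k) ⟨by linarith, by linarith⟩]
  · intro i _ hik
    rcases lt_or_gt_of_ne hik with hk | hk
    · have : (i:ℝ) + 1 ≤ k := by exact_mod_cast hk
      rw [hr.high i _ (Tf_high hy (by linarith)), cl_of_one_le (by linarith)]; ring
    · have : (k:ℝ) + 1 ≤ i := by exact_mod_cast hk
      rw [hr.low i _ (Tf_low hy (by linarith)), cl_of_nonpos (by linarith)]; ring
  · intro h; exact absurd (Finset.mem_range.2 hkm) h

/-- sorted tuples -/
def KK (n m : ℕ) : Set (Fin n → ℝ) := {y | Monotone y ∧ ∀ l, y l ∈ Set.Icc (0:ℝ) m}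

def NN (x : ℝ) : Prop := ∀ k : ℕ, x ≠ k

lemma exists_block {m : ℕ} {x : ℝ} (hx : x ∈ Set.Icc (0:ℝ) m) (h : NN x) : ∃ k < m, (k:ℝ) < x ∧ x < k + 1 := by
  refine ⟨⌊x⌋₊, ?_, ?_, Nat.lt_floor_add_one x⟩
  · rw [Nat.floor_lt hx.1]; exact lt_of_le_of_ne hx.2 (h m)
  · exact lt_of_le_of_ne (Nat.floor_le hx.1) (h ⌊x⌋₊).symm

lemma Tf_sub {n : ℕ} {y : Fin n → ℝ} (hy : Monotone y) {i : ℕ} {l : Fin n} (h1 : (i:ℝ) < y l) (h2 : y l < i + 1) :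
    ∀ l', ¬ NN (y l') → (if l' ≤ l then cl (y l' - i) else cl (y l' - i) - 1) = 0 := by
  intro l' hl'
  simp only [NN, not_forall, not_not] at hl'
  obtain ⟨k, hk⟩ := hl'
  split_ifs with h
  · have := hy h
    have h3 : (k:ℝ) < (i+1:ℕ) := by push_cast; linarith
    have h4 : (k:ℝ) ≤ i := by have : k < i+1 := by exact_mod_cast h3
                              exact_mod_cast (by omega : k ≤ i)
    exact cl_of_nonpos (by linarith)
  · have := hy (not_le.1 h).le
    have h3 : (i:ℝ) < k := by linarith
    have h4 : (i:ℝ) + 1 ≤ k := by have : i < k := by exact_mod_cast h3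
                                  exact_mod_cast this
    rw [cl_of_one_le (by linarith)]; ring

lemma KK_iso {n m : ℕ} {y y' : Fin n → ℝ} (hy : y ∈ KK n m) (hy' : y' ∈ KK n m) 
    (h : (spMk (piG ∘ y) : SP n (ℕ → UnitAddCircle)) = spMk (piG ∘ y')) :
    ∃ φ : {l // NN (y l)} ≃o {l // NN (y' l)}, ∀ a, y' (φ a) = y a := by
  classical
  obtain ⟨e, he⟩ := spMk_eq.1 h
  have he' : ∀ l, piG (y (e l)) = piG (y' l) := fun l => congrFun he l
  have k1 : ∀ l, NN (y' l) → y (e l) = y' l := fun l hl => piG_eq_of_not_nat (hy'.2 l).1 hl (he' l).symm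
  have k2 : ∀ l, NN (y (e l)) → y (e l) = y' l := fun l hl => (piG_eq_of_not_nat (hy.2 _).1 hl (he' l)).symm
  let S : Finset (Fin n) := Finset.univ.filter (fun l => NN (y l))
  let S' : Finset (Fin n) := Finset.univ.filter (fun l => NN (y' l))
  have hcard : S.card = S'.card := by
    symm
    refine Finset.card_bij (fun l _ => e l) ?_ (fun a _ b _ h => e.injective h) ?_
    · intro l hl
      simp only [S, S', Finset.mem_filter, Finset.mem_univ, true_and] at hl ⊢
      rw [k1 l hl]; exact hl
    · intro l hl
      simp only [S, S', Finset.mem_filter, Finset.mem_univ, true_and] at hl ⊢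
      refine ⟨e.symm l, ?_, by simp⟩
      rw [← k2 _ (by simpa using hl)]; simpa using hl
  let ε : Fin S.card ≃o S := S.orderIsoOfFin rfl
  let ε' : Fin S.card ≃o S' := S'.orderIsoOfFin hcard.symm
  have m1 : ∀ l, l ∈ S ↔ NN (y l) := by intro l; simp [S]
  have m2 : ∀ l, l ∈ S' ↔ NN (y' l) := by intro l; simp [S']
  have em : ∀ a : S', e a ∈ S := fun a => by
    rw [m1, k1 _ ((m2 _).1 a.2)]; exact (m2 _).1 a.2
  have em' : ∀ a : S, e.symm a ∈ S' := fun a => by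
    have ha := (m1 _).1 a.2
    rw [m2, ← k2 _ (by simpa using ha)]; simpa using ha
  let π : Equiv.Perm (Fin S.card) := 
    { toFun := fun q => ε.symm ⟨e (ε' q), em _⟩
      invFun := fun q => ε'.symm ⟨e.symm (ε q), em' _⟩
      left_inv := fun q => by simp
      right_inv := fun q => by simp }
  have hπ : ∀ q, y' (ε' q) = y (ε (π q)) := by
    intro q
    simp only [π, Equiv.coe_fn_mk, OrderIso.apply_symm_apply]
    exact (k1 _ ((m2 _).1 (ε' q).2)).symm
  have mono1 : Monotone ((fun q => y (ε q)) ∘ (1 : Equiv.Perm (Fin S.card))) := fun q q' h => hy.1 (ε.monotone h)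
  have mono2 : Monotone ((fun q => y (ε q)) ∘ π) := by
    intro q q' h
    simp only [Function.comp_apply]
    rw [← hπ, ← hπ]
    exact hy'.1 (ε'.monotone h)
  have hu := Tuple.unique_monotone mono1 mono2
  have hq : ∀ q, y' (ε' q) = y (ε q) := by
    intro q
    have := congrFun hu q
    simp only [Function.comp_apply, Equiv.Perm.coe_one, id_eq] at this
    rw [hπ, ← this]
  let i1 : {l // NN (y l)} ≃o S := 
    { toFun := fun a => ⟨a, (m1 _).2 a.2⟩, invFun := fun a => ⟨a, (m1 _).1 a.2⟩, left_inv := fun a => rfl, right_inv := fun a => rfl, 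
      map_rel_iff' := Iff.rfl }
  let i2 : {l // NN (y' l)} ≃o S' := 
    { toFun := fun a => ⟨a, (m2 _).2 a.2⟩, invFun := fun a => ⟨a, (m2 _).1 a.2⟩, left_inv := fun a => rfl, right_inv := fun a => rfl, 
      map_rel_iff' := Iff.rfl }
  refine ⟨((i1.trans ε.symm).trans ε').trans i2.symm, fun a => ?_⟩
  have := hq (ε.symm (i1 a))
  rw [OrderIso.apply_symm_apply] at this
  exact this

lemma Tf_iso {n m : ℕ} {y y' : Fin n → ℝ} (hy : y ∈ KK n m) (hy' : y' ∈ KK n m) 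
    (φ : {l // NN (y l)} ≃o {l // NN (y' l)}) (hφ : ∀ a, y' (φ a) = y a) (a : {l // NN (y l)}) {i : ℕ} (h1 : (i:ℝ) < y a) (h2 : y a < i + 1) :
    Tf y i a = Tf y' i (φ a) := by
  classical
  unfold Tf
  have e1 : ∀ (y : Fin n → ℝ) (w : Fin n → ℝ), (∀ l, ¬ NN (y l) → w l = 0) → ∑ l, w l = ∑ a : {l // NN (y l)}, w a := by
    intro y w hw
    rw [← Finset.sum_subtype (Finset.univ.filter (fun l => NN (y l))) (by simp) w]
    exact Finset.sum_filter_of_ne (fun l _ hl => by by_contra hh; exact hl (hw l hh)) |>.symm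
  rw [e1 y _ (Tf_sub hy.1 h1 h2), e1 y' _ (Tf_sub hy'.1 (by rw [hφ]; exact h1) (by rw [hφ]; exact h2))]
  rw [← Equiv.sum_comp φ.toEquiv]
  refine Finset.sum_congr rfl fun b _ => ?_
  show _ = (if ((φ b : {l // NN (y' l)}) : Fin n) ≤ φ a then cl (y' (φ b) - i) else cl (y' (φ b) - i) - 1)
  have : ((φ b : {l // NN (y' l)}) : Fin n) ≤ φ a ↔ (b : Fin n) ≤ a := by
    rw [Subtype.coe_le_coe, Subtype.coe_le_coe]; exact φ.le_iff_le
  simp only [this, hφ]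

lemma zf_wd {n m : ℕ} {X : Type*} [TopologicalSpace X] {P : X} {hh : ℝ → X} (hP : ∀ k : ℕ, hh k = P) {r : ℕ → ℝ → ℝ} (hr : ROk r) (lam : ℝ)
    {y y' : Fin n → ℝ} (hy : y ∈ KK n m) (hy' : y' ∈ KK n m) 
    (h : (spMk (piG ∘ y) : SP n (ℕ → UnitAddCircle)) = spMk (piG ∘ y')) : 
    (spMk (hh ∘ zf m r lam y) : SP n X) = spMk (hh ∘ zf m r lam y') := by
  obtain ⟨φ, hφ⟩ := KK_iso hy hy' h
  have hz : ∀ y : Fin n → ℝ, Monotone y → ∀ l, ¬ NN (y l) → (hh ∘ zf m r lam y) l = P := by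
    intro y hy l hl
    simp only [NN, not_forall, not_not] at hl
    obtain ⟨k, hk⟩ := hl
    rw [Function.comp_apply, zf_nat hr lam hy hk, hP]
  refine spMk_partial φ.toEquiv (fun a => ?_) (hz y hy.1) (hz y' hy'.1)
  obtain ⟨k, hkm, h1, h2⟩ := exists_block (hy.2 a) a.2
  show hh (zf m r lam y' (φ a)) = hh (zf m r lam y a)
  rw [zf_int hr lam hy.1 hkm h1.le h2.le, zf_int hr lam hy'.1 hkm (by rw [hφ]; exact h1.le) (by rw [hφ]; exact h2.le), 
    Tf_iso hy hy' φ hφ a h1 h2, hφ]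

end LSP

namespace LSP
set_option linter.all false
set_option autoImplicit false
open Topology

def qK {n m : ℕ} (y : KK n m) : SP n (Gr m) := spMk (fun l => ⟨piG (y.1 l), ⟨_, y.2.2 l, rfl⟩⟩)

lemma KK_closed (n m : ℕ) : IsClosed (KK n m) := by
  have : KK n m = (⋂ l, ⋂ l', ⋂ (_ : l ≤ l'), {y | y l ≤ y l'}) ∩ ⋂ l, {y | y l ∈ Set.Icc (0:ℝ) m} := by
    ext y; simp [KK, Monotone]
  rw [this]
  refine IsClosed.inter ?_ ?_
  · refine isClosed_iInter fun l => isClosed_iInter fun l' => isClosed_iInter fun _ => isClosed_le (by fun_prop) (by fun_prop)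
  · refine isClosed_iInter fun l => isClosed_Icc.preimage (by fun_prop)

lemma KK_compact (n m : ℕ) : IsCompact (KK n m) := by
  refine (isCompact_univ_pi (fun _ : Fin n => isCompact_Icc (a := (0:ℝ)) (b := m))).of_isClosed_subset (KK_closed n m) ?_
  intro y hy l _
  exact hy.2 l

lemma qK_surj {n m : ℕ} : Function.Surjective (qK : KK n m → SP n (Gr m)) := by
  intro D
  obtain ⟨x, rfl⟩ := spMk_surj D
  choose y hy hy' using fun l => (x l).2
  refine ⟨⟨y ∘ Tuple.sort y, Tuple.monotone_sort y, fun l => hy _⟩, ?_⟩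
  refine (spMk_eq.2 ⟨Tuple.sort y, ?_⟩).symm
  funext l
  exact Subtype.ext (hy' _).symm

lemma qK_quot {n m : ℕ} : IsQuotientMap (qK : KK n m → SP n (Gr m)) := by
  let j : KK n m → (Fin n → Gr m) := fun y l => ⟨piG (y.1 l), ⟨_, y.2.2 l, rfl⟩⟩
  have hj : Continuous j := by
    refine continuous_pi fun l => Continuous.subtype_mk (piG_cont.comp ?_) _
    exact (continuous_apply l).comp continuous_subtype_val
  have hc : CompactSpace (KK n m) := isCompact_iff_compactSpace.1 (KK_compact n m)
  have hq : Continuous (qK : KK n m → SP n (Gr m)) := spMk_cont.comp hj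
  refine IsClosedMap.isQuotientMap ?_ hq qK_surj
  intro C hC
  have h1 : qK '' C = spMk '' (j '' C) := by rw [Set.image_image]; rfl
  rw [h1, ← spMk_isQuotientMap.isClosed_preimage, spMk_preimage_image]
  have h2 : IsClosed (j '' C) := hj.isClosedMap C hC
  exact isClosed_iUnion_of_finite fun e => h2.preimage (permComp_cont e)

theorem merge {n m : ℕ} {X : Type*} [TopologicalSpace X] {P : X} {hh : ℝ → X} (hc : Continuous hh) (hP : ∀ k : ℕ, hh k = P) {r : ℕ → ℝ → ℝ} (hr : ROk r) :
    ∃ H : I × SP n (Gr m) → SP n X, Continuous H ∧ ∀ (τ : I) (y : KK n m), H (τ, qK y) = spMk (hh ∘ zf m r τ y.1) := by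
  have hwd : ∀ (τ : I) (y y' : KK n m), qK y = qK y' → (spMk (hh ∘ zf m r τ y.1) : SP n X) = spMk (hh ∘ zf m r τ y'.1) := by
    intro τ y y' h
    refine zf_wd hP hr τ y.2 y'.2 ?_
    exact congrArg (spMap Subtype.val) h
  let H : I × SP n (Gr m) → SP n X := fun p => spMk (hh ∘ zf m r p.1 (qK_surj p.2).choose.1)
  have hH : ∀ (τ : I) (y : KK n m), H (τ, qK y) = spMk (hh ∘ zf m r τ y.1) := by
    intro τ y
    exact hwd τ _ _ (qK_surj (qK y)).choose_spec
  refine ⟨H, ?_, hH⟩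
  refine qK_quot.continuous_lift_prod_right ?_
  simp only [hH]
  refine spMk_cont.comp (continuous_pi fun l => hc.comp ?_)
  exact (zf_cont m hr l).comp (f := fun p : I × KK n m => ((p.1:ℝ), (p.2.1 : Fin n → ℝ))) (by fun_prop)

end LSP

namespace LSP
set_option linter.all false
set_option autoImplicit false
open Topology

lemma uac_sum {n : ℕ} (f : Fin n → ℝ) : (((∑ l, f l : ℝ)) : UnitAddCircle) = ∑ l, ((f l : ℝ) : UnitAddCircle) :=
  map_sum (QuotientAddGroup.mk' (AddSubgroup.zmultiples (1:ℝ))) f Finset.univ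

lemma uac_norm {T : ℝ} (h0 : 0 ≤ T) (h1 : T ≤ 1/2) : ‖((T:ℝ) : UnitAddCircle)‖ = T := by
  rw [UnitAddCircle.norm_eq]
  rcases h1.lt_or_eq with h | h
  · have : round T = 0 := by rw [round_eq_zero_iff]; constructor <;> linarith
    rw [this]; simp [abs_of_nonneg h0]
  · rw [h]; norm_num

/-- squeezing -/
def sq (a b T : ℝ) : ℝ := cl ((T - a)/(b - a))

lemma sq_cont (a b : ℝ) : Continuous (sq a b) := by unfold sq; fun_prop
lemma sq_low {a b : ℝ} (hab : a < b) {T : ℝ} (h : T ≤ a) : sq a b T = 0 :=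
  cl_of_nonpos (div_nonpos_of_nonpos_of_nonneg (by linarith) (by linarith))
lemma sq_high {a b : ℝ} (hab : a < b) {T : ℝ} (h : b ≤ T) : sq a b T = 1 :=
  cl_of_one_le ((one_le_div (by linarith)).2 (by linarith))
lemma sq_cases {a b : ℝ} (ha : 0 < a) (hab : a < b) (hb : b < 1/4) {T : ℝ} (h : ‖((T:ℝ) : UnitAddCircle)‖ ∉ Set.Icc a b) :
    sq a b T = 0 ∨ sq a b T = 1 := by
  rcases le_or_gt T a with h1 | h1
  · left; exact sq_low hab h1
  · rcases le_or_gt b T with h2 | h2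
    · right; exact sq_high hab h2
    · exfalso; apply h; rw [uac_norm (by linarith) (by linarith)]; exact ⟨h1.le, h2.le⟩

def rS (a b : ℝ) : ℕ → ℝ → ℝ := fun _ => sq a b
def rU (a b : ℝ) : ℕ → ℝ → ℝ := fun i => if i % 2 = 0 then sq a b else cl

lemma rS_ok {a b : ℝ} (ha : 0 < a) (hab : a < b) (hb : b < 1/4) : ROk (rS a b) :=
  ⟨fun _ => sq_cont a b, fun _ T h => sq_low hab (by linarith), fun _ T h => sq_high hab (by linarith)⟩
lemma rU_ok {a b : ℝ} (ha : 0 < a) (hab : a < b) (hb : b < 1/4) : ROk (rU a b) := by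
  refine ⟨fun i => ?_, fun i T h => ?_, fun i T h => ?_⟩ <;> unfold rU <;> split_ifs
  · exact sq_cont a b
  · exact cl_cont
  · exact sq_low hab (by linarith)
  · exact cl_of_nonpos h
  · exact sq_high hab (by linarith)
  · exact cl_of_one_le h

lemma Tf_coe {n : ℕ} (y : Fin n → ℝ) (i : ℕ) (l : Fin n) : ((Tf y i l : ℝ) : UnitAddCircle) = ∑ l', piG (y l') i := by
  have h1 : ((Tf y i l : ℝ) : UnitAddCircle) = ((∑ l', cl (y l' - i) : ℝ) : UnitAddCircle) := by
    rw [uac_eq]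
    refine ⟨-((n - 1 - (l:ℕ) : ℕ) : ℤ), ?_⟩
    rw [Tf_eq]; push_cast; ring
  rw [h1, uac_sum]; rfl

lemma Tf_block {n : ℕ} {y : Fin n → ℝ} (hy : Monotone y) {i : ℕ} {l : Fin n} (h : Tf y i l ∈ Set.Ioo (0:ℝ) 1) : (i:ℝ) < y l ∧ y l < i + 1 := by
  constructor
  · by_contra hh; linarith [Tf_low hy (not_lt.1 hh), h.1]
  · by_contra hh; linarith [Tf_high hy (not_lt.1 hh), h.2]

lemma block_unique {i i' : ℕ} {x : ℝ} (h : (i:ℝ) < x ∧ x < i + 1) (h' : (i':ℝ) < x ∧ x < i' + 1) : i = i' := by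
  have h1 : (i:ℝ) < (i' + 1 : ℕ) := by push_cast; linarith [h.1, h'.2]
  have h2 : (i':ℝ) < (i + 1 : ℕ) := by push_cast; linarith [h'.1, h.2]
  have h3 : i < i' + 1 := by exact_mod_cast h1
  have h4 : i' < i + 1 := by exact_mod_cast h2
  omega

lemma Tf_exists {n : ℕ} (y : Fin n → ℝ) (i : ℕ) (h : ∀ l, Tf y i l ∉ Set.Ioo (0:ℝ) 1) : ∑ l', piG (y l') i = 0 := by
  set τ : ℝ := ∑ l', cl (y l' - i) with hτ
  have e : ∑ l', piG (y l') i = ((τ : ℝ) : UnitAddCircle) := by rw [hτ, uac_sum]; rfl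
  have h0 : 0 ≤ τ := Finset.sum_nonneg fun l _ => cl_nonneg _
  have h1 : τ ≤ n := by
    calc τ ≤ ∑ l' : Fin n, (1:ℝ) := Finset.sum_le_sum fun l _ => cl_le_one _
      _ = n := by simp
  rw [e]
  by_contra hne
  have hn : ∀ k : ℕ, τ ≠ k := by
    intro k hk; apply hne; rw [hk]; exact uac_nat k
  have h2 : ⌊τ⌋₊ < n := by rw [Nat.floor_lt h0]; exact lt_of_le_of_ne h1 (hn n)
  have h3 : (⌊τ⌋₊:ℝ) < τ := lt_of_le_of_ne (Nat.floor_le h0) (hn _).symm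
  have h4 := Nat.lt_floor_add_one τ
  refine h ⟨n - 1 - ⌊τ⌋₊, by omega⟩ ?_
  rw [Tf_eq, ← hτ]
  have : (n - 1 - (n - 1 - ⌊τ⌋₊)) = ⌊τ⌋₊ := by omega
  simp only [this]
  constructor <;> linarith

/-- loops `C_j` as maps from the circle -/
def Cc (g j : ℕ) (θ : UnitAddCircle) : Mg (g+1) := hG g (Pi.single (2 * j + 1) θ)

lemma uac_rep (θ : UnitAddCircle) : ∃ t ∈ Set.Icc (0:ℝ) 1, θ = ((t:ℝ) : UnitAddCircle) := by
  obtain ⟨t, rfl⟩ := QuotientAddGroup.mk_surjective θ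
  refine ⟨Int.fract t, ⟨Int.fract_nonneg t, (Int.fract_lt_one t).le⟩, ?_⟩
  refine uac_eq.2 ⟨⌊t⌋, ?_⟩
  rw [add_comm]; exact (Int.floor_add_fract t).symm

lemma Cc_cont (g j : ℕ) (hj : j < g + 1) : Continuous (Cc g j) := by
  refine (hG_cont g).comp_continuous (single_cont _) fun θ => ?_
  obtain ⟨t, ht, rfl⟩ := uac_rep θ
  exact single_mem_Gr (by omega) ht

lemma Cc_coe (g j : ℕ) (hj : j < g + 1) {t : ℝ} (ht : t ∈ Set.Icc (0:ℝ) 1) : Cc g j t = lpG g (2 * j + 1) t :=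
  hG_single g (by omega) ht

lemma Cc_zero (g j : ℕ) (hj : j < g + 1) : Cc g j 0 = Pb g := by
  have := Cc_coe g j hj (t := 0) (by simp)
  rw [lpG_zero g _ (by omega)] at this
  simpa using this

/-- the end map -/
def kap (n g : ℕ) (θ : ℕ → UnitAddCircle) : SP n (Mg (g+1)) := spMk (fun l : Fin n => if (l:ℕ) < g + 1 then Cc g l (θ l) else Pb g)

theorem zf_end {n g : ℕ} (hn : g + 1 ≤ n) {a b : ℝ} (ha : 0 < a) (hab : a < b) (hb : b < 1/4) (y : Fin n → ℝ) (hy : y ∈ KK n (2 * (g+1)))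
    (hZ : ∀ j < g + 1, ‖∑ l, piG (y l) (2 * j)‖ ∉ Set.Icc a b) :
    (spMk (hhG g ∘ zf (2 * (g+1)) (rU a b) 1 y) : SP n (Mg (g+1))) = kap n g (fun j => ∑ l, piG (y l) (2 * j + 1)) := by
  unfold kap
  have hr := rU_ok ha hab hb
  let Q : ℕ → Fin n → Prop := fun j l => j < g + 1 ∧ Tf y (2 * j + 1) l ∈ Set.Ioo (0:ℝ) 1
  have Qj : ∀ {j j' l}, Q j l → Q j' l → j = j' := by
    intro j j' l h h'
    have := block_unique (Tf_block hy.1 h.2) (Tf_block hy.1 h'.2)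
    omega
  have Ql : ∀ {j l l'}, Q j l → Q j l' → l = l' := by
    intro j l l' h h'
    have h1 := h.2; have h2 := h'.2
    rw [Tf_eq] at h1 h2
    have h3 : ((n - 1 - (l:ℕ) : ℕ) : ℝ) < ((n - 1 - (l':ℕ) : ℕ) : ℝ) + 1 := by linarith [h1.1, h2.2]
    have h4 : ((n - 1 - (l':ℕ) : ℕ) : ℝ) < ((n - 1 - (l:ℕ) : ℕ) : ℝ) + 1 := by linarith [h2.1, h1.2]
    have h5 : (n - 1 - (l:ℕ) : ℕ) < (n - 1 - (l':ℕ) : ℕ) + 1 := by exact_mod_cast h3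
    have h6 : (n - 1 - (l':ℕ) : ℕ) < (n - 1 - (l:ℕ) : ℕ) + 1 := by exact_mod_cast h4
    apply Fin.ext; omega
  let A : Fin n → Prop := fun l => ∃ j, Q j l
  let B : Fin n → Prop := fun l => ∃ l', Q l l'
  choose J hJ using fun a : {l // A l} => a.2
  let f : {l // A l} → {l // B l} := fun a => ⟨⟨J a, by have := (hJ a).1; omega⟩, ⟨a.1, hJ a⟩⟩
  have hf : Function.Bijective f := by
    constructor
    · intro a a' h
      have h1 : J a = J a' := congrArg (fun z : {l // B l} => (z.1 : ℕ)) h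
      have h2 := hJ a
      rw [h1] at h2
      exact Subtype.ext (Ql h2 (hJ a'))
    · rintro ⟨l, l', hl⟩
      refine ⟨⟨l', ⟨l, hl⟩⟩, ?_⟩
      apply Subtype.ext; apply Fin.ext
      exact Qj (hJ _) hl
  refine spMk_partial (P := Pb g) (Equiv.ofBijective f hf) ?_ ?_ ?_
  · intro x
    have hja := hJ x
    have hbl := Tf_block hy.1 hja.2
    rw [Equiv.ofBijective_apply]
    show (if J x < g + 1 then Cc g (J x) (∑ l, piG (y l) (2 * J x + 1)) else Pb g) = hhG g (zf (2 * (g+1)) (rU a b) 1 y x)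
    have hkm : 2 * J x + 1 < 2 * (g+1) := by have := hja.1; omega
    have hIcc : Tf y (2 * J x + 1) x ∈ Set.Icc (0:ℝ) 1 := Set.Ioo_subset_Icc_self hja.2
    rw [if_pos hja.1, ← Tf_coe y _ x.1, Cc_coe g _ hja.1 hIcc, zf_int hr 1 hy.1 hkm hbl.1.le hbl.2.le, ← hhG_add g _ hkm _ hIcc]
    congr 1
    unfold rU
    rw [if_neg (by omega), cl_of_mem hIcc]
    ring
  · intro l hl
    rw [Function.comp_apply]
    by_cases hN : NN (y l)
    · obtain ⟨k, hkm, h1, h2⟩ := exists_block (hy.2 l) hN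
      rw [zf_int hr 1 hy.1 hkm h1.le h2.le]
      have e : y l + 1 * (rU a b k (Tf y k l) - (y l - k)) = k + rU a b k (Tf y k l) := by ring
      rw [e]
      have : rU a b k (Tf y k l) = 0 ∨ rU a b k (Tf y k l) = 1 := by
        unfold rU
        split_ifs with hk
        · apply sq_cases ha hab hb
          have := hZ (k/2) (by omega)
          rw [show 2 * (k/2) = k by omega] at this
          rwa [Tf_coe]
        · by_contra hc
          push Not at hc
          apply hl
          refine ⟨k/2, by omega, ?_⟩
          rw [show 2 * (k/2) + 1 = k by omega]
          constructor
          · by_contra hh; exact hc.1 (cl_of_nonpos (not_lt.1 hh))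
          · by_contra hh; exact hc.2 (cl_of_one_le (not_lt.1 hh))
      rcases this with h | h <;> rw [h]
      · rw [add_zero]; exact hhG_nat g k
      · have := hhG_nat g (k+1); push_cast at this; exact this
    · simp only [NN, not_forall, not_not] at hN
      obtain ⟨k, hk⟩ := hN
      rw [zf_nat hr 1 hy.1 hk, hhG_nat]
  · intro l hl
    show (if (l:ℕ) < g + 1 then Cc g l (∑ l', piG (y l') (2 * (l:ℕ) + 1)) else Pb g) = _
    split_ifs with h
    · rw [Tf_exists, Cc_zero g l h]
      intro l' h'
      exact hl ⟨l', h, h'⟩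
    · rfl

end LSP

namespace LSP
set_option linter.all false
set_option autoImplicit false
open Topology

/-! ### The end map is null-homotopic when `n > g + 1` -/

section comm
variable {X : Type*} [TopologicalSpace X]

def mu2 (p : X × X) : SP 2 X := spMk ![p.1, p.2]

lemma mu2_cont : Continuous (mu2 : X × X → SP 2 X) := by
  refine spMk_cont.comp (continuous_pi fun l => ?_)
  fin_cases l
  · exact continuous_fst
  · exact continuous_snd

lemma mu2_swap (x y : X) : mu2 (x, y) = mu2 (y, x) := by
  refine spMk_eq.2 ⟨Equiv.swap 0 1, ?_⟩
  funext l
  fin_cases l <;> simp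

def i2 (P : X) (x : X) : SP 2 X := mu2 (x, P)
lemma i2_cont (P : X) : Continuous (i2 P) := mu2_cont.comp (by fun_prop)

def phiQ {P : X} (p : Path P P) : Path.Homotopic.Quotient (i2 P P) (i2 P P) := Path.Homotopic.Quotient.mk (p.map (i2_cont P))

lemma phi_congr {P : X} {p q : Path P P} (h : p.Homotopic q) : phiQ p = phiQ q := by
  refine Path.Homotopic.Quotient.eq.2 ?_
  exact h.map ⟨i2 P, i2_cont P⟩

lemma phi_trans {P : X} (p q : Path P P) : phiQ (p.trans q) = (phiQ p).trans (phiQ q) := by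
  unfold phiQ
  rw [Path.map_trans, Path.Homotopic.Quotient.mk_trans]

lemma phi_refl (P : X) : phiQ (Path.refl P) = Path.Homotopic.Quotient.refl _ := by
  rw [← Path.Homotopic.Quotient.mk_refl]
  unfold phiQ
  congr 1

def dd {P : X} (p q : Path P P) : Path.Homotopic.Quotient (i2 P P) (i2 P P) := Path.Homotopic.Quotient.mk ((p.prod q).map mu2_cont)

lemma dd_congr {P : X} {p p' q q' : Path P P} (h : p.Homotopic p') (h' : q.Homotopic q') : dd p q = dd p' q' := by
  refine Path.Homotopic.Quotient.eq.2 ?_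
  obtain ⟨h⟩ := h
  obtain ⟨h'⟩ := h'
  have h2 : (p.prod q).Homotopic (p'.prod q') := ⟨Path.Homotopic.prodHomotopy h h'⟩
  exact h2.map ⟨mu2, mu2_cont⟩

lemma dd_trans {P : X} (p p' q q' : Path P P) : (dd p q).trans (dd p' q') = dd (p.trans p') (q.trans q') := by
  unfold dd
  rw [← Path.trans_prod_eq_prod_trans, Path.map_trans]
  exact (Path.Homotopic.Quotient.mk_trans _ _).symm

lemma dd_left {P : X} (p : Path P P) : dd p (Path.refl P) = phiQ p := by
  unfold dd phiQ
  congr 1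

lemma dd_right {P : X} (p : Path P P) : dd (Path.refl P) p = phiQ p := by
  unfold dd phiQ
  congr 1
  ext t
  exact mu2_swap _ _

lemma phi_comm {P : X} (p q : Path P P) : (phiQ p).trans (phiQ q) = (phiQ q).trans (phiQ p) := by
  have h1 : (phiQ p).trans (phiQ q) = dd p q := by
    rw [← dd_left p, ← dd_right q, dd_trans]
    exact dd_congr ⟨Path.Homotopy.transRefl p⟩ ⟨Path.Homotopy.reflTrans q⟩
  have h2 : (phiQ q).trans (phiQ p) = dd p q := by
    rw [← dd_left p, ← dd_right q, dd_trans]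
    exact dd_congr ⟨Path.Homotopy.reflTrans p⟩ ⟨Path.Homotopy.transRefl q⟩
  rw [h1, h2]

end comm

lemma disc_paths {u v : Disc} (p q : Path u v) : p.Homotopic q := by
  have e : ({z : ℂ | ‖z‖ ≤ 1} : Set ℂ) = Metric.closedBall 0 1 := by ext z; simp
  have hc : Convex ℝ {z : ℂ | ‖z‖ ≤ 1} := by rw [e]; exact convex_closedBall _ _
  haveI : ContractibleSpace Disc := hc.contractibleSpace ⟨0, by simp⟩
  exact SimplyConnectedSpace.paths_homotopic p q

/-- `q` is the class of the image of a path of the disc from `u` to `v` -/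
def Rr (g : ℕ) (u v : Disc) (q : Path.Homotopic.Quotient (i2 (Pb g) (Pb g)) (i2 (Pb g) (Pb g))) : Prop :=
  ∃ (p : Path u v) (ℓ : Path (Pb g) (Pb g)), (∀ t, ℓ t = mq g (p t)) ∧ phiQ ℓ = q

lemma Rr_mk (g : ℕ) {u v : Disc} (p : Path u v) (hu : mq g u = Pb g) (hv : mq g v = Pb g) : ∃ q, Rr g u v q :=
  ⟨_, p, (p.map (mq_cont g)).cast hu.symm hv.symm, fun _ => rfl, rfl⟩

lemma Rr_unique {g : ℕ} {u v : Disc} {q q'} (h : Rr g u v q) (h' : Rr g u v q') : q = q' := by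
  obtain ⟨p, ℓ, h1, rfl⟩ := h
  obtain ⟨p', ℓ', h1', rfl⟩ := h'
  have hu : Pb g = mq g u := by have := h1 0; simpa using this
  have hv : Pb g = mq g v := by have := h1 1; simpa using this
  have e : ℓ = (p.map (mq_cont g)).cast hu hv := by ext t; exact h1 t
  have e' : ℓ' = (p'.map (mq_cont g)).cast hu hv := by ext t; exact h1' t
  rw [e, e']
  apply phi_congr
  exact (((disc_paths p p').map ⟨mq g, mq_cont g⟩)).pathCast hu hv

lemma Rr_trans {g : ℕ} {u v w : Disc} {q q'} (h : Rr g u v q) (h' : Rr g v w q') : Rr g u w (q.trans q') := by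
  obtain ⟨p, ℓ, h1, rfl⟩ := h
  obtain ⟨p', ℓ', h1', rfl⟩ := h'
  refine ⟨p.trans p', ℓ.trans ℓ', fun t => ?_, phi_trans _ _⟩
  rw [Path.trans_apply, Path.trans_apply]
  split_ifs
  · exact h1 _
  · exact h1' _

lemma Rr_refl {g : ℕ} {u : Disc} (hu : mq g u = Pb g) : Rr g u u (Path.Homotopic.Quotient.refl _) :=
  ⟨Path.refl u, Path.refl _, fun t => hu.symm, phi_refl _⟩

lemma Rr_glue {g : ℕ} {u v u' v' : Disc} (p : Path u v) (p' : Path u' v') (h : ∀ t, mq g (p t) = mq g (p' t))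
    (hu : mq g u = Pb g) (hv : mq g v = Pb g) : ∃ q, Rr g u v q ∧ Rr g u' v' q ∧ ∃ ℓ, phiQ ℓ = q :=
  ⟨_, ⟨p, (p.map (mq_cont g)).cast hu.symm hv.symm, fun _ => rfl, rfl⟩,
    ⟨p', (p.map (mq_cont g)).cast hu.symm hv.symm, fun t => h t, rfl⟩, _, rfl⟩

/-- arc on the boundary -/
def arc (G : ℕ) (α β : ℝ) : Path (dpt G 1 α) (dpt G 1 β) where
  toFun t := dpt G 1 (α + t * (β - α))
  continuous_toFun := by
    have h : Continuous (fun t : I => ((1:ℝ), α + (t:ℝ) * (β - α))) := by fun_prop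
    exact (dpt_cont G).comp h
  source' := by simp
  target' := by simp

lemma Rr_cor (g : ℕ) (j : ℕ) (hj : j ≤ g + 1) : Rr g (dpt (g+1) 1 0) (dpt (g+1) 1 (4 * j)) (Path.Homotopic.Quotient.refl _) := by
  induction j with
  | zero => simpa using Rr_refl (g := g) (u := dpt (g+1) 1 0) rfl
  | succ j ih =>
    have ih := ih (by omega)
    have hc : ∀ r : ℕ, r ≤ 4 → mq g (dpt (g+1) 1 (4 * j + (r:ℝ))) = Pb g := fun r hr => corner g ⟨j, by omega⟩ r hr
    obtain ⟨a, ha, ha', la, rfl⟩ := Rr_glue (arc (g+1) (4 * j) (4 * j + 1)) (arc (g+1) (4 * j + 3) (4 * j + 2)) (g := g) (by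
      intro t
      have := glue2 g ⟨j, by omega⟩ (t := t) t.2
      show mpt g 1 _ = mpt g 1 _
      convert this using 2 <;> ring) (by simpa using hc 0 (by omega)) (by simpa using hc 1 (by omega))
    obtain ⟨b, hb, hb', lb, rfl⟩ := Rr_glue (arc (g+1) (4 * j + 1) (4 * j + 2)) (arc (g+1) (4 * j + 4) (4 * j + 3)) (g := g) (by
      intro t
      have := glue3 g ⟨j, by omega⟩ (t := t) t.2
      show mpt g 1 _ = mpt g 1 _
      convert this using 2 <;> ring) (by simpa using hc 1 (by omega)) (by simpa using hc 2 (by omega))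
    obtain ⟨x, hx⟩ := Rr_mk g (arc (g+1) (4 * j) (4 * j + 4)) (by simpa using hc 0 (by omega)) (by simpa using hc 4 (by omega))
    have h1 := Rr_unique (Rr_trans hx (Rr_trans hb' ha')) (Rr_trans ha hb)
    rw [phi_comm la lb] at h1
    have h2 : x = Path.Homotopic.Quotient.refl _ := by
      have := congrArg (fun z => Path.Homotopic.Quotient.trans z ((phiQ lb).trans (phiQ la)).symm) h1
      simpa [Path.Homotopic.Quotient.trans_assoc, Path.Homotopic.Quotient.trans_symm, Path.Homotopic.Quotient.trans_refl] using this
    subst h2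
    have := Rr_trans ih hx
    rw [Path.Homotopic.Quotient.refl_trans] at this
    convert this using 2
    push_cast; ring

lemma uac_quot : IsQuotientMap (fun t : I => ((t:ℝ) : UnitAddCircle)) := by
  refine IsClosedMap.isQuotientMap ?_ ?_ ?_
  · exact Continuous.isClosedMap (uac_coe_cont.comp continuous_subtype_val)
  · exact uac_coe_cont.comp continuous_subtype_val
  · intro θ
    obtain ⟨t, ht, rfl⟩ := uac_rep θ
    exact ⟨⟨t, ht⟩, rfl⟩

lemma Cc_null (g k : ℕ) (hk : k < g + 1) : ∃ H : I × UnitAddCircle → SP 2 (Mg (g+1)), Continuous H ∧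
    ∀ θ, H (0, θ) = spMk ![Cc g k θ, Pb g] ∧ H (1, θ) = spMk ![Pb g, Pb g] := by
  -- the loop in the disc
  let p : Path (dpt (g+1) 1 0) (dpt (g+1) 1 (4 * k)) :=
    { toFun := fun t => toD (ct (g+1) (EE (g+1) (4 * k)) t)
      continuous_toFun := toD_cont.comp ((ct_cont _ _).comp continuous_subtype_val)
      source' := by simp [ct_zero, toD_EE]
      target' := by simp [ct_one, toD_EE] }
  let ℓ : Path (Pb g) (Pb g) :=
    { toFun := fun t => lpG g (2 * k + 1) t
      continuous_toFun := (lpG_cont g _).comp continuous_subtype_val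
      source' := lpG_zero g _ (by omega)
      target' := lpG_one g _ (by omega) }
  have h1 : Rr g _ _ (phiQ ℓ) := ⟨p, ℓ, fun t => lpG_odd g k t, rfl⟩
  have h2 := Rr_unique h1 (Rr_cor g k hk.le)
  rw [← Path.Homotopic.Quotient.mk_refl] at h2
  obtain ⟨F⟩ := Path.Homotopic.Quotient.exact h2
  have hex : ∀ θ : UnitAddCircle, ∃ t : I, ((t:ℝ) : UnitAddCircle) = θ := uac_quot.surjective
  choose tt htt using hex
  have key : ∀ (τ t : I), F (τ, tt ((t:ℝ) : UnitAddCircle)) = F (τ, t) := by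
    intro τ t
    have := htt ((t:ℝ) : UnitAddCircle)
    rw [uac_eq] at this
    obtain ⟨m, hm⟩ := this
    have b1 := (tt ((t:ℝ) : UnitAddCircle)).2
    have b2 := t.2
    have hm1 : (m:ℝ) ≤ 1 := by have := b1.1; have := b1.2; have := b2.1; have := b2.2; linarith
    have hm2 : (-1:ℝ) ≤ m := by have := b1.1; have := b1.2; have := b2.1; have := b2.2; linarith
    have hm1' : m ≤ 1 := by exact_mod_cast hm1
    have hm2' : -1 ≤ m := by exact_mod_cast hm2
    have : m = -1 ∨ m = 0 ∨ m = 1 := by omega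
    rcases this with rfl | rfl | rfl
    · push_cast at hm
      have c1 : t = 0 ∧ tt ((t:ℝ) : UnitAddCircle) = 1 ∨ t = 1 ∧ tt ((t:ℝ) : UnitAddCircle) = 0 := by
        first
        | (left; exact ⟨Subtype.ext (show (t:ℝ) = 0 by linarith [b1.1, b1.2, b2.1, b2.2]), Subtype.ext (show (tt ((t:ℝ) : UnitAddCircle) : ℝ) = 1 by linarith [b1.1, b1.2, b2.1, b2.2])⟩)
        | (right; exact ⟨Subtype.ext (show (t:ℝ) = 1 by linarith [b1.1, b1.2, b2.1, b2.2]), Subtype.ext (show (tt ((t:ℝ) : UnitAddCircle) : ℝ) = 0 by linarith [b1.1, b1.2, b2.1, b2.2])⟩)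
      rcases c1 with ⟨c, d⟩ | ⟨c, d⟩ <;> rw [d, c] <;> simp
    · have c : tt ((t:ℝ) : UnitAddCircle) = t := by apply Subtype.ext; push_cast at hm; linarith
      rw [c]
    · push_cast at hm
      have c1 : t = 0 ∧ tt ((t:ℝ) : UnitAddCircle) = 1 ∨ t = 1 ∧ tt ((t:ℝ) : UnitAddCircle) = 0 := by
        first
        | (left; exact ⟨Subtype.ext (show (t:ℝ) = 0 by linarith [b1.1, b1.2, b2.1, b2.2]), Subtype.ext (show (tt ((t:ℝ) : UnitAddCircle) : ℝ) = 1 by linarith [b1.1, b1.2, b2.1, b2.2])⟩)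
        | (right; exact ⟨Subtype.ext (show (t:ℝ) = 1 by linarith [b1.1, b1.2, b2.1, b2.2]), Subtype.ext (show (tt ((t:ℝ) : UnitAddCircle) : ℝ) = 0 by linarith [b1.1, b1.2, b2.1, b2.2])⟩)
      rcases c1 with ⟨c, d⟩ | ⟨c, d⟩ <;> rw [d, c] <;> simp
  refine ⟨fun q => F (q.1, tt q.2), ?_, ?_⟩
  · refine uac_quot.continuous_lift_prod_right ?_
    have : (fun q : I × I => F (q.1, tt ((q.2:ℝ) : UnitAddCircle))) = F := by
      funext q; exact key q.1 q.2
    show Continuous (fun q : I × I => F (q.1, tt ((q.2:ℝ) : UnitAddCircle)))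
    rw [this]
    exact F.continuous
  · intro θ
    constructor
    · show F (0, _) = _
      rw [F.apply_zero]
      have : Cc g k θ = lpG g (2 * k + 1) (tt θ) := by
        conv_lhs => rw [← htt θ]
        exact Cc_coe g k hk (tt θ).2
      rw [this]
      rfl
    · show F (1, _) = _
      rw [F.apply_one]
      rfl

section join
variable {X : Type*} [TopologicalSpace X]

def jnf {n : ℕ} (k : ℕ) (s : Fin 2 → X) (x : Fin n → X) : Fin n → X :=
  fun l => if (l:ℕ) = k then s 0 else if (l:ℕ) = k + 1 then s 1 else x l

lemma jnf_cont {n : ℕ} (k : ℕ) : Continuous (fun q : (Fin 2 → X) × (Fin n → X) => jnf k q.1 q.2) := by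
  refine continuous_pi fun l => ?_
  unfold jnf
  split_ifs <;> fun_prop

def jn {n : ℕ} (k : ℕ) (hk : k + 1 < n) (D : SP 2 X) (x : Fin n → X) : SP n X :=
  Quot.lift (fun s => (spMk (jnf k s x) : SP n X)) (by
    rintro s t ⟨e, rfl⟩
    have he : ∀ e : Equiv.Perm (Fin 2), e = 1 ∨ e = Equiv.swap 0 1 := by decide
    rcases he e with rfl | rfl
    · rfl
    · refine spMk_eq.2 ⟨Equiv.swap ⟨k, by omega⟩ ⟨k+1, hk⟩, ?_⟩
      funext l
      by_cases h1 : (l:ℕ) = k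
      · have : l = (⟨k, Nat.lt_of_succ_lt hk⟩ : Fin n) := Fin.ext h1
        rw [this]
        simp [jnf]
      · by_cases h2 : (l:ℕ) = k + 1
        · have : l = (⟨k+1, hk⟩ : Fin n) := Fin.ext h2
          rw [this]
          simp [jnf]
        · rw [Function.comp_apply, Equiv.swap_apply_of_ne_of_ne (fun h => h1 (by rw [h])) (fun h => h2 (by rw [h]))]
          simp [jnf, h1, h2]) D

lemma jn_mk {n : ℕ} (k : ℕ) (hk : k + 1 < n) (s : Fin 2 → X) (x : Fin n → X) : jn k hk (spMk s) x = spMk (jnf k s x) := rfl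

lemma jn_cont {n : ℕ} (k : ℕ) (hk : k + 1 < n) : Continuous (fun q : SP 2 X × (Fin n → X) => jn k hk q.1 q.2) := by
  have hq : IsOpenQuotientMap (Prod.map (spMk : (Fin 2 → X) → SP 2 X) (id : (Fin n → X) → _)) := spMk_oq.prodMap IsOpenQuotientMap.id
  rw [hq.isQuotientMap.continuous_iff]
  exact spMk_cont.comp (jnf_cont k)

end join

def kapK (n g k : ℕ) (θ : ℕ → UnitAddCircle) (l : Fin n) : Mg (g+1) := if (l:ℕ) < k then Cc g l (θ l) else Pb g

lemma kapK_cont (n g k : ℕ) (hk : k ≤ g + 1) : Continuous (kapK n g k) := by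
  refine continuous_pi fun l => ?_
  unfold kapK
  split_ifs with h
  · exact (Cc_cont g l (by omega)).comp (continuous_apply _)
  · exact continuous_const

lemma kapK_step (n g k : ℕ) (hk : k < g + 1) (hn : k + 1 < n) :
    HomOn Set.univ (fun θ => (spMk (kapK n g (k+1) θ) : SP n (Mg (g+1)))) (fun θ => spMk (kapK n g k θ)) := by
  obtain ⟨H, hH, h1⟩ := Cc_null g k hk
  refine ⟨fun q => jn k hn (H (q.1, q.2 k)) (kapK n g k q.2), ?_, ?_⟩
  · apply Continuous.continuousOn
    have := kapK_cont n g k hk.le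
    exact (jn_cont k hn).comp ((hH.comp (by fun_prop)).prodMk (this.comp continuous_snd))
  · intro θ _
    constructor
    · show jn k hn (H (0, θ k)) _ = _
      rw [(h1 _).1, jn_mk]
      congr 1
      funext l
      unfold jnf kapK
      by_cases a1 : (l:ℕ) = k
      · simp [a1]
      · by_cases a2 : (l:ℕ) = k + 1
        · simp [a2]
        · simp only [a1, a2, if_false]
          have : (l:ℕ) < k ↔ (l:ℕ) < k + 1 := by omega
          simp only [this]
    · show jn k hn (H (1, θ k)) _ = _
      rw [(h1 _).2, jn_mk]
      congr 1
      funext l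
      unfold jnf kapK
      by_cases a1 : (l:ℕ) = k
      · simp [a1]
      · by_cases a2 : (l:ℕ) = k + 1
        · simp [a2]
        · simp [a1, a2]

theorem kap_null (n g : ℕ) (hn : g + 1 < n) : HomOn Set.univ (kap n g) (fun _ => spMk (fun _ => Pb g)) := by
  have : ∀ k, k ≤ g + 1 → HomOn Set.univ (fun θ => (spMk (kapK n g k θ) : SP n (Mg (g+1)))) (fun _ => spMk (fun _ => Pb g)) := by
    intro k
    induction k with
    | zero => 
      intro _
      have e : (fun θ => (spMk (kapK n g 0 θ) : SP n (Mg (g+1)))) = (fun _ => spMk (fun _ => Pb g)) := by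
        funext θ; congr 1
      rw [e]
      exact HomOn.refl continuousOn_const
    | succ k ih =>
      intro hk
      exact (kapK_step n g k (by omega) (by omega)).trans (ih (by omega))
  exact this (g+1) le_rfl

end LSP

namespace LSP
set_option linter.all false
set_option autoImplicit false
open Topology

/-! ### The upper bounds in positive genus -/

def puS {g : ℕ} {a b : ℝ} {pu : Mg (g+1) → ℕ → UnitAddCircle} (h : IsPu g a b pu) (x : Mg (g+1)) : Gr (2 * (g+1)) := ⟨pu x, h.mem x⟩

lemma spMap_puS_cont {n g : ℕ} {a b : ℝ} (ha : 0 < a) (hab : a < b) (hb : b < 1/4) {pu} (h : IsPu g a b pu) :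
    ContinuousOn (spMap (puS h) : SP n (Mg (g+1)) → SP n (Gr (2 * (g+1)))) (spSet n (MI g a b)) := by
  have h1 : ContinuousOn (puS h) (MI g a b) := by
    have := h.cont ha hab hb
    rw [continuousOn_iff_continuous_domRestrict] at this ⊢
    exact Continuous.subtype_mk this _
  obtain ⟨H, hH, h2⟩ := (HomOn.refl h1).sp (MI_open g a b) (n := n)
  have h3 : ContinuousOn (fun D => H (0, D)) (spSet n (MI g a b)) :=
    hH.comp (by fun_prop) (fun D hD => ⟨trivial, hD⟩)
  exact h3.congr fun D hD => ((h2 D hD).1).symm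

lemma spMap_id' {n : ℕ} {X : Type*} [TopologicalSpace X] (D : SP n X) : spMap id D = D := by
  obtain ⟨s, rfl⟩ := spMk_surj D; rfl

lemma homU (n : ℕ) {g : ℕ} {a b : ℝ} (ha : 0 < a) (hab : a < b) (hb : b < 1/4) {pu} (h : IsPu g a b pu) {r : ℕ → ℝ → ℝ} (hr : ROk r) :
    ∃ E : SP n (Gr (2 * (g+1))) → SP n (Mg (g+1)), HomOn (spSet n (MI g a b)) id (E ∘ spMap (puS h)) ∧
      ∀ y : KK n (2 * (g+1)), E (qK y) = spMk (hhG g ∘ zf (2 * (g+1)) r 1 y.1) := by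
  obtain ⟨H, hH, hy⟩ := merge (n := n) (m := 2 * (g+1)) (hhG_cont g) (hhG_nat g) hr
  refine ⟨fun D => H (1, D), ?_, fun y => hy 1 y⟩
  have h1 := (h.hom ha hab hb).sp (MI_open g a b) (n := n)
  have hp := spMap_puS_cont (n := n) ha hab hb h
  have h2 : HomOn (spSet n (MI g a b)) (spMap (fun x => hG g (pu x))) ((fun D => H (1, D)) ∘ spMap (puS h)) := by
    refine ⟨fun q => H (q.1, spMap (puS h) q.2), ?_, ?_⟩
    · refine hH.comp_continuousOn (continuous_fst.continuousOn.prodMk ?_)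
      exact hp.comp continuous_snd.continuousOn (fun q hq => hq.2)
    · intro D hD
      refine ⟨?_, rfl⟩
      obtain ⟨y, hy'⟩ := qK_surj (spMap (puS h) D)
      have e1 : (spMap (fun x => hG g (pu x)) D : SP n (Mg (g+1))) = spMap (fun z : Gr (2 * (g+1)) => hG g z.1) (spMap (puS h) D) := by
        obtain ⟨s, rfl⟩ := spMk_surj D; rfl
      show H (0, spMap (puS h) D) = _
      rw [e1, ← hy', hy]
      unfold qK
      rw [spMap_mk]
      congr 1
      funext l
      show hhG g (zf _ r ((0:I):ℝ) y.1 l) = hG g (piG (y.1 l))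
      rw [hG_eq g _ (y.2.2 l)]
      congr 1
      simp [zf]
  exact (h1.trans h2).congr (fun D _ => spMap_id' D) (fun _ _ => rfl)

lemma zf_endS {n g : ℕ} {a b : ℝ} (ha : 0 < a) (hab : a < b) (hb : b < 1/4) (y : Fin n → ℝ) (hy : y ∈ KK n (2 * (g+1)))
    (hZ : ∀ j < 2 * (g + 1), ‖∑ l, piG (y l) j‖ ∉ Set.Icc a b) (l : Fin n) :
    hhG g (zf (2 * (g+1)) (rS a b) 1 y l) = Pb g := by
  have hr := rS_ok ha hab hb
  by_cases hN : NN (y l)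
  · obtain ⟨k, hkm, h1, h2⟩ := exists_block (hy.2 l) hN
    rw [zf_int hr 1 hy.1 hkm h1.le h2.le]
    have e : y l + 1 * (rS a b k (Tf y k l) - (y l - k)) = k + rS a b k (Tf y k l) := by ring
    rw [e]
    have : rS a b k (Tf y k l) = 0 ∨ rS a b k (Tf y k l) = 1 := by
      unfold rS
      apply sq_cases ha hab hb
      rw [Tf_coe]
      exact hZ k hkm
    rcases this with h | h <;> rw [h]
    · rw [add_zero]; exact hhG_nat g k
    · have := hhG_nat g (k+1); push_cast at this; exact this
  · simp only [NN, not_forall, not_not] at hN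
    obtain ⟨k, hk⟩ := hN
    rw [zf_nat hr 1 hy.1 hk, hhG_nat]

def ev1 {X : Type*} [TopologicalSpace X] : SP 1 X → X := Quot.lift (fun s => s 0) (by
  rintro s t ⟨e, rfl⟩
  show s 0 = s (e 0)
  congr 1
  exact Subsingleton.elim _ _)

lemma ev1_cont {X : Type*} [TopologicalSpace X] : Continuous (ev1 : SP 1 X → X) :=
  continuous_quot_lift _ (continuous_apply 0)

def puE (g : ℕ) (a b : ℝ) : Mg (g+1) → ℕ → UnitAddCircle := 
  haveI : Nonempty (Mg (g+1) → ℕ → UnitAddCircle) := ⟨fun _ _ => 0⟩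
  Classical.epsilon (IsPu g a b)

lemma puE_spec (g : ℕ) {a b : ℝ} (ha : 0 < a) (hab : a < b) (hb : b < 1/4) : IsPu g a b (puE g a b) :=
  Classical.epsilon_spec (exists_isPu g ha hab hb)

def S1 (g : ℕ) (a b : ℝ) : Set (Mg (g+1)) := {x | x ∈ MI g a b ∧ ∀ i < 2 * (g+1), ‖puE g a b x i‖ ∉ Set.Icc a b}

lemma S1_open (g : ℕ) {a b : ℝ} (ha : 0 < a) (hab : a < b) (hb : b < 1/4) : IsOpen (S1 g a b) := by
  have hc := (puE_spec g ha hab hb).cont ha hab hb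
  have e : S1 g a b = MI g a b ∩ puE g a b ⁻¹' (⋂ i ∈ Finset.range (2 * (g+1)), {z : ℕ → UnitAddCircle | ‖z i‖ ∉ Set.Icc a b}) := by
    ext x; simp [S1]
  rw [e]
  refine hc.isOpen_inter_preimage (MI_open g a b) ?_
  refine isOpen_biInter_finset fun i _ => ?_
  have hcc : Continuous (fun z : ℕ → UnitAddCircle => ‖z i‖) := continuous_norm.comp (continuous_apply i)
  exact (isClosed_Icc.preimage hcc).isOpen_compl

lemma S1_null (g : ℕ) {a b : ℝ} (ha : 0 < a) (hab : a < b) (hb : b < 1/4) : NullOn (S1 g a b) := by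
  have hp := puE_spec g ha hab hb
  obtain ⟨E, hE, hy⟩ := homU 1 ha hab hb hp (rS_ok ha hab hb)
  refine ⟨Pb g, ?_⟩
  have hk : Continuous (fun x : Mg (g+1) => (spMk (fun _ => x) : SP 1 (Mg (g+1)))) := 
    spMk_cont.comp (continuous_pi fun _ => continuous_id)
  have h1 := (hE.precomp (T := S1 g a b) hk.continuousOn (by
    intro x hx l; exact hx.1)).postcomp ev1_cont
  refine h1.congr (fun x _ => rfl) (fun x hx => ?_)
  show ev1 (E (spMap (puS hp) (spMk fun _ => x))) = Pb g
  obtain ⟨y, hy'⟩ := qK_surj (spMap (puS hp) (spMk (fun _ => x) : SP 1 (Mg (g+1))))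
  rw [← hy', hy]
  show hhG g (zf _ _ 1 y.1 0) = Pb g
  refine zf_endS ha hab hb y.1 y.2 (fun j hj => ?_) 0
  have := congrArg (spSum (fun z : Gr (2 * (g+1)) => z.1 j)) hy'
  have e1 : spSum (fun z : Gr (2 * (g+1)) => z.1 j) (qK y) = ∑ l, piG (y.1 l) j := rfl
  have e2 : spSum (fun z : Gr (2 * (g+1)) => z.1 j) (spMap (puS hp) (spMk (fun _ => x) : SP 1 (Mg (g+1)))) = ∑ l : Fin 1, puE g a b x j := rfl
  rw [e1, e2] at this
  rw [this]
  simpa using hx.2 j hj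

lemma hasFeat_small (n g : ℕ) : HasFeat (SP n (Mg (g+1))) (n + n) := by
  refine ⟨fun a b => spSet n (S1 g a b), ?_, ?_⟩
  · intro a b ha hab hb
    exact ⟨isOpen_spSet (S1_open g ha hab hb), (S1_null g ha hab hb).sp (S1_open g ha hab hb)⟩
  · intro D
    obtain ⟨s, rfl⟩ := spMk_surj D
    choose r hr using pu_feat g
    classical
    refine ⟨Finset.univ.image (fun l => dG g (s l)) ∪ Finset.univ.image (fun l => r (s l)), ?_, ?_⟩
    · refine (Finset.card_union_le _ _).trans (Nat.add_le_add ?_ ?_) <;> exact Finset.card_image_le.trans (by simp)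
    · intro a b ha hab hb h l
      refine ⟨?_, fun i _ => ?_⟩
      · exact h _ (Finset.mem_union_left _ (Finset.mem_image_of_mem _ (Finset.mem_univ l)))
      · exact hr (s l) a b ha _ (puE_spec g ha hab hb) (h _ (Finset.mem_union_right _ (Finset.mem_image_of_mem _ (Finset.mem_univ l)))) i

def S2 (n g : ℕ) (a b : ℝ) : Set (SP n (Mg (g+1))) := spSet n (MI g a b) ∩ {D | ∀ j : Fin (g+1), ‖spSum (vG g j) D‖ ∉ Set.Icc a b}

lemma S2_open (n g : ℕ) (a b : ℝ) : IsOpen (S2 n g a b) := by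
  refine (isOpen_spSet (MI_open g a b)).inter ?_
  rw [Set.setOf_forall]
  refine isOpen_iInter_of_finite fun j => ?_
  have hc : Continuous (fun D : SP n (Mg (g+1)) => ‖spSum (vG g j) D‖) := continuous_norm.comp (spSum_cont (vG_cont g j))
  exact (isClosed_Icc.preimage hc).isOpen_compl

lemma S2_null {n g : ℕ} (hn : g + 1 < n) {a b : ℝ} (ha : 0 < a) (hab : a < b) (hb : b < 1/4) : NullOn (S2 n g a b) := by
  have hp := puE_spec g ha hab hb
  obtain ⟨E, hE, hy⟩ := homU n ha hab hb hp (rU_ok ha hab hb)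
  refine ⟨spMk (fun _ => Pb g), ?_⟩
  let O : SP n (Gr (2 * (g+1))) → ℕ → UnitAddCircle := fun D j => spSum (fun z : Gr (2 * (g+1)) => z.1 (2 * j + 1)) D
  have hO : Continuous O := continuous_pi fun j => spSum_cont ((continuous_apply _).comp continuous_subtype_val)
  have h2 := (kap_null n g hn).precomp (T := S2 n g a b) (k := O ∘ spMap (puS hp))
    (hO.comp_continuousOn ((spMap_puS_cont ha hab hb hp).mono fun D hD => hD.1)) (fun _ _ => trivial)
  refine HomOn.trans ((hE.mono (T := S2 n g a b) fun D hD => hD.1).congr (fun _ _ => rfl) (fun D hD => ?_)) h2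
  show E (spMap (puS hp) D) = kap n g (O (spMap (puS hp) D))
  obtain ⟨y, hy'⟩ := qK_surj (spMap (puS hp) D)
  have e : ∀ i, spSum (fun z : Gr (2 * (g+1)) => z.1 i) (spMap (puS hp) D) = ∑ l, piG (y.1 l) i := by
    intro i; rw [← hy']; rfl
  rw [← hy', hy, zf_end (by omega) ha hab hb y.1 y.2]
  · rfl
  · intro j hj
    rw [← e]
    have : spSum (fun z : Gr (2 * (g+1)) => z.1 (2 * j)) (spMap (puS hp) D) = spSum (vG g ⟨j, hj⟩) D := by
      obtain ⟨s, rfl⟩ := spMk_surj D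
      show ∑ l, puE g a b (s l) (2 * j) = ∑ l, vG g ⟨j, hj⟩ (s l)
      exact Finset.sum_congr rfl fun l _ => hp.even (s l) ⟨j, hj⟩
    rw [this]
    exact hD.2 ⟨j, hj⟩

lemma hasFeat_big {n g : ℕ} (hn : g + 1 < n) : HasFeat (SP n (Mg (g+1))) (n + (g+1)) := by
  refine ⟨fun a b => S2 n g a b, ?_, ?_⟩
  · intro a b ha hab hb
    exact ⟨S2_open n g a b, S2_null hn ha hab hb⟩
  · intro D
    obtain ⟨s, rfl⟩ := spMk_surj D
    classical
    refine ⟨Finset.univ.image (fun l => dG g (s l)) ∪ Finset.univ.image (fun j : Fin (g+1) => ‖∑ l, vG g j (s l)‖), ?_, ?_⟩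
    · refine (Finset.card_union_le _ _).trans (Nat.add_le_add ?_ ?_) <;> exact Finset.card_image_le.trans (by simp)
    · intro a b ha hab hb h
      refine ⟨fun l => ?_, fun j => ?_⟩
      · exact h _ (Finset.mem_union_left _ (Finset.mem_image_of_mem _ (Finset.mem_univ l)))
      · exact h _ (Finset.mem_union_right _ (Finset.mem_image_of_mem _ (Finset.mem_univ j)))

theorem hasFeat_all (n g : ℕ) : HasFeat (SP n (Mg g)) (n + min n g) := by
  cases g with
  | zero => simpa using hasFeat_zero n
  | succ g =>
    rcases Nat.lt_or_ge (g+1) n with h | h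
    · rw [min_eq_right h.le]; exact hasFeat_big h
    · rw [min_eq_left h]; exact hasFeat_small n g

end LSP

namespace LSP
set_option linter.all false
set_option autoImplicit false
open Topology

theorem LScat_prod {k : ℕ} (n g : Fin k → ℕ) :
    LScat (∀ j : Fin k, SP (n j) (Mg (g j))) = ((∑ j, (n j + min (n j) (g j)) : ℕ) : ℕ∞) :=
  LScat_eq (HasFeat.pi fun j => hasFeat_all (n j) (g j)).catLE (fun r h => lower_bound n g r h)

theorem LScat_single (n g : ℕ) : LScat (SP n (Mg g)) = ((n + min n g : ℕ) : ℕ∞) := by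
  have h := LScat_prod (k := 1) (fun _ => n) (fun _ => g)
  rw [← LScat_homeo (Homeomorph.funUnique (Fin 1) (SP n (Mg g))), h]
  simp

end LSP

/-- The family `{SPⁿ(M_g)}` is LS-logarithmic; in particular
`cat((SPⁿ(M_g))ᵐ) = m·cat(SPⁿ(M_g))`. -/
theorem lsLogarithmic_SP_orientableSurfaces :
    (∀ (k : ℕ), 1 ≤ k → ∀ n g : Fin k → ℕ, (∀ j, 1 ≤ n j) →
      LScat (∀ j : Fin k, SP (n j) (Mg (g j)))
        = ∑ j : Fin k, LScat (SP (n j) (Mg (g j)))) ∧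
    (∀ m n g : ℕ, 1 ≤ m → 1 ≤ n →
      LScat (Fin m → SP n (Mg g)) = (m : ℕ∞) * LScat (SP n (Mg g))) := by
  refine ⟨fun k _ n g _ => ?_, fun m n g _ _ => ?_⟩
  · rw [LSP.LScat_prod, Nat.cast_sum]
    exact Finset.sum_congr rfl fun j _ => (LSP.LScat_single _ _).symm
  · rw [LSP.LScat_prod (fun _ : Fin m => n) (fun _ => g), LSP.LScat_single]
    simp

end
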